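/- arXiv:2206.09134 — 2 statements merged into one kernel-verified Lean document; each statement's English description precedes it below -/
import Mathlib

section
/- Let 𝕂 be a number field. If 𝒫_{r₁,r₂}(y) = O_{r₁,r₂}(y^{−1/4+δ}) as y → ∞ for every δ > 0, then the Generalized Riemann Hypothesis holds for ζ_𝕂, i.e. every zero ρ of ζ_𝕂 with 0 < Re ρ < 1 satisfies Re ρ = 1/2. -/
open Complex NumberField Filter MeasureTheory Topology

/-- `Z_{r₁,r₂}(x)`, defined as the inverse Mellin transform
`(1/(2πi)) ∫_{Re s = c} Γ^{r₁}(s/2) Γ^{r₂}(s) x^{−s} ds` on the line `Re s = -1/4`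
(the value is independent of the choice of `c ∈ (-1/2, 0)`). -/
noncomputable def Z (r₁ r₂ : ℕ) (x : ℝ) : ℂ :=
  mellinInv (-(1/4)) (fun s => (Complex.Gamma (s / 2)) ^ r₁ * (Complex.Gamma s) ^ r₂) x

/-- `𝒫_{r₁,r₂}(y) = ∑_{m ≥ 1} (b_m/m) Z_{r₁,r₂}(√y/m)`. -/
noncomputable def P (r₁ r₂ : ℕ) (b : ℕ → ℝ) (y : ℝ) : ℂ :=
  ∑' m : ℕ, ((b m : ℂ) / (m : ℂ)) * Z r₁ r₂ (Real.sqrt y / m)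

/-- `‖Γ(z)‖ ≤ Γ(Re z)` on the right half plane. -/
theorem norm_Gamma_le_Gamma_re {z : ℂ} (hz : 0 < z.re) : ‖Gamma z‖ ≤ Real.Gamma z.re := by
  rw [Complex.Gamma_eq_integral hz, Real.Gamma_eq_integral hz, GammaIntegral]
  refine (norm_integral_le_integral_norm _).trans (le_of_eq ?_)
  refine setIntegral_congr_fun measurableSet_Ioi fun x hx => ?_
  have hx' : 0 < x := hx
  simp [norm_cpow_eq_rpow_re_of_pos hx', Complex.norm_exp]

/-- Quadratic decay of `Γ` along vertical lines in `-1/2 < Re z < 0`. -/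
theorem norm_Gamma_le_of_re_mem_Ioo {z : ℂ} (h1 : -(1 / 2) < z.re) (h2 : z.re < 0) :
    ‖Gamma z‖ ≤ 8 / (|z.re| * (1 + z.im ^ 2)) := by
  have hz0 : z ≠ 0 := fun h => by simp [h] at h2
  have hz1 : z + 1 ≠ 0 := fun h => by
    have := congrArg re h; simp at this; linarith
  have hz2 : z + 1 + 1 ≠ 0 := fun h => by
    have := congrArg re h; simp at this; linarith
  have e : Gamma (z + 1 + 1 + 1) = (z + 1 + 1) * ((z + 1) * (z * Gamma z)) := by
    rw [Gamma_add_one _ hz2, Gamma_add_one _ hz1, Gamma_add_one _ hz0]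
  have hG : ‖Gamma (z + 1 + 1 + 1)‖ ≤ 2 := by
    refine (norm_Gamma_le_Gamma_re (by simp; linarith)).trans ?_
    have h3 : Real.Gamma 3 = 2 := by
      rw [show (3 : ℝ) = ((2 : ℕ) : ℝ) + 1 by norm_num, Real.Gamma_nat_eq_factorial]; norm_num
    rw [← h3]
    exact Real.Gamma_strictMonoOn_Ici.monotoneOn (by simp; linarith) (by simp; norm_num)
      (by simp; linarith)
  have key : ∀ w : ℂ, 1 / 2 < w.re → w.im = z.im → (1 + z.im ^ 2) / 4 ≤ ‖w‖ ^ 2 := by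
    intro w hw hi
    rw [← Complex.normSq_eq_norm_sq, normSq_apply, hi]
    nlinarith [sq_nonneg z.im]
  have k1 := key (z + 1) (by simp; linarith) (by simp)
  have k2 := key (z + 1 + 1) (by simp; linarith) (by simp)
  have hq : 0 < 1 + z.im ^ 2 := by positivity
  have k3 : (1 + z.im ^ 2) / 4 ≤ ‖z + 1 + 1‖ * ‖z + 1‖ := by
    refine abs_le_of_sq_le_sq' ?_ (by positivity) |>.2
    rw [mul_pow, sq]
    exact mul_le_mul k2 k1 (by positivity) (by positivity)
  have k4 : |z.re| ≤ ‖z‖ := abs_re_le_norm z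
  have hr : 0 < |z.re| := abs_pos.mpr h2.ne
  rw [e, norm_mul, norm_mul, norm_mul] at hG
  rw [le_div_iff₀ (by positivity)]
  have k5 : (1 + z.im ^ 2) / 4 * (|z.re| * ‖Gamma z‖) ≤ 2 := by
    refine le_trans ?_ hG
    rw [← mul_assoc]
    calc _ ≤ (‖z + 1 + 1‖ * ‖z + 1‖) * (‖z‖ * ‖Gamma z‖) := by
          rw [mul_assoc]; gcongr
      _ = _ := by ring
  nlinarith

/-- The Mellin multiplier `Γ(s/2)^{r₁} Γ(s)^{r₂}`. -/
noncomputable def gammaFactor (r₁ r₂ : ℕ) (s : ℂ) : ℂ := Gamma (s / 2) ^ r₁ * Gamma s ^ r₂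

theorem norm_gammaFactor_le {r₁ r₂ : ℕ} (hr : 1 ≤ r₁ + r₂) {s : ℂ} (h1 : -(1 / 2) < s.re)
    (h2 : s.re < 0) :
    ‖gammaFactor r₁ r₂ s‖ ≤ (64 / |s.re|) ^ (r₁ + r₂) * (1 + s.im ^ 2)⁻¹ := by
  have hr0 : 0 < |s.re| := abs_pos.mpr h2.ne
  have b1 : ‖Gamma s‖ ≤ 64 / |s.re| * (1 + s.im ^ 2)⁻¹ := by
    refine (norm_Gamma_le_of_re_mem_Ioo h1 h2).trans ?_
    rw [← div_eq_mul_inv, div_div]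
    gcongr; norm_num
  have b2 : ‖Gamma (s / 2)‖ ≤ 64 / |s.re| * (1 + s.im ^ 2)⁻¹ := by
    have e1 : (s / 2).re = s.re / 2 := by simp
    have e2 : (s / 2).im = s.im / 2 := by simp
    refine (norm_Gamma_le_of_re_mem_Ioo (by rw [e1]; linarith) (by rw [e1]; linarith)).trans ?_
    rw [e1, e2, ← div_eq_mul_inv, div_div, abs_div, abs_two,
      div_le_div_iff₀ (by positivity) (by positivity)]
    nlinarith [sq_nonneg s.im, mul_nonneg hr0.le (sq_nonneg s.im)]
  have hq : (1 + s.im ^ 2)⁻¹ ≤ 1 := inv_le_one_of_one_le₀ (by nlinarith [sq_nonneg s.im])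
  calc ‖gammaFactor r₁ r₂ s‖ = ‖Gamma (s / 2)‖ ^ r₁ * ‖Gamma s‖ ^ r₂ := by
        rw [gammaFactor, norm_mul, norm_pow, norm_pow]
    _ ≤ (64 / |s.re| * (1 + s.im ^ 2)⁻¹) ^ r₁ * (64 / |s.re| * (1 + s.im ^ 2)⁻¹) ^ r₂ := by
        gcongr
    _ = (64 / |s.re|) ^ (r₁ + r₂) * ((1 + s.im ^ 2)⁻¹) ^ (r₁ + r₂) := by
        rw [← pow_add, mul_pow]
    _ ≤ _ := by
        gcongr
        exact pow_le_of_le_one (by positivity) hq (by omega)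

theorem differentiableAt_gammaFactor (r₁ r₂ : ℕ) {s : ℂ} (h1 : -(1 / 2) < s.re) (h2 : s.re < 0) :
    DifferentiableAt ℂ (gammaFactor r₁ r₂) s := by
  have key : ∀ z : ℂ, -1 < z.re → z.re < 0 → ∀ m : ℕ, z ≠ -m := by
    rintro z hz1 hz2 m rfl
    rw [neg_re, natCast_re] at hz1 hz2
    have h3 : (m : ℝ) < 1 := by linarith
    have h4 : m < 1 := by exact_mod_cast h3
    obtain rfl : m = 0 := by omega
    simp at hz2
  have e1 : (s / 2).re = s.re / 2 := by simp
  have d1 : DifferentiableAt ℂ (fun s : ℂ => Gamma (s / 2)) s :=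
    (differentiableAt_Gamma _ (key _ (by rw [e1]; linarith) (by rw [e1]; linarith))).comp s
      (differentiableAt_id.div_const 2)
  exact (d1.pow _).mul ((differentiableAt_Gamma _ (key _ (by linarith) h2)).pow _)

/-- Shifting a vertical line of integration across a strip of holomorphy. -/
theorem integral_vertical_eq_of_bound {f : ℂ → ℂ} {a b C : ℝ} (hab : a ≤ b)
    (hf : ∀ s : ℂ, a ≤ s.re → s.re ≤ b → DifferentiableAt ℂ f s)
    (hC : ∀ s : ℂ, a ≤ s.re → s.re ≤ b → ‖f s‖ ≤ C * (1 + s.im ^ 2)⁻¹) :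
    ∫ t : ℝ, f (a + t * I) = ∫ t : ℝ, f (b + t * I) := by
  have hcont : ∀ c : ℝ, a ≤ c → c ≤ b → Continuous fun t : ℝ => f (c + t * I) := by
    intro c h1 h2
    refine continuous_iff_continuousAt.mpr fun t => ?_
    exact ContinuousAt.comp (f := fun t : ℝ => (c + t * I : ℂ))
      (hf _ (by simpa using h1) (by simpa using h2)).continuousAt (by fun_prop)
  have hI : ∀ c : ℝ, a ≤ c → c ≤ b → Integrable fun t : ℝ => f (c + t * I) := by
    intro c h1 h2
    refine (integrable_inv_one_add_sq.const_mul C).mono' (hcont c h1 h2).aestronglyMeasurable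
      (Eventually.of_forall fun t => ?_)
    simpa using hC (c + t * I) (by simpa using h1) (by simpa using h2)
  have hlim : ∀ c : ℝ, a ≤ c → c ≤ b → Tendsto (fun T : ℝ => ∫ t in (-T)..T, f (c + t * I)) atTop
      (𝓝 (∫ t : ℝ, f (c + t * I))) := fun c h1 h2 =>
    intervalIntegral_tendsto_integral (hI c h1 h2) tendsto_neg_atTop_atBot tendsto_id
  have hhor : ∀ σ : ℝ, σ = 1 ∨ σ = -1 → Tendsto (fun T : ℝ => ∫ x in a..b, f (x + (σ * T : ℝ) * I))
      atTop (𝓝 0) := by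
    intro σ hσ
    have hσ2 : σ ^ 2 = 1 := by rcases hσ with rfl | rfl <;> norm_num
    have h0 : Tendsto (fun T : ℝ => C * (1 + T ^ 2)⁻¹ * |b - a|) atTop (𝓝 0) := by
      have : Tendsto (fun T : ℝ => (1 + T ^ 2)⁻¹) atTop (𝓝 0) :=
        tendsto_inv_atTop_zero.comp
          (tendsto_atTop_add_const_left _ _ (tendsto_pow_atTop (by norm_num)))
      simpa using (this.const_mul C).mul_const |b - a|
    refine squeeze_zero_norm (fun T => ?_) h0
    refine intervalIntegral.norm_integral_le_of_norm_le_const fun x hx => ?_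
    rw [Set.uIoc_of_le hab] at hx
    have := hC (x + (σ * T : ℝ) * I) (by simpa using hx.1.le) (by simpa using hx.2)
    simpa [mul_pow, hσ2] using this
  have hrect : ∀ T : ℝ, (∫ t in (-T)..T, f (b + t * I)) - (∫ t in (-T)..T, f (a + t * I)) =
      I * ((∫ x in a..b, f (x + ((-1 : ℝ) * T : ℝ) * I)) -
        ∫ x in a..b, f (x + ((1 : ℝ) * T : ℝ) * I)) := by
    intro T
    have := integral_boundary_rect_eq_zero_of_differentiableOn f (a - T * I) (b + T * I) (by
      intro s hs
      rw [mem_reProdIm] at hs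
      have := hs.1
      simp [Set.uIcc_of_le hab] at this
      exact (hf s this.1 this.2).differentiableWithinAt)
    simp at this
    simp only [neg_mul, one_mul, ofReal_neg]
    linear_combination (-I) * this + ((∫ t in (-T)..T, f (b + t * I)) -
      (∫ t in (-T)..T, f (a + t * I))) * I_sq
  have h1 := (hlim b hab le_rfl).sub (hlim a le_rfl hab)
  have h2 := ((hhor (-1) (Or.inr rfl)).sub (hhor 1 (Or.inl rfl))).const_mul I
  rw [sub_zero, mul_zero] at h2
  have := tendsto_nhds_unique (h1.congr hrect) h2
  exact (sub_eq_zero.mp this).symm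

theorem continuous_gammaFactor_vertical (r₁ r₂ : ℕ) {c : ℝ} (h1 : -(1 / 2) < c) (h2 : c < 0) :
    Continuous fun t : ℝ => gammaFactor r₁ r₂ (c + t * I) := by
  refine continuous_iff_continuousAt.mpr fun t => ?_
  exact ContinuousAt.comp (f := fun t : ℝ => (c + t * I : ℂ))
    (differentiableAt_gammaFactor r₁ r₂ (by simpa using h1) (by simpa using h2)).continuousAt
    (by fun_prop)

theorem integrable_gammaFactor_vertical {r₁ r₂ : ℕ} (hr : 1 ≤ r₁ + r₂) {c : ℝ}
    (h1 : -(1 / 2) < c) (h2 : c < 0) :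
    Integrable fun t : ℝ => gammaFactor r₁ r₂ (c + t * I) := by
  refine (integrable_inv_one_add_sq.const_mul ((64 / |c|) ^ (r₁ + r₂))).mono'
    (continuous_gammaFactor_vertical r₁ r₂ h1 h2).aestronglyMeasurable
    (Eventually.of_forall fun t => ?_)
  simpa using norm_gammaFactor_le hr (s := c + t * I) (by simpa using h1) (by simpa using h2)

/-- The inverse Mellin transform of the Gamma factor does not depend on the vertical line. -/
theorem mellinInv_gammaFactor_eq_of_le {r₁ r₂ : ℕ} (hr : 1 ≤ r₁ + r₂) {a b : ℝ}
    (ha : -(1 / 2) < a) (hab : a ≤ b) (hb : b < 0) {x : ℝ} (hx : 0 < x) :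
    mellinInv a (gammaFactor r₁ r₂) x = mellinInv b (gammaFactor r₁ r₂) x := by
  have hx0 : (x : ℂ) ≠ 0 := ofReal_ne_zero.mpr hx.ne'
  rw [mellinInv, mellinInv]
  congr 1
  refine integral_vertical_eq_of_bound
    (f := fun s : ℂ => (x : ℂ) ^ (-s) • gammaFactor r₁ r₂ s)
    (C := (x ^ (-a) + x ^ (-b)) * (64 / |b|) ^ (r₁ + r₂)) hab (fun s h1 h2 => ?_)
    (fun s h1 h2 => ?_)
  · exact ((differentiableAt_id.neg).const_cpow (Or.inl hx0)).smul
      (differentiableAt_gammaFactor r₁ r₂ (by linarith) (by linarith))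
  · rw [norm_smul, norm_cpow_eq_rpow_re_of_pos hx, neg_re, mul_assoc]
    have hbs : |b| ≤ |s.re| := by
      rw [abs_of_neg hb, abs_of_neg (by linarith)]; linarith
    have hb0 : 0 < |b| := abs_pos.mpr hb.ne
    refine mul_le_mul ?_ ((norm_gammaFactor_le hr (by linarith) (by linarith)).trans ?_)
      (norm_nonneg _) (by positivity)
    · rcases le_total 1 x with h | h
      · have := Real.rpow_le_rpow_of_exponent_le h (neg_le_neg h1)
        have := Real.rpow_nonneg hx.le (-b)
        linarith
      · have := Real.rpow_le_rpow_of_exponent_ge hx h (neg_le_neg h2)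
        have := Real.rpow_nonneg hx.le (-a)
        linarith
    · gcongr

theorem Z_eq_mellinInv {r₁ r₂ : ℕ} (hr : 1 ≤ r₁ + r₂) {c : ℝ}
    (h1 : -(1 / 2) < c) (h2 : c < 0) {x : ℝ} (hx : 0 < x) :
    Z r₁ r₂ x = mellinInv c (gammaFactor r₁ r₂) x := by
  change mellinInv (-(1 / 4)) (gammaFactor r₁ r₂) x = _
  rcases le_total c (-(1 / 4)) with h | h
  · exact (mellinInv_gammaFactor_eq_of_le hr h1 h (by norm_num) hx).symm
  · exact mellinInv_gammaFactor_eq_of_le hr (by norm_num) h h2 hx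

theorem exists_norm_Z_le {r₁ r₂ : ℕ} (hr : 1 ≤ r₁ + r₂) {c : ℝ}
    (h1 : -(1 / 2) < c) (h2 : c < 0) :
    ∃ C : ℝ, 0 ≤ C ∧ ∀ x : ℝ, 0 < x → ‖Z r₁ r₂ x‖ ≤ C * x ^ (-c) := by
  refine ⟨|1 / (2 * Real.pi)| * ∫ t : ℝ, ‖gammaFactor r₁ r₂ (c + t * I)‖,
    mul_nonneg (abs_nonneg _) (integral_nonneg fun _ => norm_nonneg _), fun x hx => ?_⟩
  rw [Z_eq_mellinInv hr h1 h2 hx, mellinInv, norm_smul, Real.norm_eq_abs, mul_assoc]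
  refine mul_le_mul_of_nonneg_left ?_ (abs_nonneg _)
  refine (norm_integral_le_integral_norm _).trans (le_of_eq ?_)
  rw [← integral_mul_const]
  congr 1
  ext t
  rw [norm_smul, norm_cpow_eq_rpow_re_of_pos hx, mul_comm]
  simp

theorem verticalIntegrable_scaled {r₁ r₂ : ℕ} (hr : 1 ≤ r₁ + r₂) {c : ℝ}
    (h1 : -(1 / 2) < c) (h2 : c < 0) :
    Integrable fun t : ℝ => gammaFactor r₁ r₂ (c + 2 * Real.pi * t * I) := by
  have := (integrable_gammaFactor_vertical hr h1 h2).comp_mul_left' (R := 2 * Real.pi)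
    (by positivity)
  simpa using this

open FourierTransform in
theorem continuousOn_Z {r₁ r₂ : ℕ} (hr : 1 ≤ r₁ + r₂) :
    ContinuousOn (Z r₁ r₂) (Set.Ioi 0) := by
  have h1 : -(1 / 2 : ℝ) < -(1 / 4) := by norm_num
  have h2 : -(1 / 4 : ℝ) < 0 := by norm_num
  have hF : Continuous (𝓕⁻ fun t : ℝ =>
      gammaFactor r₁ r₂ ((-(1 / 4) : ℝ) + 2 * Real.pi * t * I)) := by
    rw [Real.fourierInv_eq_fourier_comp_neg]
    exact VectorFourier.fourierIntegral_continuous Real.continuous_fourierChar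
      (by fun_prop) (verticalIntegrable_scaled hr h1 h2).comp_neg
  refine ContinuousOn.congr (f := fun x : ℝ => (x : ℂ) ^ (-((-(1 / 4) : ℝ) : ℂ)) •
    (𝓕⁻ fun t : ℝ => gammaFactor r₁ r₂ ((-(1 / 4) : ℝ) + 2 * Real.pi * t * I)) (-Real.log x))
    ?_ fun x hx => ?_
  · simp only [smul_eq_mul]
    refine ContinuousOn.mul (fun x hx => ?_) ?_
    · exact ((continuousAt_ofReal_cpow_const _ _
        (Or.inr (ne_of_gt hx)))).continuousWithinAt
    · exact hF.comp_continuousOn ((Real.continuousOn_log.mono fun x hx => ne_of_gt hx).neg)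
  · rw [Z_eq_mellinInv hr h1 h2 hx]
    exact mellinInv_eq_fourierInv _ _ hx

theorem mellinConvergent_Z {r₁ r₂ : ℕ} (hr : 1 ≤ r₁ + r₂) {s : ℂ}
    (h1 : -(1 / 2) < s.re) (h2 : s.re < 0) : MellinConvergent (Z r₁ r₂) s := by
  obtain ⟨C, -, hC⟩ := exists_norm_Z_le (r₁ := r₁) (r₂ := r₂) hr (c := s.re / 2) (by linarith)
    (by linarith)
  obtain ⟨D, -, hD⟩ := exists_norm_Z_le (r₁ := r₁) (r₂ := r₂) hr (c := (s.re - 1 / 2) / 2)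
    (by linarith) (by linarith)
  refine mellinConvergent_of_isBigO_rpow (a := s.re / 2) (b := (s.re - 1 / 2) / 2)
    ((continuousOn_Z hr).locallyIntegrableOn measurableSet_Ioi) ?_ (by linarith) ?_ (by linarith)
  · refine Asymptotics.IsBigO.of_bound C ?_
    filter_upwards [eventually_gt_atTop 0] with x hx
    rw [Real.norm_of_nonneg (Real.rpow_nonneg hx.le _)]
    exact hC x hx
  · refine Asymptotics.IsBigO.of_bound D ?_
    filter_upwards [self_mem_nhdsWithin] with x hx
    rw [Real.norm_of_nonneg (Real.rpow_nonneg (le_of_lt hx) _)]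
    exact hD x hx

open FourierTransform in
/-- Mellin inversion: `Z` has the Gamma factor as its Mellin transform. -/
theorem mellin_Z {r₁ r₂ : ℕ} (hr : 1 ≤ r₁ + r₂) {s : ℂ}
    (h1 : -(1 / 2) < s.re) (h2 : s.re < 0) : mellin (Z r₁ r₂) s = gammaFactor r₁ r₂ s := by
  set g : ℝ → ℂ := fun t => gammaFactor r₁ r₂ (s.re + 2 * Real.pi * t * I) with hg
  have hgc : Continuous g :=
    (continuous_gammaFactor_vertical r₁ r₂ h1 h2).comp
      (f := fun t : ℝ => 2 * Real.pi * t) (by fun_prop) |>.congr (by intro t; simp [hg])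
  have hgi : Integrable g := verticalIntegrable_scaled hr h1 h2
  have e : (fun u : ℝ => Real.exp (-s.re * u) • Z r₁ r₂ (Real.exp (-u))) = 𝓕⁻ g := by
    ext u
    rw [Z_eq_mellinInv hr h1 h2 (Real.exp_pos _), mellinInv_eq_fourierInv _ _ (Real.exp_pos _),
      Real.log_exp, neg_neg, real_smul, smul_eq_mul, ← mul_assoc]
    have : ((Real.exp (-s.re * u) : ℝ) : ℂ) * ((Real.exp (-u) : ℝ) : ℂ) ^ (-(s.re : ℂ)) = 1 := by
      rw [← ofReal_neg, ← ofReal_cpow (Real.exp_pos _).le, ← ofReal_mul, ← Real.exp_mul,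
        ← Real.exp_add, show -s.re * u + -u * -s.re = 0 by ring, Real.exp_zero, ofReal_one]
    rw [this, one_mul]
  have hI : Integrable (𝓕⁻ g) := by
    rw [← e]
    obtain ⟨C, hC0, hC⟩ := exists_norm_Z_le (r₁ := r₁) (r₂ := r₂) hr (c := s.re / 2)
      (by linarith) (by linarith)
    obtain ⟨D, hD0, hD⟩ := exists_norm_Z_le (r₁ := r₁) (r₂ := r₂) hr (c := (s.re - 1 / 2) / 2)
      (by linarith) (by linarith)
    have hcont : Continuous fun u : ℝ => Real.exp (-s.re * u) • Z r₁ r₂ (Real.exp (-u)) := by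
      have h3 : Continuous fun u : ℝ => Z r₁ r₂ (Real.exp (-u)) :=
        (continuousOn_Z hr).comp_continuous (by fun_prop) fun u => Real.exp_pos _
      fun_prop
    have hb : ∀ (c E : ℝ), (∀ x : ℝ, 0 < x → ‖Z r₁ r₂ x‖ ≤ E * x ^ (-c)) → ∀ u : ℝ,
        ‖Real.exp (-s.re * u) • Z r₁ r₂ (Real.exp (-u))‖ ≤ E * Real.exp ((c - s.re) * u) := by
      intro c E hE u
      rw [norm_smul, Real.norm_of_nonneg (Real.exp_pos _).le]
      calc _ ≤ Real.exp (-s.re * u) * (E * Real.exp (-u) ^ (-c)) := by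
            gcongr; exact hE _ (Real.exp_pos _)
        _ = E * (Real.exp (-s.re * u) * Real.exp (-u * -c)) := by rw [← Real.exp_mul]; ring
        _ = _ := by rw [← Real.exp_add]; ring_nf
    rw [← integrableOn_univ, ← Set.Iic_union_Ioi (a := (0 : ℝ)), integrableOn_union]
    constructor
    · refine Integrable.mono' (((integrableOn_exp_mul_Iic (a := s.re / 2 - s.re)
        (by linarith) 0)).const_mul C) hcont.aestronglyMeasurable
        (Eventually.of_forall (hb _ _ hC))
    · refine Integrable.mono' (((integrableOn_exp_mul_Ioi
        (a := (s.re - 1 / 2) / 2 - s.re) (by linarith) 0)).const_mul D)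
        hcont.aestronglyMeasurable (Eventually.of_forall (hb _ _ hD))
  have hF : Integrable (𝓕 g) := by
    have := hI.comp_neg
    rw [Real.fourierInv_eq_fourier_comp_neg] at hI
    refine this.congr (Eventually.of_forall fun u => ?_)
    simp [Real.fourierInv_eq_fourier_neg]
  rw [mellin_eq_fourier, e, hgc.fourier_fourierInv_eq hgi hF, hg]
  push_cast
  rw [mul_div_cancel₀ _ (by simp [Real.pi_ne_zero]), re_add_im]

theorem mellin_comp_sqrt_div (g : ℝ → ℂ) (w : ℂ) {m : ℕ} (hm : m ≠ 0) :
    mellin (fun y : ℝ => g (Real.sqrt y / m)) w = 2 * (m : ℂ) ^ (2 * w) * mellin g (2 * w) := by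
  have hm0 : (0 : ℝ) < (m : ℝ)⁻¹ := by positivity
  have e : (fun y : ℝ => g (Real.sqrt y / m)) =
      fun y : ℝ => (fun t => g ((m : ℝ)⁻¹ * t)) (y ^ (1 / 2 : ℝ)) := by
    ext y; simp only [Real.sqrt_eq_rpow]; congr 1; ring
  rw [e]
  refine (mellin_comp_rpow (fun t : ℝ => g ((m : ℝ)⁻¹ * t)) w (1 / 2)).trans ?_
  rw [mellin_comp_mul_left _ _ hm0]
  have h2 : w / ((1 / 2 : ℝ) : ℂ) = 2 * w := by push_cast; ring
  have h3 : |(1 / 2 : ℝ)|⁻¹ = 2 := by norm_num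
  rw [h2, h3, real_smul, smul_eq_mul, ofReal_inv, ofReal_natCast,
    inv_cpow _ _ (by rw [natCast_arg]; exact Real.pi_pos.ne), ← cpow_neg, neg_neg]
  push_cast
  ring

theorem MellinConvergent.comp_sqrt_div {g : ℝ → ℂ} {w : ℂ} {m : ℕ} (hm : m ≠ 0)
    (h : MellinConvergent g (2 * w)) :
    MellinConvergent (fun y : ℝ => g (Real.sqrt y / m)) w := by
  have hm0 : (0 : ℝ) < (m : ℝ)⁻¹ := by positivity
  have e : (fun y : ℝ => g (Real.sqrt y / m)) =
      fun y : ℝ => (fun t => g ((m : ℝ)⁻¹ * t)) (y ^ (1 / 2 : ℝ)) := by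
    ext y; simp only [Real.sqrt_eq_rpow]; congr 1; ring
  have h2 : w / ((1 / 2 : ℝ) : ℂ) = 2 * w := by push_cast; ring
  rw [e]
  refine (MellinConvergent.comp_rpow (f := fun t : ℝ => g ((m : ℝ)⁻¹ * t)) (by norm_num)).mpr ?_
  rw [h2, MellinConvergent.comp_mul_left hm0]
  exact h

theorem integral_norm_mellin_eq (h : ℝ → ℂ) (w : ℂ) :
    ((∫ y in Set.Ioi (0 : ℝ), ‖(y : ℂ) ^ (w - 1) • h y‖ : ℝ) : ℂ) =
      mellin (fun y => (‖h y‖ : ℂ)) w.re := by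
  rw [mellin, ← integral_complex_ofReal]
  refine setIntegral_congr_fun measurableSet_Ioi fun y hy => ?_
  have hy' : (0 : ℝ) < y := hy
  simp only [smul_eq_mul, norm_mul, norm_cpow_eq_rpow_re_of_pos hy', ofReal_mul]
  rw [ofReal_cpow hy'.le]
  simp

section RieszFunction

variable {r₁ r₂ : ℕ} {b : ℕ → ℝ}

/-- Termwise bound for the series `P`. -/
theorem norm_P_term_le {c C : ℝ} (hC : ∀ x : ℝ, 0 < x → ‖Z r₁ r₂ x‖ ≤ C * x ^ (-c))
    {y : ℝ} (hy : 0 < y) (m : ℕ) :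
    ‖((b m : ℂ) / (m : ℂ)) * Z r₁ r₂ (Real.sqrt y / m)‖ ≤
      |b m| * (m : ℝ) ^ (-(1 - c)) * (C * y ^ (-c / 2)) := by
  rcases Nat.eq_zero_or_pos m with rfl | hm
  · have hC0 : 0 ≤ C := by simpa using (norm_nonneg _).trans (hC 1 one_pos)
    simp only [CharP.cast_eq_zero, div_zero, zero_mul, norm_zero]
    positivity
  · have hm0 : (0 : ℝ) < m := by exact_mod_cast hm
    have hs : 0 < Real.sqrt y := Real.sqrt_pos.mpr hy
    rw [norm_mul, norm_div, norm_real, Complex.norm_natCast, Real.norm_eq_abs]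
    refine (mul_le_mul_of_nonneg_left (hC _ (by positivity)) (by positivity)).trans (le_of_eq ?_)
    rw [Real.div_rpow hs.le hm0.le, Real.sqrt_eq_rpow, ← Real.rpow_mul hy.le,
      show -(1 - c) = -1 - -c by ring, Real.rpow_sub hm0, Real.rpow_neg_one]
    rw [show 1 / 2 * -c = -c / 2 by ring]
    field_simp

theorem summable_P_bound (hb : ∀ σ : ℝ, 1 < σ → Summable fun m : ℕ => |b m| * (m : ℝ) ^ (-σ))
    {c : ℝ} (hc : c < 0) (D : ℝ) :
    Summable fun m : ℕ => |b m| * (m : ℝ) ^ (-(1 - c)) * D :=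
  (hb (1 - c) (by linarith)).mul_right D

theorem exists_norm_P_le (hr : 1 ≤ r₁ + r₂)
    (hb : ∀ σ : ℝ, 1 < σ → Summable fun m : ℕ => |b m| * (m : ℝ) ^ (-σ))
    {c : ℝ} (h1 : -(1 / 2) < c) (h2 : c < 0) :
    ∃ C : ℝ, ∀ y : ℝ, 0 < y → ‖P r₁ r₂ b y‖ ≤ C * y ^ (-c / 2) := by
  obtain ⟨C, -, hC⟩ := exists_norm_Z_le (r₁ := r₁) (r₂ := r₂) hr h1 h2
  refine ⟨(∑' m : ℕ, |b m| * (m : ℝ) ^ (-(1 - c))) * C, fun y hy => ?_⟩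
  rw [mul_assoc, ← tsum_mul_right]
  exact tsum_of_norm_bounded (summable_P_bound hb h2 _).hasSum
    fun m => norm_P_term_le hC hy m

theorem continuousOn_P (hr : 1 ≤ r₁ + r₂)
    (hb : ∀ σ : ℝ, 1 < σ → Summable fun m : ℕ => |b m| * (m : ℝ) ^ (-σ)) :
    ContinuousOn (P r₁ r₂ b) (Set.Ioi 0) := by
  obtain ⟨C, hC0, hC⟩ := exists_norm_Z_le (r₁ := r₁) (r₂ := r₂) hr (c := -(1 / 4)) (by norm_num)
    (by norm_num)
  have key : ∀ R : ℝ, ContinuousOn (P r₁ r₂ b) (Set.Ioo 0 R) := by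
    intro R
    refine continuousOn_tsum (u := fun m : ℕ => |b m| * (m : ℝ) ^ (-(1 - (-(1 / 4)) : ℝ)) *
      (C * R ^ (-(-(1 / 4)) / 2 : ℝ))) (fun m => ?_) (summable_P_bound hb (by norm_num) _)
      fun m y hy => ?_
    · rcases Nat.eq_zero_or_pos m with rfl | hm
      · simpa using continuousOn_const
      · refine continuousOn_const.mul ((continuousOn_Z hr).comp (by fun_prop) fun y hy => ?_)
        have := Real.sqrt_pos.mpr hy.1
        exact div_pos this (by exact_mod_cast hm)
    · refine (norm_P_term_le hC hy.1 m).trans ?_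
      have := hy.1.le
      have := hy.2.le
      gcongr
  intro y hy
  have hy' : (0 : ℝ) < y := hy
  exact ((key (y + 1)).continuousAt (Ioo_mem_nhds hy' (by linarith))).continuousWithinAt

/-- The Mellin transform of `P` in the half strip where its defining series can be integrated
termwise. -/
theorem mellin_P (hr : 1 ≤ r₁ + r₂)
    (hb : ∀ σ : ℝ, 1 < σ → Summable fun m : ℕ => |b m| * (m : ℝ) ^ (-σ))
    {w L : ℂ} (h1 : -(1 / 4) < w.re) (h2 : w.re < 0)
    (hL : HasSum (fun m : ℕ => (b m : ℂ) * (m : ℂ) ^ (-(1 - 2 * w))) L) :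
    mellin (P r₁ r₂ b) w = 2 * gammaFactor r₁ r₂ (2 * w) * L := by
  have e2 : (2 * w).re = 2 * w.re := by simp
  have hconv := mellinConvergent_Z (r₁ := r₁) (r₂ := r₂) hr (s := 2 * w) (by rw [e2]; linarith)
    (by rw [e2]; linarith)
  set F : ℕ → ℝ → ℂ := fun m y =>
    (y : ℂ) ^ (w - 1) • (((b m : ℂ) / (m : ℂ)) * Z r₁ r₂ (Real.sqrt y / m)) with hF
  have hF0 : F 0 = 0 := by ext y; simp [hF]
  have hFi : ∀ m, IntegrableOn (F m) (Set.Ioi 0) := by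
    intro m
    rcases eq_or_ne m 0 with rfl | hm
    · rw [hF0]; exact integrableOn_zero
    · exact (hconv.comp_sqrt_div hm).const_smul ((b m : ℂ) / (m : ℂ))
  have hpow : ∀ m : ℕ, m ≠ 0 → ∀ z : ℂ, (m : ℂ) ^ (-(1 - z)) = (m : ℂ) ^ z / m := by
    intro m hm z
    rw [neg_sub, cpow_sub _ _ (by exact_mod_cast hm), cpow_one]
  have hFint : ∀ m, ∫ y in Set.Ioi (0 : ℝ), F m y =
      2 * gammaFactor r₁ r₂ (2 * w) * ((b m : ℂ) * (m : ℂ) ^ (-(1 - 2 * w))) := by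
    intro m
    rcases eq_or_ne m 0 with rfl | hm
    · rw [hF0]
      have : 2 * w - 1 ≠ 0 := fun h => by
        have := congrArg re h; simp at this; linarith
      simp [this]
    · change mellin (fun y => ((b m : ℂ) / (m : ℂ)) • Z r₁ r₂ (Real.sqrt y / m)) w = _
      rw [mellin_const_smul, mellin_comp_sqrt_div _ _ hm, mellin_Z hr (by rw [e2]; linarith)
        (by rw [e2]; linarith), smul_eq_mul, hpow m hm]
      ring
  have hFnorm : ∀ m, ∫ y in Set.Ioi (0 : ℝ), ‖F m y‖ ≤ |b m| * (m : ℝ) ^ (-(1 - 2 * w.re)) *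
      (2 * ‖mellin (fun y => (‖Z r₁ r₂ y‖ : ℂ)) (2 * w.re)‖) := by
    intro m
    rcases eq_or_ne m 0 with rfl | hm
    · rw [hF0]; simp only [Pi.zero_apply, norm_zero, integral_zero]; positivity
    · have h := integral_norm_mellin_eq
        (fun y => ((b m : ℂ) / (m : ℂ)) * Z r₁ r₂ (Real.sqrt y / m)) w
      simp only [norm_mul, norm_div, norm_real, Complex.norm_natCast, ofReal_mul, ofReal_div,
        ofReal_natCast] at h
      have h' := mellin_const_smul (fun y => (‖Z r₁ r₂ (Real.sqrt y / m)‖ : ℂ)) (w.re : ℂ)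
        ((‖b m‖ : ℂ) / (m : ℂ))
      simp only [smul_eq_mul] at h'
      rw [h', mellin_comp_sqrt_div (fun x => (‖Z r₁ r₂ x‖ : ℂ)) _ hm] at h
      have hm0 : (0 : ℝ) < m := by positivity
      have h3 := congrArg norm h
      rw [norm_real, Real.norm_eq_abs] at h3
      refine (le_abs_self _).trans (le_of_eq ?_)
      simp only [hF, norm_smul, norm_mul, norm_div, norm_real, Complex.norm_natCast] at h3 ⊢
      rw [h3, norm_natCast_cpow_of_pos (Nat.pos_of_ne_zero hm),
        show -(1 - 2 * w.re) = 2 * w.re - 1 by ring, Real.rpow_sub hm0, Real.rpow_one]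
      simp
      ring
  have hs := hasSum_integral_of_summable_integral_norm (μ := volume.restrict (Set.Ioi (0 : ℝ)))
    hFi (Summable.of_nonneg_of_le (fun m => integral_nonneg fun _ => norm_nonneg _) hFnorm
      (summable_P_bound hb (by linarith) _))
  simp_rw [hFint] at hs
  rw [(hL.mul_left (2 * gammaFactor r₁ r₂ (2 * w))).unique hs, mellin]
  congr 1
  ext y
  rw [P, smul_eq_mul, ← tsum_mul_left]
  simp [hF]

theorem differentiableAt_mellin_P (hr : 1 ≤ r₁ + r₂)
    (hb : ∀ σ : ℝ, 1 < σ → Summable fun m : ℕ => |b m| * (m : ℝ) ^ (-σ))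
    (hP : ∀ δ : ℝ, 0 < δ →
      (fun y : ℝ => P r₁ r₂ b y) =O[atTop] fun y : ℝ => y ^ (-(1/4 : ℝ) + δ))
    {w : ℂ} (h1 : -(1 / 4) < w.re) (h2 : w.re < 1 / 4) :
    DifferentiableAt ℂ (mellin (P r₁ r₂ b)) w := by
  obtain ⟨c, hc1, hc2⟩ : ∃ c : ℝ, -(1 / 4) < c ∧ c < min w.re 0 :=
    exists_between (lt_min h1 (by norm_num))
  obtain ⟨C, hC⟩ := exists_norm_P_le (r₁ := r₁) (r₂ := r₂) hr hb (c := 2 * c) (by linarith)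
    (by linarith [min_le_right w.re 0])
  have hPδ := hP ((1 / 4 - w.re) / 2) (by linarith)
  rw [show -(1 / 4 : ℝ) + (1 / 4 - w.re) / 2 = -(1 / 4 - (1 / 4 - w.re) / 2) by ring] at hPδ
  refine mellin_differentiableAt_of_isBigO_rpow
    ((continuousOn_P hr hb).locallyIntegrableOn measurableSet_Ioi) hPδ (by linarith) (b := c) ?_
    (lt_of_lt_of_le hc2 (min_le_left _ _))
  refine Asymptotics.IsBigO.of_bound C ?_
  filter_upwards [self_mem_nhdsWithin] with y hy
  rw [Real.norm_of_nonneg (Real.rpow_nonneg (le_of_lt hy) _)]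
  have := hC y hy
  rwa [show -(2 * c) / 2 = -c by ring] at this

end RieszFunction

/-- Removing the simple pole at `1` by multiplying with `s - 1`. -/
theorem exists_entire_of_simple_pole {f : ℂ → ℂ}
    (hf : ∀ s : ℂ, s ≠ 1 → DifferentiableAt ℂ f s) {A : ℂ}
    (hA : Tendsto (fun s : ℂ => (s - 1) * f s) (𝓝[≠] (1 : ℂ)) (𝓝 A)) :
    ∃ H : ℂ → ℂ, Differentiable ℂ H ∧ H 1 = A ∧ ∀ s, s ≠ 1 → H s = (s - 1) * f s := by
  refine ⟨Function.update (fun s => (s - 1) * f s) 1 A, ?_, by simp,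
    fun s hs => Function.update_of_ne hs _ _⟩
  have hd : ∀ s : ℂ, s ≠ 1 →
      DifferentiableAt ℂ (Function.update (fun s => (s - 1) * f s) 1 A) s := by
    intro s hs
    have h : DifferentiableAt ℂ (fun s => (s - 1) * f s) s :=
      (differentiableAt_id.sub_const 1).mul (hf s hs)
    refine h.congr_of_eventuallyEq ?_
    filter_upwards [isOpen_ne.mem_nhds hs] with z hz
    exact Function.update_of_ne hz _ _
  intro s
  rcases eq_or_ne s 1 with rfl | hs
  · refine (analyticAt_of_differentiable_on_punctured_nhds_of_continuousAt ?_
      (continuousAt_update_same.mpr hA)).differentiableAt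
    filter_upwards [self_mem_nhdsWithin] with z hz
    exact hd z hz
  · exact hd s hs

section RieszCriterion

variable {r₁ r₂ : ℕ} {b : ℕ → ℝ}

theorem summable_abs_mul_rpow_of_hasSum {f : ℂ → ℂ}
    (hb : ∀ s : ℂ, 1 < s.re → HasSum (fun m : ℕ => (b m : ℂ) * (m : ℂ) ^ (-s)) (f s))
    (σ : ℝ) (hσ : 1 < σ) : Summable fun m : ℕ => |b m| * (m : ℝ) ^ (-σ) := by
  refine (hb σ (by simpa using hσ)).summable.norm.congr fun m => ?_
  rw [norm_mul, norm_real, Real.norm_eq_abs, ← ofReal_neg, ← ofReal_natCast m,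
    ← ofReal_cpow (Nat.cast_nonneg m), norm_real,
    Real.norm_of_nonneg (Real.rpow_nonneg (Nat.cast_nonneg m) _)]

/-- The functional identity satisfied by the Mellin transform of `P` on the strip
`|Re w| < 1/4`. -/
theorem mellin_P_mul_eq {ζ H : ℂ → ℂ} (hr : 1 ≤ r₁ + r₂) (hH : Differentiable ℂ H)
    (hH1 : H 1 ≠ 0) (hHζ : ∀ s, s ≠ 1 → H s = (s - 1) * ζ s)
    (hb : ∀ s : ℂ, 1 < s.re →
      HasSum (fun m : ℕ => (b m : ℂ) * (m : ℂ) ^ (-s)) (ζ s)⁻¹)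
    (hP : ∀ δ : ℝ, 0 < δ →
      (fun y : ℝ => P r₁ r₂ b y) =O[atTop] fun y : ℝ => y ^ (-(1/4 : ℝ) + δ))
    {w : ℂ} (h1 : -(1 / 4) < w.re) (h2 : w.re < 1 / 4) :
    mellin (P r₁ r₂ b) w * H (1 - 2 * w) * ((Gamma w)⁻¹ ^ r₁ * (Gamma (2 * w))⁻¹ ^ r₂) =
      -4 * w := by
  have hb' := summable_abs_mul_rpow_of_hasSum hb
  set U : Set ℂ := re ⁻¹' Set.Ioo (-(1 / 4)) (1 / 4) with hU
  have hUo : IsOpen U := isOpen_Ioo.preimage continuous_re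
  have hUc : IsPreconnected U :=
    ((convex_Ioo _ _).is_linear_preimage reLm.isLinear).isPreconnected
  have hG : Differentiable ℂ fun w : ℂ => (Gamma w)⁻¹ := differentiable_one_div_Gamma
  have hG2 : Differentiable ℂ fun w : ℂ => (Gamma (2 * w))⁻¹ :=
    hG.comp (differentiable_id.const_mul 2)
  have hH2 : Differentiable ℂ fun w : ℂ => H (1 - 2 * w) :=
    hH.comp ((differentiable_id.const_mul 2).const_sub 1)
  have hl : AnalyticOnNhd ℂ (fun w => mellin (P r₁ r₂ b) w * H (1 - 2 * w) *
      ((Gamma w)⁻¹ ^ r₁ * (Gamma (2 * w))⁻¹ ^ r₂)) U := by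
    refine DifferentiableOn.analyticOnNhd (fun z hz => ?_) hUo
    exact (((differentiableAt_mellin_P hr hb' hP hz.1 hz.2).mul (hH2 z)).mul
      (((hG z).pow _).mul ((hG2 z).pow _))).differentiableWithinAt
  have hrr : AnalyticOnNhd ℂ (fun w : ℂ => -4 * w) U :=
    DifferentiableOn.analyticOnNhd (by fun_prop) hUo
  refine hl.eqOn_of_preconnected_of_frequently_eq hrr hUc (z₀ := 0) (by simp [hU]) ?_ ⟨h1, h2⟩
  have hev : ∀ᶠ z : ℂ in 𝓝[≠] 0, H (1 - 2 * z) ≠ 0 := by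
    refine (hH2.continuous.continuousAt.eventually_ne ?_).filter_mono nhdsWithin_le_nhds
    simpa using hH1
  have hfr : ∃ᶠ z : ℂ in 𝓝[≠] 0, -(1 / 4) < z.re ∧ z.re < 0 := by
    have ht : Tendsto (fun x : ℝ => (x : ℂ)) (𝓝[<] 0) (𝓝[≠] 0) := by
      refine tendsto_nhdsWithin_iff.mpr ⟨?_, ?_⟩
      · exact (continuous_ofReal.tendsto' 0 0 ofReal_zero).mono_left nhdsWithin_le_nhds
      · filter_upwards [self_mem_nhdsWithin] with x hx
        exact ofReal_ne_zero.mpr (ne_of_lt hx)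
    refine ht.frequently (Eventually.frequently ?_)
    filter_upwards [Ioo_mem_nhdsLT (show -(1 / 4 : ℝ) < 0 by norm_num)] with x hx
    simpa using hx
  refine (hfr.and_eventually hev).mono fun z ⟨⟨hz1, hz2⟩, hz⟩ => ?_
  have hz0 : z ≠ 0 := by rintro rfl; simp at hz2
  have hne : 1 - 2 * z ≠ 1 := by simpa using hz0
  have e2 : (2 * z).re = 2 * z.re := by simp
  have hΓ : ∀ u : ℂ, -1 < u.re → u.re < 0 → Gamma u ≠ 0 := by
    intro u hu1 hu2
    refine Gamma_ne_zero fun m hm => ?_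
    have := congrArg re hm
    simp only [neg_re, natCast_re] at this
    rw [this] at hu1 hu2
    have h3 : m < 1 := by exact_mod_cast (by linarith : (m : ℝ) < 1)
    have h4 : 0 < m := by exact_mod_cast (by linarith : (0 : ℝ) < (m : ℝ))
    omega
  have hΓ1 := hΓ z (by linarith) hz2
  have hΓ2 := hΓ (2 * z) (by linarith) (by linarith)
  rw [mellin_P hr hb' hz1 hz2 (hb (1 - 2 * z) (by simp; linarith)), gammaFactor,
    show 2 * z / 2 = z by ring]
  rw [hHζ _ hne] at hz ⊢
  have hζ0 : ζ (1 - 2 * z) ≠ 0 := right_ne_zero_of_mul hz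
  simp only [inv_pow]
  field_simp
  ring

theorem ne_zero_of_isBigO {ζ H : ℂ → ℂ} (hr : 1 ≤ r₁ + r₂) (hH : Differentiable ℂ H)
    (hH1 : H 1 ≠ 0) (hHζ : ∀ s, s ≠ 1 → H s = (s - 1) * ζ s)
    (hb : ∀ s : ℂ, 1 < s.re →
      HasSum (fun m : ℕ => (b m : ℂ) * (m : ℂ) ^ (-s)) (ζ s)⁻¹)
    (hP : ∀ δ : ℝ, 0 < δ →
      (fun y : ℝ => P r₁ r₂ b y) =O[atTop] fun y : ℝ => y ^ (-(1/4 : ℝ) + δ))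
    {ρ : ℂ} (h1 : 1 / 2 < ρ.re) (h2 : ρ.re < 1) : ζ ρ ≠ 0 := by
  intro h0
  have hρ : ρ ≠ 1 := by rintro rfl; simp at h2
  have e : ((1 - ρ) / 2).re = (1 - ρ.re) / 2 := by simp
  have h := mellin_P_mul_eq hr hH hH1 hHζ hb hP (w := (1 - ρ) / 2) (by rw [e]; linarith)
    (by rw [e]; linarith)
  rw [show 1 - 2 * ((1 - ρ) / 2) = ρ by ring, hHζ ρ hρ, h0] at h
  simp only [mul_zero, zero_mul, zero_eq_mul, neg_eq_zero, div_eq_zero_iff, sub_eq_zero] at h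
  rcases h with h | h | h
  · norm_num at h
  · exact hρ h.symm
  · norm_num at h

/-- The bound on `P` is only possible when there is exactly one infinite place. -/
theorem add_eq_one_of_isBigO {ζ H : ℂ → ℂ} (hr : 1 ≤ r₁ + r₂) (hH : Differentiable ℂ H)
    (hH1 : H 1 ≠ 0) (hHζ : ∀ s, s ≠ 1 → H s = (s - 1) * ζ s)
    (hb : ∀ s : ℂ, 1 < s.re →
      HasSum (fun m : ℕ => (b m : ℂ) * (m : ℂ) ^ (-s)) (ζ s)⁻¹)
    (hP : ∀ δ : ℝ, 0 < δ →
      (fun y : ℝ => P r₁ r₂ b y) =O[atTop] fun y : ℝ => y ^ (-(1/4 : ℝ) + δ)) :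
    r₁ + r₂ = 1 := by
  by_contra hne
  obtain ⟨k, hk⟩ : ∃ k, r₁ + r₂ = k + 1 + 1 := ⟨r₁ + r₂ - 2, by omega⟩
  have hb' := summable_abs_mul_rpow_of_hasSum hb
  have hG : Differentiable ℂ fun w : ℂ => (Gamma w)⁻¹ := differentiable_one_div_Gamma
  have hinv : ∀ w : ℂ, w ≠ 0 → (Gamma w)⁻¹ = w * (Gamma (w + 1))⁻¹ := by
    intro w hw
    rw [Gamma_add_one w hw, mul_inv, mul_inv_cancel_left₀ hw]
  set F : ℂ → ℂ := fun w => mellin (P r₁ r₂ b) w * H (1 - 2 * w) *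
      ((Gamma (w + 1))⁻¹ ^ r₁ * (2 * (Gamma (2 * w + 1))⁻¹) ^ r₂) * w ^ (k + 1) with hF
  have hFc : ContinuousAt F 0 := by
    have hM := (differentiableAt_mellin_P (r₁ := r₁) (r₂ := r₂) hr hb' hP (w := 0) (by simp)
      (by simp)).continuousAt
    have hHc : Continuous fun w : ℂ => H (1 - 2 * w) := hH.continuous.comp (by fun_prop)
    have h1 : Continuous fun w : ℂ => (Gamma (w + 1))⁻¹ :=
      hG.continuous.comp (by fun_prop : Continuous fun w : ℂ => w + 1)
    have h2 : Continuous fun w : ℂ => (Gamma (2 * w + 1))⁻¹ :=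
      hG.continuous.comp (by fun_prop : Continuous fun w : ℂ => 2 * w + 1)
    exact ((hM.mul hHc.continuousAt).mul ((h1.pow _).mul
      ((continuous_const.mul h2).pow _)).continuousAt).mul (by fun_prop)
  have hF4 : ∀ᶠ w in 𝓝[≠] (0 : ℂ), F w = -4 := by
    have hnear : ∀ᶠ w in 𝓝 (0 : ℂ), w.re ∈ Set.Ioo (-(1 / 4)) (1 / 4) :=
      continuous_re.continuousAt.eventually (Ioo_mem_nhds (by simp) (by simp))
    filter_upwards [self_mem_nhdsWithin, hnear.filter_mono nhdsWithin_le_nhds] with w hw0 hw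
    have hw0' : w ≠ 0 := hw0
    have h := mellin_P_mul_eq hr hH hH1 hHζ hb hP hw.1 hw.2
    rw [hinv w hw0', hinv (2 * w) (by simpa using hw0')] at h
    refine mul_right_cancel₀ hw0' ?_
    rw [← h, hF]
    dsimp only
    rw [mul_assoc _ (w ^ (k + 1)) w, ← pow_succ, ← hk, pow_add]
    ring
  have h1 : Tendsto F (𝓝[≠] 0) (𝓝 (F 0)) := hFc.tendsto.mono_left nhdsWithin_le_nhds
  have h2 : Tendsto F (𝓝[≠] 0) (𝓝 (-4)) :=
    tendsto_const_nhds.congr' (hF4.mono fun _ h => h.symm)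
  have h3 := tendsto_nhds_unique h1 h2
  simp [hF] at h3

end RieszCriterion

section IdealCount

variable {K : Type*} [Field K] [NumberField K]

variable (K) in
/-- The number of ideals of norm `n` in the ring of integers of `K`. -/
noncomputable def idealCount (n : ℕ) : ℕ :=
  Nat.card {I : Ideal (𝓞 K) // Ideal.absNorm I = n}

theorem finite_absNorm_eq (n : ℕ) : Finite {I : Ideal (𝓞 K) // Ideal.absNorm I = n} :=
  (Ideal.finite_setOfPred_absNorm_eq n).to_subtype

/-- Grouping the Dedekind zeta series by norms. -/
theorem hasSum_idealCount {s z : ℂ} (hs : 1 < s.re)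
    (h : HasSum (fun I : {I : Ideal (𝓞 K) // I ≠ ⊥} =>
      ((Ideal.absNorm I.1 : ℕ) : ℂ) ^ (-s)) z) :
    HasSum (fun n : ℕ => (idealCount K n : ℂ) * (n : ℂ) ^ (-s)) z := by
  have hs0 : -s ≠ 0 := fun h0 => by
    have := congrArg re h0
    simp only [neg_re, zero_re] at this
    linarith
  have h1 : HasSum (fun I : Ideal (𝓞 K) => ((Ideal.absNorm I : ℕ) : ℂ) ^ (-s)) z := by
    refine (hasSum_subtype_iff_of_support_subset (s := {I : Ideal (𝓞 K) | I ≠ ⊥}) ?_).mp h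
    intro I hI hbot
    have : I = ⊥ := hbot
    simp [this, zero_cpow hs0] at hI
  have h2 := (Equiv.hasSum_iff (Equiv.sigmaFiberEquiv
    (fun I : Ideal (𝓞 K) => Ideal.absNorm I))).mpr h1
  refine h2.sigma fun n => ?_
  have := finite_absNorm_eq (K := K) n
  have := Fintype.ofFinite {I : Ideal (𝓞 K) // Ideal.absNorm I = n}
  have h3 : (idealCount K n : ℂ) * (n : ℂ) ^ (-s) =
      ∑ I : {I : Ideal (𝓞 K) // Ideal.absNorm I = n},
        ((Ideal.absNorm I.1 : ℕ) : ℂ) ^ (-s) := by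
    rw [Finset.sum_congr rfl (g := fun _ => (n : ℂ) ^ (-s)) fun I _ => by rw [I.2]]
    simp [idealCount]
  rw [h3]
  exact hasSum_fintype _

theorem eq_of_dvd_of_absNorm_eq {I J : Ideal (𝓞 K)} (h : I ∣ J)
    (hN : Ideal.absNorm I = Ideal.absNorm J) (h0 : Ideal.absNorm I ≠ 0) : I = J := by
  obtain ⟨L, rfl⟩ := h
  rw [map_mul] at hN
  have : Ideal.absNorm L = 1 := by
    have h1 : 0 < Ideal.absNorm I := Nat.pos_of_ne_zero h0
    nlinarith
  rw [Ideal.absNorm_eq_one_iff] at this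
  rw [this, Ideal.mul_top]

theorem dvd_span_natCast_absNorm (I : Ideal (𝓞 K)) {n : ℕ} (h : Ideal.absNorm I = n) :
    I ∣ Ideal.span {(n : 𝓞 K)} := by
  rw [Ideal.dvd_iff_le, ← h]
  exact Ideal.span_singleton_absNorm_le I

theorem isCoprime_span_natCast {R : Type*} [CommRing R] {m n : ℕ} (h : m.Coprime n) :
    IsCoprime (Ideal.span {(m : R)}) (Ideal.span {(n : R)}) := by
  rw [Ideal.isCoprime_span_singleton_iff]
  simpa using (Nat.isCoprime_iff_coprime.mpr h).map (Int.castRingHom R)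

theorem isCoprime_of_absNorm_coprime {I J : Ideal (𝓞 K)} {m n : ℕ}
    (hI : Ideal.absNorm I = m) (hJ : Ideal.absNorm J = n) (h : m.Coprime n) : IsCoprime I J :=
  ((isCoprime_span_natCast h).of_isCoprime_of_dvd_left
    (dvd_span_natCast_absNorm I hI)).of_isCoprime_of_dvd_right (dvd_span_natCast_absNorm J hJ)

theorem idealCount_one : idealCount K 1 = 1 := by
  rw [idealCount, Nat.card_eq_one_iff_unique]
  exact ⟨⟨fun I J => Subtype.ext <| (Ideal.absNorm_eq_one_iff.mp I.2).trans
    (Ideal.absNorm_eq_one_iff.mp J.2).symm⟩, ⟨⟨⊤, Ideal.absNorm_top⟩⟩⟩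

theorem idealCount_mul {m n : ℕ} (h : m.Coprime n) :
    idealCount K (m * n) = idealCount K m * idealCount K n := by
  rcases Nat.eq_zero_or_pos m with rfl | hm
  · obtain rfl : n = 1 := by simpa using h
    simp [idealCount_one]
  rcases Nat.eq_zero_or_pos n with rfl | hn
  · obtain rfl : m = 1 := by simpa using h
    simp [idealCount_one]
  rw [idealCount, idealCount, idealCount, ← Nat.card_prod]
  symm
  refine Nat.card_eq_of_bijective (fun x : {I : Ideal (𝓞 K) // Ideal.absNorm I = m} ×
    {I : Ideal (𝓞 K) // Ideal.absNorm I = n} => ⟨x.1.1 * x.2.1, by rw [map_mul, x.1.2, x.2.2]⟩)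
    ⟨?_, ?_⟩
  · rintro ⟨⟨I, hI⟩, ⟨J, hJ⟩⟩ ⟨⟨I', hI'⟩, ⟨J', hJ'⟩⟩ hx
    have hx' : I * J = I' * J' := congrArg Subtype.val hx
    have e1 : I = I' := by
      refine eq_of_dvd_of_absNorm_eq ?_ (hI.trans hI'.symm) (by omega)
      exact (isCoprime_of_absNorm_coprime hI hJ' h).dvd_of_dvd_mul_right
        (hx' ▸ dvd_mul_right I J)
    have e2 : J = J' := by
      refine eq_of_dvd_of_absNorm_eq ?_ (hJ.trans hJ'.symm) (by omega)
      exact (isCoprime_of_absNorm_coprime hJ hI' h.symm).dvd_of_dvd_mul_left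
        (hx' ▸ dvd_mul_left J I)
    subst e1 e2
    rfl
  · rintro ⟨I, hI⟩
    set A := I + Ideal.span {(m : 𝓞 K)} with hA
    set B := I + Ideal.span {(n : 𝓞 K)} with hB
    have hAB : A * B = I := by
      have hmn : Ideal.span {(m : 𝓞 K)} * Ideal.span {(n : 𝓞 K)} ≤ I := by
        rw [Ideal.span_singleton_mul_span_singleton, ← Nat.cast_mul, ← hI]
        exact Ideal.span_singleton_absNorm_le I
      have h1 : Ideal.span {(m : 𝓞 K)} + Ideal.span {(n : 𝓞 K)} = 1 :=
        Ideal.isCoprime_iff_add.mp (isCoprime_span_natCast h)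
      have h2 : A * B = I * (I + (Ideal.span {(m : 𝓞 K)} + Ideal.span {(n : 𝓞 K)})) +
          Ideal.span {(m : 𝓞 K)} * Ideal.span {(n : 𝓞 K)} := by rw [hA, hB]; ring
      rw [h2, h1, Ideal.one_eq_top, Ideal.add_eq_sup, Ideal.add_eq_sup, sup_top_eq, Ideal.mul_top]
      exact sup_eq_left.mpr hmn
    have hN : Ideal.absNorm A * Ideal.absNorm B = m * n := by rw [← map_mul, hAB, hI]
    have hdvd : ∀ (k l : ℕ) (C : Ideal (𝓞 K)), k.Coprime l → Ideal.absNorm C ∣ k * l →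
        Ideal.span {(k : 𝓞 K)} ≤ C → Ideal.absNorm C ∣ k := by
      intro k l C hkl h1 h2
      refine Nat.Coprime.dvd_of_dvd_mul_right ?_ h1
      have h3 := Ideal.absNorm_dvd_absNorm_of_le h2
      rw [Ideal.absNorm_span_natCast] at h3
      exact Nat.Coprime.of_dvd_left h3 (hkl.pow_left _)
    have hAm : Ideal.absNorm A ∣ m :=
      hdvd m n A h (hN ▸ dvd_mul_right _ _) le_sup_right
    have hBn : Ideal.absNorm B ∣ n :=
      hdvd n m B h.symm (mul_comm m n ▸ hN ▸ dvd_mul_left _ _) le_sup_right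
    have hAle := Nat.le_of_dvd hm hAm
    have hBle := Nat.le_of_dvd hn hBn
    have hA' : Ideal.absNorm A = m := by
      refine le_antisymm hAle (Nat.le_of_mul_le_mul_right ?_ hn)
      rw [← hN]
      exact Nat.mul_le_mul_left _ hBle
    have hB' : Ideal.absNorm B = n := by
      rw [hA'] at hN
      exact Nat.eq_of_mul_eq_mul_left hm hN
    exact ⟨⟨⟨A, hA'⟩, ⟨B, hB'⟩⟩, Subtype.ext hAB⟩

/-- Multiplication by `P` identifies ideals of norm `n` with multiples of `P`. -/
theorem card_dvd_absNorm_eq {P : Ideal (𝓞 K)} {q n : ℕ} (hP : Ideal.absNorm P = q) (hq : 0 < q) :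
    Nat.card {I : Ideal (𝓞 K) // Ideal.absNorm I = q * n ∧ P ∣ I} = idealCount K n := by
  have hP0 : P ≠ 0 := by
    rintro rfl
    simp at hP
    omega
  symm
  refine Nat.card_eq_of_bijective (fun J : {I : Ideal (𝓞 K) // Ideal.absNorm I = n} =>
    ⟨P * J.1, by rw [map_mul, hP, J.2], dvd_mul_right _ _⟩) ⟨?_, ?_⟩
  · rintro ⟨I, hI⟩ ⟨J, hJ⟩ h
    have : P * I = P * J := congrArg Subtype.val h
    exact Subtype.ext (mul_left_cancel₀ hP0 this)
  · rintro ⟨_, hI, J, rfl⟩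
    rw [map_mul, hP] at hI
    exact ⟨⟨J, Nat.eq_of_mul_eq_mul_left hq hI⟩, rfl⟩

theorem card_absNorm_eq_split (n : ℕ) (P : Ideal (𝓞 K)) :
    idealCount K n = Nat.card {I : Ideal (𝓞 K) // Ideal.absNorm I = n ∧ P ∣ I} +
      Nat.card {I : Ideal (𝓞 K) // Ideal.absNorm I = n ∧ ¬ P ∣ I} := by
  classical
  have hf : {I : Ideal (𝓞 K) | Ideal.absNorm I = n}.Finite := Ideal.finite_setOfPred_absNorm_eq n
  have h := Set.ncard_inter_add_ncard_sdiff_eq_ncard {I : Ideal (𝓞 K) | Ideal.absNorm I = n}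
    {I | P ∣ I} hf
  exact h.symm

end IdealCount

section QuadraticIdealCount

variable {K : Type*} [Field K] [NumberField K]

theorem absNorm_span_natCast_of_finrank_eq_two (hK : Module.finrank ℚ K = 2) (p : ℕ) :
    Ideal.absNorm (Ideal.span {(p : 𝓞 K)}) = p ^ 2 := by
  rw [Ideal.absNorm_span_natCast, RingOfIntegers.rank, hK]

theorem span_natCast_dvd_of_absNorm_eq_pow (hK : Module.finrank ℚ K = 2) {p : ℕ}
    (hp : p.Prime) (h : ∀ I : Ideal (𝓞 K), Ideal.absNorm I ≠ p) {I : Ideal (𝓞 K)} {k : ℕ}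
    (hI : Ideal.absNorm I = p ^ (k + 1)) : Ideal.span {(p : 𝓞 K)} ∣ I := by
  have hI1 : I ≠ ⊤ := by
    intro h1
    rw [h1, Ideal.absNorm_top] at hI
    exact (Nat.one_lt_pow (Nat.succ_ne_zero k) hp.one_lt).ne hI
  obtain ⟨P, hPm, hIP⟩ := Ideal.exists_le_maximal I hI1
  have hPI : Ideal.absNorm P ∣ p ^ (k + 1) := hI ▸ Ideal.absNorm_dvd_absNorm_of_le hIP
  have hpP : (p : 𝓞 K) ∈ P := by
    refine hPm.isPrime.mem_of_pow_mem (k + 1) (hIP ?_)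
    have := Ideal.absNorm_mem I
    rwa [hI, Nat.cast_pow] at this
  have hdvd : P ∣ Ideal.span {(p : 𝓞 K)} := by
    rw [Ideal.dvd_iff_le]
    exact (Ideal.span_singleton_le_iff_mem _).mpr hpP
  have hP2 : Ideal.absNorm P ∣ p ^ 2 := by
    rw [← absNorm_span_natCast_of_finrank_eq_two hK p]
    exact Ideal.absNorm_dvd_absNorm_of_le (Ideal.dvd_iff_le.mp hdvd)
  obtain ⟨j, hj, hPj⟩ := (Nat.dvd_prime_pow hp).mp hP2
  have hP : Ideal.absNorm P = p ^ 2 := by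
    interval_cases j
    · exact absurd (Ideal.absNorm_eq_one_iff.mp (by simpa using hPj)) hPm.ne_top
    · exact absurd (by simpa using hPj) (h P)
    · exact hPj
  rw [← eq_of_dvd_of_absNorm_eq hdvd
    (hP.trans (absNorm_span_natCast_of_finrank_eq_two hK p).symm)
    (by rw [hP]; exact pow_ne_zero _ hp.ne_zero)]
  exact Ideal.dvd_iff_le.mpr hIP

theorem idealCount_prime_pow_of_inert (hK : Module.finrank ℚ K = 2) {p : ℕ}
    (hp : p.Prime) (h : ∀ I : Ideal (𝓞 K), Ideal.absNorm I ≠ p) :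
    ∀ k : ℕ, (idealCount K (p ^ k) : ℤ) = ∑ j ∈ Finset.range (k + 1), (-1) ^ j
  | 0 => by simp [idealCount_one]
  | 1 => by
    have : IsEmpty {I : Ideal (𝓞 K) // Ideal.absNorm I = p ^ 1} :=
      ⟨fun I => h I.1 (by simpa using I.2)⟩
    rw [idealCount, Nat.card_of_isEmpty]
    simp [Finset.sum_range_succ]
  | k + 2 => by
    rw [Finset.sum_range_succ, Finset.sum_range_succ, ← idealCount_prime_pow_of_inert hK hp h k,
      card_absNorm_eq_split _ (Ideal.span {(p : 𝓞 K)}), pow_add p k 2, mul_comm,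
      card_dvd_absNorm_eq (absNorm_span_natCast_of_finrank_eq_two hK p) (pow_pos hp.pos 2)]
    have : IsEmpty {I : Ideal (𝓞 K) // Ideal.absNorm I = p ^ 2 * p ^ k ∧
        ¬ Ideal.span {(p : 𝓞 K)} ∣ I} := by
      refine ⟨fun I => I.2.2 (span_natCast_dvd_of_absNorm_eq_pow hK hp h (k := k + 1) ?_)⟩
      rw [I.2.1]
      ring
    rw [Nat.card_of_isEmpty, pow_succ (-1 : ℤ) (k + 1)]
    simp

theorem idealCount_prime_pow_of_mul_eq (hK : Module.finrank ℚ K = 2) {p : ℕ}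
    (hp : p.Prime) {P Q : Ideal (𝓞 K)} (hP : Ideal.absNorm P = p)
    (hPQ : P * Q = Ideal.span {(p : 𝓞 K)}) {ε : ℤ} (hε1 : P ≠ Q → ε = 1) (hε0 : P = Q → ε = 0)
    (k : ℕ) : (idealCount K (p ^ k) : ℤ) = ∑ j ∈ Finset.range (k + 1), ε ^ j := by
  have hQ : Ideal.absNorm Q = p := by
    have h := absNorm_span_natCast_of_finrank_eq_two hK p
    rw [← hPQ, map_mul, hP, sq] at h
    exact Nat.eq_of_mul_eq_mul_left hp.pos h
  have hPp : P.IsPrime := Ideal.isPrime_of_irreducible_absNorm (hP ▸ hp)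
  have hQp : Q.IsPrime := Ideal.isPrime_of_irreducible_absNorm (hQ ▸ hp)
  have hmax : ∀ R : Ideal (𝓞 K), R.IsPrime → Ideal.absNorm R = p → R.IsMaximal := by
    intro R hR hN
    refine hR.isMaximal fun h0 => ?_
    rw [h0, Ideal.absNorm_bot] at hN
    exact hp.ne_zero hN.symm
  have hPm := hmax P hPp hP
  have hQm := hmax Q hQp hQ
  have key : ∀ (m : ℕ) (I : Ideal (𝓞 K)), Ideal.absNorm I = p ^ m → ¬ P ∣ I → I = Q ^ m := by
    intro m I hI hPI
    have hdvd : I ∣ P ^ m * Q ^ m := by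
      rw [← mul_pow, hPQ, Ideal.span_singleton_pow, ← Nat.cast_pow]
      exact dvd_span_natCast_absNorm I hI
    have hcop : IsCoprime I (P ^ m) := by
      refine IsCoprime.pow_right ?_
      rw [Ideal.isCoprime_iff_sup_eq]
      exact hPm.out.2 _ (right_lt_sup.mpr fun h => hPI (Ideal.dvd_iff_le.mpr h))
    refine eq_of_dvd_of_absNorm_eq (hcop.dvd_of_dvd_mul_left hdvd) ?_ ?_
    · rw [hI, map_pow, hQ]
    · rw [hI]
      exact pow_ne_zero _ hp.ne_zero
  induction k with
  | zero => simp [idealCount_one]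
  | succ k ih =>
    rw [Finset.sum_range_succ, ← ih, card_absNorm_eq_split _ P, pow_succ' p k,
      card_dvd_absNorm_eq hP hp.pos]
    push_cast
    congr 1
    by_cases hne : P = Q
    · have : IsEmpty {I : Ideal (𝓞 K) // Ideal.absNorm I = p * p ^ k ∧ ¬ P ∣ I} := by
        refine ⟨fun I => I.2.2 ?_⟩
        rw [key (k + 1) I.1 (I.2.1.trans (pow_succ' p k).symm) I.2.2, hne]
        exact dvd_pow_self Q (Nat.succ_ne_zero k)
      rw [hε0 hne, Nat.card_of_isEmpty]
      simp
    · rw [hε1 hne, one_pow]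
      norm_cast
      rw [Nat.card_eq_one_iff_unique]
      refine ⟨⟨fun I J => Subtype.ext ?_⟩, ⟨⟨Q ^ (k + 1), ?_, ?_⟩⟩⟩
      · rw [key (k + 1) I.1 (I.2.1.trans (pow_succ' p k).symm) I.2.2,
          key (k + 1) J.1 (J.2.1.trans (pow_succ' p k).symm) J.2.2]
      · rw [map_pow, hQ, pow_succ']
      · intro h
        have h1 := hPp.le_of_pow_le (Ideal.dvd_iff_le.mp h)
        exact hne (hQm.eq_of_le hPp.ne_top h1).symm

/-- In a quadratic field the numbers of ideals of prime power norm are governed by a sign. -/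
theorem exists_idealCount_prime_pow (hK : Module.finrank ℚ K = 2) {p : ℕ} (hp : p.Prime) :
    ∃ ε : ℤ, |ε| ≤ 1 ∧
      ∀ k : ℕ, (idealCount K (p ^ k) : ℤ) = ∑ j ∈ Finset.range (k + 1), ε ^ j := by
  by_cases h : ∀ I : Ideal (𝓞 K), Ideal.absNorm I ≠ p
  · exact ⟨-1, by simp, idealCount_prime_pow_of_inert hK hp h⟩
  · push Not at h
    obtain ⟨P, hP⟩ := h
    obtain ⟨Q, hQ⟩ := dvd_span_natCast_absNorm P hP
    by_cases hPQ : P = Q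
    · exact ⟨0, by simp, idealCount_prime_pow_of_mul_eq hK hp hP hQ.symm (fun h => absurd hPQ h)
        fun _ => rfl⟩
    · exact ⟨1, by simp, idealCount_prime_pow_of_mul_eq hK hp hP hQ.symm (fun _ => rfl)
        fun h => absurd h hPQ⟩

end QuadraticIdealCount

section QuadraticSymbol

open scoped NumberTheorySymbols

variable {K : Type*} [Field K] [NumberField K]

/-- A quadratic field contains the square root of a nonzero integer, and has a ring automorphism
changing its sign. -/
theorem exists_sq_eq_intCast (hK : Module.finrank ℚ K = 2) :
    ∃ (d : ℤ) (θ : 𝓞 K) (σ : 𝓞 K ≃+* 𝓞 K), d ≠ 0 ∧ θ ^ 2 = (d : 𝓞 K) ∧ σ θ = -θ := by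
  have : Algebra.IsQuadraticExtension ℚ K := ⟨hK⟩
  have hcard : Nat.card Gal(K/ℚ) = 2 := by rw [IsGalois.card_aut_eq_finrank, hK]
  obtain ⟨σ, hσ⟩ : ∃ σ : Gal(K/ℚ), σ ≠ 1 := by
    have : Nontrivial Gal(K/ℚ) := Finite.one_lt_card_iff_nontrivial.mp (by omega)
    exact exists_ne 1
  have hσ2 : ∀ x : K, σ (σ x) = x := by
    intro x
    have h : σ ^ 2 = 1 := hcard ▸ pow_card_eq_one'
    rw [sq] at h
    exact DFunLike.congr_fun h x
  have hall : ∀ τ : Gal(K/ℚ), τ = 1 ∨ τ = σ := by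
    intro τ
    by_contra! hτ
    have h3 : ({1, σ, τ} : Set Gal(K/ℚ)).ncard = 3 :=
      Set.ncard_eq_three.mpr ⟨1, σ, τ, hσ.symm, hτ.1.symm, hτ.2.symm, rfl⟩
    have := Set.ncard_le_card ({1, σ, τ} : Set Gal(K/ℚ))
    omega
  set s : 𝓞 K ≃+* 𝓞 K := RingOfIntegers.mapRingEquiv (σ : K ≃+* K) with hs
  have hsc : ∀ x : 𝓞 K, ((s x : 𝓞 K) : K) = σ x := fun x => rfl
  obtain ⟨α, hα⟩ : ∃ α : 𝓞 K, s α ≠ α := by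
    by_contra! hfix
    refine hσ (AlgEquiv.ext fun x => ?_)
    obtain ⟨a, b, hb, rfl⟩ := IsFractionRing.div_surjective (A := 𝓞 K) x
    rw [map_div₀]
    have h1 := hsc a
    have h2 := hsc b
    rw [hfix] at h1 h2
    exact congrArg₂ (· / ·) h1.symm h2.symm
  have hsθ : s (α - s α) = -(α - s α) := by
    have : s (s α) = α := RingOfIntegers.ext (hσ2 α)
    rw [map_sub, this, neg_sub]
  obtain ⟨d, hd⟩ : ∃ d : ℤ, (α - s α) ^ 2 = (d : 𝓞 K) := by
    have hfix : s ((α - s α) ^ 2) = (α - s α) ^ 2 := by rw [map_pow, hsθ, neg_sq]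
    have hmem : (((α - s α) ^ 2 : 𝓞 K) : K) ∈ Set.range (algebraMap ℚ K) := by
      refine (IsGalois.mem_range_algebraMap_iff_fixed _).mpr fun τ => ?_
      rcases hall τ with rfl | rfl
      · rfl
      · rw [← hsc, hfix]
    obtain ⟨q, hq⟩ := hmem
    have hI : IsIntegral ℤ q := by
      rw [← isIntegral_algebraMap_iff (algebraMap ℚ K).injective, hq]
      exact RingOfIntegers.isIntegral_coe _
    obtain ⟨d, rfl⟩ := IsIntegrallyClosed.isIntegral_iff.mp hI
    refine ⟨d, RingOfIntegers.ext ?_⟩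
    rw [← hq]
    simp
  refine ⟨d, α - s α, s, ?_, hd, hsθ⟩
  rintro rfl
  rw [Int.cast_zero, sq_eq_zero_iff, sub_eq_zero] at hd
  exact hα hd.symm

theorem intCast_dvd_of_natCast_dvd {p : ℕ} {n : ℤ} (hp : p.Prime)
    (h : (p : 𝓞 K) ∣ (n : 𝓞 K)) : (p : ℤ) ∣ n := by
  have h1 : Algebra.norm ℤ (algebraMap ℤ (𝓞 K) p) ∣ Algebra.norm ℤ (algebraMap ℤ (𝓞 K) n) :=
    map_dvd _ (by simpa using h)
  rw [Algebra.norm_algebraMap, Algebra.norm_algebraMap] at h1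
  have hr : Module.finrank ℤ (𝓞 K) ≠ 0 := Module.finrank_pos.ne'
  exact (Nat.prime_iff_prime_int.mp hp).dvd_of_dvd_pow ((dvd_pow_self _ hr).trans h1)

theorem isSquare_of_absNorm_eq {p : ℕ} [Fact p.Prime] {I : Ideal (𝓞 K)}
    (hI : Ideal.absNorm I = p) {d : ℤ} {θ : 𝓞 K} (hθ : θ ^ 2 = (d : 𝓞 K)) :
    IsSquare (d : ZMod p) := by
  have hp : p.Prime := Fact.out
  have hcard : Nat.card (𝓞 K ⧸ I) = p := by
    rw [← hI, Ideal.absNorm_apply, Submodule.cardQuot_apply]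
  have : Finite (𝓞 K ⧸ I) := Nat.finite_of_card_ne_zero (by rw [hcard]; exact hp.ne_zero)
  have := Fintype.ofFinite (𝓞 K ⧸ I)
  set e := ZMod.ringEquivOfPrime (𝓞 K ⧸ I) hp (by rw [← hcard, Nat.card_eq_fintype_card])
  refine ⟨e.symm (Ideal.Quotient.mk I θ), ?_⟩
  rw [← map_mul, ← map_mul, ← sq, hθ, map_intCast, map_intCast]

theorem idealCount_prime_eq_one_add_jacobiSym (hK : Module.finrank ℚ K = 2) {d : ℤ} {θ : 𝓞 K}
    {σ : 𝓞 K ≃+* 𝓞 K} (hθ : θ ^ 2 = (d : 𝓞 K)) (hσ : σ θ = -θ) {p : ℕ} (hp : p.Prime)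
    (hp2 : p ≠ 2) (hpd : ¬ (p : ℤ) ∣ d) : (idealCount K p : ℤ) = 1 + J(d | p) := by
  have hpf : Fact p.Prime := ⟨hp⟩
  have hd0 : (d : ZMod p) ≠ 0 := fun h => hpd ((ZMod.intCast_zmod_eq_zero_iff_dvd d p).mp h)
  rw [← jacobiSym.legendreSym.to_jacobiSym]
  rcases legendreSym.eq_one_or_neg_one p hd0 with h | h
  · obtain ⟨x, hx⟩ := (legendreSym.eq_one_iff p hd0).mp h
    obtain ⟨r, rfl⟩ := ZMod.intCast_surjective x
    have hr : (p : ℤ) ∣ d - r ^ 2 := by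
      rw [← ZMod.intCast_zmod_eq_zero_iff_dvd]
      push_cast
      rw [hx]
      ring
    have hp2r : ¬ (p : ℤ) ∣ 2 * r := by
      intro h2
      have hpi := Nat.prime_iff_prime_int.mp hp
      rcases hpi.dvd_or_dvd h2 with h3 | h3
      · have h4 : p ∣ 2 := by exact_mod_cast h3
        exact hp2 ((Nat.prime_dvd_prime_iff_eq hp Nat.prime_two).mp h4)
      · exact hpd ((dvd_sub_left (h3.trans (Dvd.intro_left _ (sq r).symm))).mp hr)
    set P : Ideal (𝓞 K) := Ideal.span {(p : 𝓞 K), θ - r} with hP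
    set Q : Ideal (𝓞 K) := Ideal.span {(p : 𝓞 K), θ + r} with hQ
    have hone : ∀ I : Ideal (𝓞 K), (p : 𝓞 K) ∈ I → ((2 * r : ℤ) : 𝓞 K) ∈ I → I = ⊤ := by
      intro I h1 h2
      have hc : IsCoprime (p : ℤ) (2 * r) :=
        ((Nat.prime_iff_prime_int.mp hp).irreducible.coprime_iff_not_dvd).mpr hp2r
      obtain ⟨a, b, hab⟩ := hc
      rw [Ideal.eq_top_iff_one]
      have : (1 : 𝓞 K) = a * (p : 𝓞 K) + b * ((2 * r : ℤ) : 𝓞 K) := by exact_mod_cast hab.symm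
      rw [this]
      exact I.add_mem (I.mul_mem_left _ h1) (I.mul_mem_left _ h2)
    have hpP : (p : 𝓞 K) ∈ P := Ideal.subset_span (by simp)
    have hpQ : (p : 𝓞 K) ∈ Q := Ideal.subset_span (by simp)
    have hrP : θ - r ∈ P := Ideal.subset_span (by simp)
    have hrQ : θ + r ∈ Q := Ideal.subset_span (by simp)
    have hPQ : P * Q = Ideal.span {(p : 𝓞 K)} := by
      refine le_antisymm ?_ ?_
      · rw [hP, hQ, Ideal.span_pair_mul_span_pair, Ideal.span_le]
        have hmul : (θ - r) * (θ + r) = ((d - r ^ 2 : ℤ) : 𝓞 K) := by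
          push_cast
          rw [← hθ]
          ring
        obtain ⟨c, hc⟩ := hr
        rintro x (rfl | rfl | rfl | rfl)
        · exact Ideal.mem_span_singleton.mpr (dvd_mul_right _ _)
        · exact Ideal.mem_span_singleton.mpr (dvd_mul_right _ _)
        · exact Ideal.mem_span_singleton.mpr (dvd_mul_left _ _)
        · rw [hmul, hc]
          exact Ideal.mem_span_singleton.mpr ⟨c, by push_cast; ring⟩
      · rw [Ideal.span_singleton_le_iff_mem]
        have htop : P ⊔ Q = ⊤ := by
          refine hone _ (le_sup_left (a := P) hpP) ?_
          have : ((2 * r : ℤ) : 𝓞 K) = (θ + r) - (θ - r) := by push_cast; ring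
          rw [this]
          exact Ideal.sub_mem _ (le_sup_right (a := P) hrQ) (le_sup_left (a := P) hrP)
        rw [Ideal.mul_eq_inf_of_coprime htop]
        exact ⟨hpP, hpQ⟩
    have hndvd : ∀ t : 𝓞 K, σ t = -t → ¬ (p : 𝓞 K) ∣ t + r := by
      intro t ht h1
      have h2 := map_dvd σ h1
      rw [map_natCast, map_add, ht, map_intCast] at h2
      have h3 : (p : 𝓞 K) ∣ ((2 * r : ℤ) : 𝓞 K) := by
        have := dvd_add h1 h2
        convert! this using 1
        push_cast
        ring
      exact hp2r (intCast_dvd_of_natCast_dvd hp h3)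
    have hN : Ideal.absNorm P * Ideal.absNorm Q = p ^ 2 := by
      rw [← map_mul, hPQ, absNorm_span_natCast_of_finrank_eq_two hK]
    have hPtop : P ≠ ⊤ := by
      intro h1
      rw [h1, Ideal.top_mul] at hPQ
      rw [hPQ, Ideal.mem_span_singleton] at hrQ
      exact hndvd θ hσ hrQ
    have hQtop : Q ≠ ⊤ := by
      intro h1
      rw [h1, Ideal.mul_top] at hPQ
      rw [hPQ, Ideal.mem_span_singleton] at hrP
      refine hndvd (-θ) (by rw [map_neg, hσ]) ?_
      have := hrP.neg_right
      rwa [neg_sub', sub_neg_eq_add] at this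
    have hPN : Ideal.absNorm P = p := by
      have h1 : Ideal.absNorm P ∣ p ^ 2 := hN ▸ dvd_mul_right _ _
      obtain ⟨j, hj, hPj⟩ := (Nat.dvd_prime_pow hp).mp h1
      interval_cases j
      · exact absurd (Ideal.absNorm_eq_one_iff.mp (by simpa using hPj)) hPtop
      · simpa using hPj
      · rw [hPj] at hN
        refine absurd (Ideal.absNorm_eq_one_iff.mp ?_) hQtop
        exact Nat.eq_of_mul_eq_mul_left (pow_pos hp.pos 2) (by rw [hN, mul_one])
    have hne : P ≠ Q := by
      intro h1
      refine hPtop (hone P hpP ?_)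
      have : ((2 * r : ℤ) : 𝓞 K) = (θ + r) - (θ - r) := by push_cast; ring
      rw [this]
      exact P.sub_mem (h1 ▸ hrQ) hrP
    have := idealCount_prime_pow_of_mul_eq hK hp hPN hPQ (ε := 1) (fun _ => rfl)
      (fun h => absurd h hne) 1
    rw [h]
    simpa [Finset.sum_range_succ] using this
  · have hno : ∀ I : Ideal (𝓞 K), Ideal.absNorm I ≠ p := fun I hI =>
      (legendreSym.eq_neg_one_iff p).mp h (isSquare_of_absNorm_eq hI hθ)
    have := idealCount_prime_pow_of_inert hK hp hno 1
    rw [h]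
    simpa [Finset.sum_range_succ] using this

end QuadraticSymbol

section QuadraticCharacter

open scoped NumberTheorySymbols

/-- The quadratic Dirichlet character attached to a nonzero integer `d`. -/
theorem exists_dirichletCharacter_jacobiSym {d : ℤ} (hd : d ≠ 0) :
    ∃ χ : DirichletCharacter ℂ (4 * d.natAbs), χ⁻¹ = χ ∧
      ∀ n : ℕ, n.Coprime (4 * d.natAbs) → χ n = (J(d | n) : ℂ) := by
  set N := 4 * d.natAbs with hN
  have hN0 : NeZero N := ⟨by simp [hN, hd]⟩
  have hodd : ∀ n : ℕ, n.Coprime N → Odd n := by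
    intro n hn
    rw [← Nat.coprime_two_right]
    exact hn.coprime_dvd_right ⟨2 * d.natAbs, by rw [hN]; ring⟩
  have hgcd : ∀ n : ℕ, n.Coprime N → d.gcd n = 1 := by
    intro n hn
    rw [Int.gcd_comm, Int.gcd_eq_natAbs, Int.natAbs_natCast]
    exact hn.coprime_dvd_right (Dvd.intro_left 4 rfl)
  have hval : ∀ u : (ZMod N)ˣ, (u : ZMod N).val.Coprime N := ZMod.val_coe_unit_coprime
  let f : (ZMod N)ˣ →* ℂ :=
    { toFun := fun u => (J(d | (u : ZMod N).val) : ℂ)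
      map_one' := by
        have h1 := jacobiSym.mod_right d (b := 1) odd_one
        rw [jacobiSym.one_right] at h1
        rw [Units.val_one, ZMod.val_one_eq_one_mod, ← h1, Int.cast_one]
      map_mul' := fun u v => by
        have hu := hodd _ (hval u)
        have hv := hodd _ (hval v)
        rw [Units.val_mul, ZMod.val_mul, ← jacobiSym.mod_right d (hu.mul hv),
          jacobiSym.mul_right' d hu.pos.ne' hv.pos.ne', Int.cast_mul] }
  have hf : ∀ u, f u * f u = 1 := by
    intro u
    have h := jacobiSym.sq_one (hgcd _ (hval u))
    rw [sq] at h
    change (J(d | (u : ZMod N).val) : ℂ) * (J(d | (u : ZMod N).val) : ℂ) = 1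
    exact_mod_cast h
  refine ⟨MulChar.ofUnitHom f.toHomUnits, ?_, fun n hn => ?_⟩
  · ext u
    have h1 : MulChar.ofUnitHom f.toHomUnits (u : ZMod N) = f u := by
      rw [MulChar.ofUnitHom_coe, MonoidHom.coe_toHomUnits]
    rw [MulChar.inv_apply_eq_inv', h1]
    exact inv_eq_of_mul_eq_one_left (hf u)
  · rw [← ZMod.coe_unitOfCoprime n hn, MulChar.ofUnitHom_coe, MonoidHom.coe_toHomUnits]
    change (J(d | (ZMod.unitOfCoprime n hn : ZMod N).val) : ℂ) = _
    rw [ZMod.coe_unitOfCoprime, ZMod.val_natCast, ← jacobiSym.mod_right d (hodd n hn)]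

end QuadraticCharacter

theorem norm_prime_cpow_neg_lt_one {p : ℕ} (hp : p.Prime) {s : ℂ} (hs : 0 < s.re) :
    ‖(p : ℂ) ^ (-s)‖ < 1 := by
  rw [norm_natCast_cpow_of_pos hp.pos, neg_re]
  exact Real.rpow_lt_one_of_one_lt_of_neg (by exact_mod_cast hp.one_lt) (by linarith)

theorem one_sub_mul_prime_cpow_neg_ne_zero {p : ℕ} (hp : p.Prime) {s a : ℂ} (hs : 0 < s.re)
    (ha : ‖a‖ ≤ 1) : 1 - a * (p : ℂ) ^ (-s) ≠ 0 := by
  intro h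
  have h1 : ‖a * (p : ℂ) ^ (-s)‖ = 1 := by rw [← sub_eq_zero.mp h, norm_one]
  rw [norm_mul] at h1
  have := mul_le_of_le_one_left (norm_nonneg ((p : ℂ) ^ (-s))) ha
  linarith [norm_prime_cpow_neg_lt_one hp hs]

theorem DirichletCharacter.gammaFactor_ne_zero {N : ℕ} (χ : DirichletCharacter ℂ N) {s : ℂ}
    (hs : 0 < s.re) : χ.gammaFactor s ≠ 0 := by
  rcases χ.even_or_odd with h | h
  · rw [h.gammaFactor_def]
    exact Gammaℝ_ne_zero_of_re_pos hs
  · rw [h.gammaFactor_def]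
    exact Gammaℝ_ne_zero_of_re_pos (by simp; linarith)

section Reflection

variable {N : ℕ} [NeZero N]

theorem DirichletCharacter.IsPrimitive.LFunction_one_sub_eq_zero {χ : DirichletCharacter ℂ N}
    (hχ : χ.IsPrimitive) (hinv : χ⁻¹ = χ) {ρ : ℂ} (h : χ.LFunction ρ = 0) (h0 : 0 < ρ.re)
    (h1 : ρ.re < 1) : χ.LFunction (1 - ρ) = 0 := by
  have hρ0 : ρ ≠ 0 := by rintro rfl; simp at h0
  have hρ1 : 1 - ρ ≠ 0 := by
    intro h
    rw [← sub_eq_zero.mp h] at h1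
    simp at h1
  rw [χ.LFunction_eq_completed_div_gammaFactor ρ (Or.inl hρ0), div_eq_zero_iff,
    or_iff_left (χ.gammaFactor_ne_zero h0)] at h
  rw [χ.LFunction_eq_completed_div_gammaFactor _ (Or.inl hρ1), hχ.completedLFunction_one_sub,
    hinv, h, mul_zero, zero_div]

/-- The zeros in the critical strip of the `L`-function of a quadratic character are symmetric. -/
theorem DirichletCharacter.LFunction_one_sub_eq_zero {χ : DirichletCharacter ℂ N}
    (hinv : χ⁻¹ = χ) {ρ : ℂ} (h : χ.LFunction ρ = 0) (h0 : 0 < ρ.re)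
    (h1 : ρ.re < 1) : χ.LFunction (1 - ρ) = 0 := by
  have hM : NeZero χ.conductor := ⟨χ.conductor_ne_zero⟩
  have hchange := χ.changeLevel_primitiveCharacter
  have hprim := χ.primitiveCharacter_isPrimitive
  have hpinv : χ.primitiveCharacter⁻¹ = χ.primitiveCharacter := by
    refine DirichletCharacter.changeLevel_injective χ.conductor_dvd_level ?_
    rw [map_inv, hchange, hinv]
  have hρ1 : ρ ≠ 1 := by rintro rfl; simp at h1
  have hρ1' : 1 - ρ ≠ 1 := by
    intro h
    rw [sub_eq_self] at h
    rw [h] at h0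
    simp at h0
  have e1 := DirichletCharacter.LFunction_changeLevel χ.conductor_dvd_level χ.primitiveCharacter
    (s := ρ) (Or.inr hρ1)
  have e2 := DirichletCharacter.LFunction_changeLevel χ.conductor_dvd_level χ.primitiveCharacter
    (s := 1 - ρ) (Or.inr hρ1')
  rw [hchange] at e1 e2
  rw [h] at e1
  have hprod : ∏ p ∈ N.primeFactors, (1 - χ.primitiveCharacter p * (p : ℂ) ^ (-ρ)) ≠ 0 :=
    Finset.prod_ne_zero_iff.mpr fun p hp => one_sub_mul_prime_cpow_neg_ne_zero
      (Nat.prime_of_mem_primeFactors hp) h0 (DirichletCharacter.norm_le_one _ _)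
  have := (mul_eq_zero.mp e1.symm).resolve_right hprod
  rw [e2, hprim.LFunction_one_sub_eq_zero hpinv this h0 h1, zero_mul]

theorem riemannZeta_one_sub_eq_zero {ρ : ℂ} (h : riemannZeta ρ = 0) (h0 : 0 < ρ.re)
    (h1 : ρ.re < 1) : riemannZeta (1 - ρ) = 0 := by
  rw [← DirichletCharacter.LFunction_modOne_eq (χ := 1)] at h ⊢
  exact DirichletCharacter.LFunction_one_sub_eq_zero inv_one h h0 h1

end Reflection

section EulerProduct

variable {K : Type*} [Field K] [NumberField K]

theorem tsum_sum_range_pow_mul_pow {a x : ℂ} (ha : ‖a‖ ≤ 1) (hx : ‖x‖ < 1) :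
    ∑' k : ℕ, (∑ j ∈ Finset.range (k + 1), a ^ j) * x ^ k = (1 - x)⁻¹ * (1 - a * x)⁻¹ := by
  have hax : ‖a * x‖ < 1 := by
    rw [norm_mul]
    exact (mul_le_of_le_one_left (norm_nonneg x) ha).trans_lt hx
  have h := tsum_mul_tsum_eq_tsum_sum_range_of_summable_norm
    (summable_norm_geometric_of_norm_lt_one hax) (summable_norm_geometric_of_norm_lt_one hx)
  rw [tsum_geometric_of_norm_lt_one hax, tsum_geometric_of_norm_lt_one hx] at h
  rw [mul_comm, h]
  refine tsum_congr fun k => ?_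
  rw [Finset.sum_mul]
  refine Finset.sum_congr rfl fun j hj => ?_
  have hjk : j ≤ k := Nat.lt_succ_iff.mp (Finset.mem_range.mp hj)
  rw [mul_pow, mul_assoc, ← pow_add, Nat.add_sub_cancel' hjk]

theorem hasProd_idealCount {s z : ℂ} (hs : 1 < s.re)
    (h : HasSum (fun n : ℕ => (idealCount K n : ℂ) * (n : ℂ) ^ (-s)) z) :
    HasProd (fun p : Nat.Primes => ∑' k : ℕ, (idealCount K ((p : ℕ) ^ k) : ℂ) *
      ((p : ℂ) ^ (-s)) ^ k) z := by
  have hs0 : -s ≠ 0 := fun h0 => by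
    have := congrArg re h0
    simp only [neg_re, zero_re] at this
    linarith
  have key := EulerProduct.eulerProduct_hasProd
    (f := fun n : ℕ => (idealCount K n : ℂ) * (n : ℂ) ^ (-s))
    (by simp [idealCount_one])
    (fun {m n} hmn => by
      rw [idealCount_mul hmn, Nat.cast_mul, Nat.cast_mul, natCast_mul_natCast_cpow]
      ring)
    h.summable.norm (by simp [zero_cpow hs0])
  rw [h.tsum_eq] at key
  have hpow : ∀ q k : ℕ, ((q : ℂ) ^ (-s)) ^ k = ((q ^ k : ℕ) : ℂ) ^ (-s) := fun q k => by
    rw [Nat.cast_pow, ← cpow_nat_mul, natCast_cpow_natCast_mul]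
  exact key.congr_fun fun p => tsum_congr fun k => congrArg _ (hpow p k)

/-- The Dedekind zeta function of a quadratic field is, up to finitely many Euler factors, the
product of the Riemann zeta function and the `L`-function of a quadratic character. -/
theorem exists_quadratic_factorization (hK : Module.finrank ℚ K = 2) :
    ∃ (N : ℕ) (_ : NeZero N) (χ : DirichletCharacter ℂ N) (T : Finset Nat.Primes)
      (ε : Nat.Primes → ℂ), χ⁻¹ = χ ∧ (∀ p, ‖ε p‖ ≤ 1) ∧
      ∀ s z : ℂ, 1 < s.re →
        HasSum (fun n : ℕ => (idealCount K n : ℂ) * (n : ℂ) ^ (-s)) z →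
        z * ∏ p ∈ T, (1 - ε p * (p : ℂ) ^ (-s)) = riemannZeta s * χ.LFunction s := by
  obtain ⟨d, θ, σ, hd, hθ, hσ⟩ := exists_sq_eq_intCast hK
  obtain ⟨χ, hinv, hχ⟩ := exists_dirichletCharacter_jacobiSym hd
  choose ε hε hcount using fun p : Nat.Primes => exists_idealCount_prime_pow hK p.2
  have hN : NeZero (4 * d.natAbs) := ⟨by simp [hd]⟩
  have hfin : {p : Nat.Primes | (p : ℕ) ∣ 4 * d.natAbs}.Finite :=
    ((Set.finite_le_nat (4 * d.natAbs)).preimage Nat.Primes.coe_nat_injective.injOn).subset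
      fun p hp => Nat.le_of_dvd (NeZero.pos _) hp
  refine ⟨_, hN, χ, hfin.toFinset, fun p => (ε p : ℂ), hinv, fun p => ?_, fun s z hs hz => ?_⟩
  · rw [Complex.norm_intCast]
    exact_mod_cast hε p
  have hεC : ∀ p, ‖(ε p : ℂ)‖ ≤ 1 := fun p => by
    rw [Complex.norm_intCast]
    exact_mod_cast hε p
  have h1 : HasProd (fun p : Nat.Primes =>
      (1 - (p : ℂ) ^ (-s))⁻¹ * (1 - (ε p : ℂ) * (p : ℂ) ^ (-s))⁻¹) z := by
    refine (hasProd_idealCount hs hz).congr_fun fun p => ?_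
    rw [← tsum_sum_range_pow_mul_pow (hεC p) (norm_prime_cpow_neg_lt_one p.2 (by linarith))]
    refine tsum_congr fun k => ?_
    congr 1
    exact_mod_cast (hcount p k).symm
  have h2 : HasProd (fun p : Nat.Primes =>
      if p ∈ hfin.toFinset then 1 - (ε p : ℂ) * (p : ℂ) ^ (-s) else 1)
      (∏ p ∈ hfin.toFinset, (1 - (ε p : ℂ) * (p : ℂ) ^ (-s))) := by
    have := hasProd_prod_of_ne_finset_one (s := hfin.toFinset) (L := .unconditional _)
      (f := fun p : Nat.Primes =>
        if p ∈ hfin.toFinset then 1 - (ε p : ℂ) * (p : ℂ) ^ (-s) else 1)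
      (fun p hp => if_neg hp)
    rwa [Finset.prod_congr rfl fun p hp => if_pos hp] at this
  have h3 := (riemannZeta_eulerProduct_hasProd hs).mul
    (DirichletCharacter.LSeries_eulerProduct_hasProd χ hs)
  rw [← DirichletCharacter.LFunction_eq_LSeries χ hs] at h3
  refine ((h1.mul h2).congr_fun fun p => ?_).unique h3
  by_cases hp : p ∈ hfin.toFinset
  · have hpN : (p : ℕ) ∣ 4 * d.natAbs := by simpa using hp
    have hχ0 : χ (p : ℕ) = 0 := by
      refine χ.map_nonunit fun hu => ?_
      rw [ZMod.isUnit_iff_coprime] at hu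
      exact p.2.coprime_iff_not_dvd.mp hu hpN
    rw [if_pos hp, hχ0, mul_assoc,
      inv_mul_cancel₀ (one_sub_mul_prime_cpow_neg_ne_zero p.2 (by linarith) (hεC p))]
    simp
  · have hpN : ¬ (p : ℕ) ∣ 4 * d.natAbs := by simpa using hp
    have hp2 : (p : ℕ) ≠ 2 := fun h => hpN (h ▸ ⟨2 * d.natAbs, by ring⟩)
    have hpd : ¬ ((p : ℕ) : ℤ) ∣ d := fun h =>
      hpN (Dvd.dvd.mul_left (Int.natCast_dvd.mp h) 4)
    have e1 := idealCount_prime_eq_one_add_jacobiSym hK hθ hσ p.2 hp2 hpd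
    have e2 := hcount p 1
    rw [pow_one, e1, Finset.sum_range_succ, Finset.sum_range_one, pow_zero, pow_one,
      add_right_inj] at e2
    rw [if_neg hp, mul_one, hχ _ (p.2.coprime_iff_not_dvd.mpr hpN), e2]

end EulerProduct

theorem eq_of_eq_of_one_lt_re {f g : ℂ → ℂ} (hf : ∀ s ≠ 1, DifferentiableAt ℂ f s)
    (hg : ∀ s ≠ 1, DifferentiableAt ℂ g s) (h : ∀ s : ℂ, 1 < s.re → f s = g s) {s : ℂ}
    (hs : s ≠ 1) : f s = g s := by
  have han : ∀ {u : ℂ → ℂ}, (∀ s ≠ 1, DifferentiableAt ℂ u s) → AnalyticOnNhd ℂ u {1}ᶜ :=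
    fun hu => DifferentiableOn.analyticOnNhd (fun s hs => (hu s hs).differentiableWithinAt)
      isOpen_compl_singleton
  have hconn : IsPreconnected ({1}ᶜ : Set ℂ) :=
    (isConnected_compl_singleton_of_one_lt_rank (by simp) 1).isPreconnected
  refine (han hf).eqOn_of_preconnected_of_eventuallyEq (han hg) hconn
    (z₀ := 2) (by simp) ?_ hs
  filter_upwards [(isOpen_lt continuous_const continuous_re).mem_nhds
    (show (1 : ℝ) < (2 : ℂ).re by simp)] with s hs
  exact h s hs

section DedekindZeta

variable {K : Type*} [Field K] [NumberField K]

theorem idealCount_eq_one_of_finrank_eq_one (hK : Module.finrank ℚ K = 1) {n : ℕ} (hn : n ≠ 0) :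
    idealCount K n = 1 := by
  have hspan : Ideal.absNorm (Ideal.span {(n : 𝓞 K)}) = n := by
    rw [Ideal.absNorm_span_natCast, RingOfIntegers.rank, hK, pow_one]
  rw [idealCount, Nat.card_eq_one_iff_unique]
  refine ⟨⟨fun I J => Subtype.ext ?_⟩, ⟨⟨_, hspan⟩⟩⟩
  have key : ∀ I : {I : Ideal (𝓞 K) // Ideal.absNorm I = n}, I.1 = Ideal.span {(n : 𝓞 K)} :=
    fun I => eq_of_dvd_of_absNorm_eq (dvd_span_natCast_absNorm I.1 I.2) (I.2.trans hspan.symm)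
      (I.2.symm ▸ hn)
  rw [key I, key J]

/-- The symmetry of the zeros in the critical strip for fields of degree at most two. -/
theorem dedekindZeta_one_sub_eq_zero {ζK : ℂ → ℂ} (hζ : ∀ s ≠ 1, DifferentiableAt ℂ ζK s)
    (hser : ∀ s : ℂ, 1 < s.re → HasSum (fun I : {I : Ideal (𝓞 K) // I ≠ ⊥} =>
      ((Ideal.absNorm I.1 : ℕ) : ℂ) ^ (-s)) (ζK s))
    (hK : Module.finrank ℚ K = 1 ∨ Module.finrank ℚ K = 2) {ρ : ℂ} (h : ζK ρ = 0)
    (h0 : 0 < ρ.re) (h1 : ρ.re < 1) : ζK (1 - ρ) = 0 := by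
  have hρ : ρ ≠ 1 := by rintro rfl; simp at h1
  have hρ' : 1 - ρ ≠ 1 := by
    intro h
    rw [sub_eq_self] at h
    simp [h] at h0
  rcases hK with hK | hK
  · have heq : ∀ s ≠ 1, ζK s = riemannZeta s := fun s hs =>
      eq_of_eq_of_one_lt_re hζ (fun s hs => differentiableAt_riemannZeta hs) (fun s hs => by
        rw [zeta_eq_tsum_one_div_nat_cpow hs, ← (hasSum_idealCount hs (hser s hs)).tsum_eq]
        refine tsum_congr fun n => ?_
        rcases eq_or_ne n 0 with rfl | hn
        · have hs0 : s ≠ 0 := by rintro rfl; norm_num at hs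
          simp [zero_cpow hs0, zero_cpow (neg_ne_zero.mpr hs0)]
        · rw [idealCount_eq_one_of_finrank_eq_one hK hn, cpow_neg]
          simp) hs
    rw [heq _ hρ] at h
    rw [heq _ hρ', riemannZeta_one_sub_eq_zero h h0 h1]
  · obtain ⟨N, hN, χ, T, ε, hinv, hε, hfac⟩ := exists_quadratic_factorization hK
    have heq : ∀ s ≠ 1, ζK s * ∏ p ∈ T, (1 - ε p * (p : ℂ) ^ (-s)) =
        riemannZeta s * χ.LFunction s := fun s hs =>
      eq_of_eq_of_one_lt_re
        (f := fun s => ζK s * ∏ p ∈ T, (1 - ε p * (p : ℂ) ^ (-s)))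
        (g := fun s => riemannZeta s * χ.LFunction s)
        (fun s hs => (hζ s hs).mul (DifferentiableAt.fun_finsetProd fun p _ =>
          ((differentiableAt_id.neg.const_cpow
            (Or.inl (Nat.cast_ne_zero.mpr p.2.ne_zero))).const_mul _).const_sub _))
        (fun s hs => (differentiableAt_riemannZeta hs).mul
          (DirichletCharacter.differentiableAt_LFunction χ s (Or.inl hs)))
        (fun s hs => hfac s _ hs (hasSum_idealCount hs (hser s hs))) hs
    have hz : riemannZeta (1 - ρ) * χ.LFunction (1 - ρ) = 0 := by
      have e := heq ρ hρ
      rw [h, zero_mul] at e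
      rcases mul_eq_zero.mp e.symm with e | e
      · rw [riemannZeta_one_sub_eq_zero e h0 h1, zero_mul]
      · rw [DirichletCharacter.LFunction_one_sub_eq_zero hinv e h0 h1, mul_zero]
    rw [← heq _ hρ'] at hz
    refine (mul_eq_zero.mp hz).resolve_right (Finset.prod_ne_zero_iff.mpr fun p _ =>
      one_sub_mul_prime_cpow_neg_ne_zero p.2 ?_ (hε p))
    rw [sub_re, one_re]
    linarith

end DedekindZeta

/-- Riesz-type criterion, part (1): the estimate `𝒫_{r₁,r₂}(y) = O(y^{-1/4+δ})` for all
`δ > 0` implies the Generalized Riemann Hypothesis for the Dedekind zeta function `ζK`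
of the number field `K`. -/
theorem riesz_criterion_implies_GRH
    (K : Type*) [Field K] [NumberField K] (ζK : ℂ → ℂ)
    (hζ_an : ∀ s : ℂ, s ≠ 1 → DifferentiableAt ℂ ζK s)
    (hζ_ser : ∀ s : ℂ, 1 < s.re →
      HasSum (fun I : {I : Ideal (𝓞 K) // I ≠ ⊥} =>
        ((Ideal.absNorm I.1 : ℕ) : ℂ) ^ (-s)) (ζK s))
    (hζ_pole : ∃ A : ℂ, A ≠ 0 ∧
      Tendsto (fun s : ℂ => (s - 1) * ζK s) (𝓝[≠] (1 : ℂ)) (𝓝 A))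
    (b : ℕ → ℝ)
    (hb : ∀ s : ℂ, 1 < s.re →
      HasSum (fun m : ℕ => (b m : ℂ) * (m : ℂ) ^ (-s)) (ζK s)⁻¹)
    (r₁ r₂ : ℕ)
    (hr₁ : r₁ = InfinitePlace.nrRealPlaces K)
    (hr₂ : r₂ = InfinitePlace.nrComplexPlaces K)
    (hP : ∀ δ : ℝ, 0 < δ →
      (fun y : ℝ => P r₁ r₂ b y) =O[atTop] fun y : ℝ => y ^ (-(1/4 : ℝ) + δ)) :
    ∀ ρ : ℂ, ζK ρ = 0 → 0 < ρ.re → ρ.re < 1 → ρ.re = 1/2 := by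
  obtain ⟨A, hA, hpole⟩ := hζ_pole
  obtain ⟨H, hH, hH1, hHζ⟩ := exists_entire_of_simple_pole hζ_an hpole
  rw [← hH1] at hA
  have hdeg := InfinitePlace.card_add_two_mul_card_eq_rank K
  rw [← hr₁, ← hr₂] at hdeg
  have hpos : 0 < Module.finrank ℚ K := Module.finrank_pos
  have hr : 1 ≤ r₁ + r₂ := by omega
  have hsum := add_eq_one_of_isBigO hr hH hA hHζ hb hP
  have hK : Module.finrank ℚ K = 1 ∨ Module.finrank ℚ K = 2 := by omega
  intro ρ hρ h0 h1
  rcases lt_trichotomy ρ.re (1 / 2) with h | h | h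
  · refine absurd (dedekindZeta_one_sub_eq_zero hζ_an hζ_ser hK hρ h0 h1)
      (ne_zero_of_isBigO hr hH hA hHζ hb hP ?_ ?_) <;>
    · rw [sub_re, one_re]
      linarith
  · exact h
  · exact absurd hρ (ne_zero_of_isBigO hr hH hA hHζ hb hP h h1)
end

section
/- Let 𝕂 be a number field with r = r₁ + r₂ − 1 = 0 (i.e. 𝕂 = ℚ or 𝕂 imaginary quadratic). If the Generalized Riemann Hypothesis holds for ζ_𝕂, then 𝒫_{r₁,r₂}(y) = O_{r₁,r₂}(y^{−1/4+δ}) as y → ∞ for every δ > 0. -/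
open Complex NumberField Filter MeasureTheory Topology

theorem integral_verticalLine_eq {f : ℂ → ℂ} {a b C : ℝ} (hab : a ≤ b)
    (hf : DifferentiableOn ℂ f {s | s.re ∈ Set.Icc a b})
    (hC : ∀ s : ℂ, s.re ∈ Set.Icc a b → ‖f s‖ ≤ C * (1 + s.im ^ 2)⁻¹) :
    ∫ t : ℝ, f (a + t * I) = ∫ t : ℝ, f (b + t * I) := by
  have hIntegrable (c : ℝ) (hc : c ∈ Set.Icc a b) : Integrable fun t : ℝ => f (c + t * I) := by
    refine (integrable_inv_one_add_sq.const_mul C).mono' ?_ ?_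
    · refine Continuous.aestronglyMeasurable ?_
      refine hf.continuousOn.comp_continuous (by fun_prop) fun t => ?_
      simpa using hc
    · exact Eventually.of_forall fun t => by simpa using hC (c + t * I) (by simpa using hc)
  have hlim (c : ℝ) (hc : c ∈ Set.Icc a b) :
      Tendsto (fun T : ℝ => ∫ t in (-T)..T, f (c + t * I)) atTop
        (𝓝 (∫ t : ℝ, f (c + t * I))) :=
    intervalIntegral_tendsto_integral (hIntegrable c hc) tendsto_neg_atTop_atBot tendsto_id
  have hrect (T : ℝ) : ‖(∫ t in (-T)..T, f (b + t * I)) - ∫ t in (-T)..T, f (a + t * I)‖ ≤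
      2 * (C * (1 + T ^ 2)⁻¹ * |b - a|) := by
    have h := integral_boundary_rect_eq_zero_of_differentiableOn f (a + (-T : ℝ) * I)
      (b + T * I) (hf.mono fun s hs => by
        have := hs.1
        simpa [Set.uIcc_of_le hab] using this)
    have hside (S : ℝ) : ‖∫ x : ℝ in a..b, f (x + S * I)‖ ≤ C * (1 + S ^ 2)⁻¹ * |b - a| := by
      refine intervalIntegral.norm_integral_le_of_norm_le_const fun x hx => ?_
      rw [Set.uIoc_of_le hab] at hx
      simpa using hC (x + S * I) (by simpa using ⟨hx.1.le, hx.2⟩)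
    have h1 := hside (-T)
    have h2 := hside T
    simp only [add_re, ofReal_re, mul_re, I_re, mul_zero, ofReal_im, I_im, mul_one, sub_self,
      add_zero, add_im, mul_im, zero_add, smul_eq_mul] at h
    have h3 : I * ((∫ t in (-T)..T, f (b + t * I)) - ∫ t in (-T)..T, f (a + t * I)) =
        (∫ x : ℝ in a..b, f (x + T * I)) - ∫ x : ℝ in a..b, f (x + (-T : ℝ) * I) := by
      linear_combination h
    have h4 := congrArg norm h3
    rw [norm_mul, norm_I, one_mul] at h4
    rw [neg_sq] at h1
    linarith [norm_sub_le (∫ x : ℝ in a..b, f (x + T * I)) (∫ x : ℝ in a..b, f (x + (-T : ℝ) * I))]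
  have hzero : Tendsto (fun T : ℝ => 2 * (C * (1 + T ^ 2)⁻¹ * |b - a|)) atTop (𝓝 0) := by
    have : Tendsto (fun T : ℝ => (1 + T ^ 2)⁻¹) atTop (𝓝 0) :=
      tendsto_inv_atTop_zero.comp
        (tendsto_atTop_add_const_left _ _ (tendsto_pow_atTop two_ne_zero))
    simpa using ((this.const_mul C).mul_const |b - a|).const_mul 2
  have := squeeze_zero_norm hrect hzero
  exact (sub_eq_zero.mp (tendsto_nhds_unique
    ((hlim b ⟨hab, le_rfl⟩).sub (hlim a ⟨le_rfl, hab⟩)) this)).symm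

theorem norm_Gamma_le_Gamma_re_s3 {s : ℂ} (hs : 0 < s.re) : ‖Gamma s‖ ≤ Real.Gamma s.re := by
  rw [Gamma_eq_integral hs, Real.Gamma_eq_integral hs, GammaIntegral]
  refine (norm_integral_le_integral_norm _).trans_eq ?_
  refine setIntegral_congr_fun measurableSet_Ioi fun x hx => ?_
  have hx : 0 < x := hx
  simp [norm_cpow_eq_rpow_re_of_pos hx, Complex.norm_exp]

theorem exists_norm_Gamma_mul_pow_le (N : ℕ) : ∀ {σ₀ σ₁ : ℝ}, 0 < σ₀ →
    ∃ C : ℝ, ∀ s : ℂ, σ₀ ≤ s.re → s.re ≤ σ₁ → ‖Gamma s‖ * (1 + |s.im|) ^ N ≤ C := by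
  induction N with
  | zero =>
    intro σ₀ σ₁ h₀
    have hcont : ContinuousOn Real.Gamma (Set.Icc σ₀ σ₁) := fun x hx =>
      (Real.differentiableAt_Gamma fun m => by
        have : 0 < x := h₀.trans_le hx.1
        have : (0 : ℝ) ≤ m := m.cast_nonneg
        linarith).continuousAt.continuousWithinAt
    obtain ⟨C, hC⟩ := isCompact_Icc.exists_bound_of_continuousOn hcont
    refine ⟨C, fun s h1 h2 => ?_⟩
    rw [pow_zero, mul_one]
    exact (norm_Gamma_le_Gamma_re_s3 (h₀.trans_le h1)).trans
      ((le_abs_self _).trans (hC _ ⟨h1, h2⟩))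
  | succ N ih =>
    intro σ₀ σ₁ h₀
    obtain ⟨C, hC⟩ := ih (σ₀ := σ₀ + 1) (σ₁ := σ₁ + 1) (by positivity)
    refine ⟨C * (σ₀⁻¹ + 1), fun s h1 h2 => ?_⟩
    have hre : 0 < s.re := h₀.trans_le h1
    have hs : s ≠ 0 := fun h => by simp [h] at hre
    have hC' := hC (s + 1) (by simpa using h1) (by simpa using h2)
    rw [Gamma_add_one s hs, norm_mul] at hC'
    simp only [add_im, one_im, add_zero] at hC'
    have hs1 : 1 + |s.im| ≤ ‖s‖ * (σ₀⁻¹ + 1) := by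
      have h3 : σ₀ ≤ ‖s‖ := h1.trans (re_le_norm s)
      have h4 : 1 ≤ ‖s‖ * σ₀⁻¹ := by rwa [← div_eq_mul_inv, one_le_div h₀]
      linarith [abs_im_le_norm s]
    calc ‖Gamma s‖ * (1 + |s.im|) ^ (N + 1)
        = ‖Gamma s‖ * (1 + |s.im|) ^ N * (1 + |s.im|) := by ring
      _ ≤ ‖Gamma s‖ * (1 + |s.im|) ^ N * (‖s‖ * (σ₀⁻¹ + 1)) := by gcongr
      _ = ‖s‖ * ‖Gamma s‖ * (1 + |s.im|) ^ N * (σ₀⁻¹ + 1) := by ring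
      _ ≤ _ := by gcongr

theorem isBigO_tsum_mellinInv_Gamma {κ : ℝ} (hκ₀ : 0 < κ) (hκ₁ : κ ≤ 1) {G : ℂ → ℂ} {b : ℕ → ℝ}
    (hG : DifferentiableOn ℂ G {s | 1 / 2 < s.re}) (hG₀ : ∀ s : ℂ, 1 / 2 < s.re → G s ≠ 0)
    (hGinv : ∀ η : ℝ, 0 < η → ∃ C : ℝ, ∃ A : ℕ, ∀ s : ℂ, 1 / 2 + η ≤ s.re → s.re ≤ 5 / 4 →
      ‖(G s)⁻¹‖ ≤ C * (1 + |s.im|) ^ A)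
    (hb : ∀ s : ℂ, 1 < s.re →
      HasSum (fun m : ℕ => (b m : ℂ) * (m : ℂ) ^ (-s)) ((s - 1) / G s))
    {δ : ℝ} (hδ : 0 < δ) :
    (fun y : ℝ => ∑' m : ℕ, ((b m : ℂ) / (m : ℂ)) *
      mellinInv (-(1 / 4)) (fun s => Gamma (κ * s)) (Real.sqrt y / m)) =O[atTop]
      fun y : ℝ => y ^ (-(1 / 4 : ℝ) + δ) := by
  obtain ⟨δ', hδ'₀, hδ'₁, hδ'₂⟩ : ∃ δ' : ℝ, 0 < δ' ∧ δ' ≤ 1 / 8 ∧ δ' ≤ δ :=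
    ⟨min δ (1 / 8), lt_min hδ (by norm_num), min_le_right _ _, min_le_left _ _⟩
  obtain ⟨c₀, hc₀⟩ : ∃ c₀ : ℝ, c₀ = -(1 / 4) := ⟨_, rfl⟩
  obtain ⟨c, hc⟩ : ∃ c : ℝ, c = 1 / 2 - 2 * δ' := ⟨_, rfl⟩
  rw [← hc₀]
  have hcc : c₀ ≤ c := by linarith
  have hκ : (κ : ℂ) ≠ 0 := by exact_mod_cast hκ₀.ne'
  obtain ⟨C₂, A, hA⟩ := hGinv (2 * δ') (by positivity)
  obtain ⟨C₁, hC₁⟩ := exists_norm_Gamma_mul_pow_le (A + 2) (σ₀ := 3 / 4) (σ₁ := 3 / 2) (by norm_num)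
  have hΓ (s : ℂ) (hs : s.re ∈ Set.Icc c₀ c) :
      ‖Gamma (κ * s + 1)‖ * (1 + |s.im|) ^ (A + 2) ≤ C₁ * (κ⁻¹) ^ (A + 2) := by
    have hs1 : -(1 / 4) ≤ s.re := hc₀ ▸ hs.1
    have hs2 : s.re ≤ 1 / 2 := hs.2.trans (by linarith)
    have h := hC₁ (κ * s + 1) (by simp; nlinarith) (by simp; nlinarith)
    have h2 : 1 + |s.im| ≤ (1 + |(κ * s + 1).im|) * κ⁻¹ := by
      have : (κ * s + 1).im = κ * s.im := by simp
      rw [this, abs_mul, abs_of_pos hκ₀, add_mul, mul_comm κ, mul_assoc, mul_inv_cancel₀ hκ₀.ne',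
        mul_one, one_mul]
      gcongr
      exact (one_le_inv₀ hκ₀).mpr hκ₁
    calc _ ≤ ‖Gamma (κ * s + 1)‖ * ((1 + |(κ * s + 1).im|) * κ⁻¹) ^ (A + 2) := by gcongr
      _ = ‖Gamma (κ * s + 1)‖ * (1 + |(κ * s + 1).im|) ^ (A + 2) * κ⁻¹ ^ (A + 2) := by
        rw [mul_pow, mul_assoc]
      _ ≤ _ := by gcongr
  have hsq (t : ℝ) : 1 + t ^ 2 ≤ (1 + |t|) ^ 2 := by
    nlinarith [sq_abs t, abs_nonneg t]
  have hΓ2 (s : ℂ) (hs : s.re ∈ Set.Icc c₀ c) :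
      ‖Gamma (κ * s + 1)‖ * (1 + |s.im|) ^ A ≤ C₁ * (κ⁻¹) ^ (A + 2) * (1 + s.im ^ 2)⁻¹ := by
    rw [← div_eq_mul_inv, le_div_iff₀ (by positivity)]
    refine le_trans ?_ (hΓ s hs)
    rw [pow_add, ← mul_assoc]
    gcongr
    exact hsq _
  set F : ℂ → ℂ := fun s => -(κ : ℂ)⁻¹ * Gamma (κ * s + 1) * (G (1 - s))⁻¹ with hF
  set B : ℝ := κ⁻¹ * |C₂| * (C₁ * (κ⁻¹) ^ (A + 2)) with hB
  have hFB (s : ℂ) (hs : s.re ∈ Set.Icc c₀ c) : ‖F s‖ ≤ B * (1 + s.im ^ 2)⁻¹ := by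
    have h1 := hA (1 - s) (by rw [sub_re, one_re]; linarith [hs.2]) (by rw [sub_re, one_re]; linarith [hs.1])
    simp only [sub_im, one_im, zero_sub, abs_neg] at h1
    calc ‖F s‖ = κ⁻¹ * ‖Gamma (κ * s + 1)‖ * ‖(G (1 - s))⁻¹‖ := by
          simp [hF, abs_of_pos hκ₀]
      _ ≤ κ⁻¹ * ‖Gamma (κ * s + 1)‖ * (|C₂| * (1 + |s.im|) ^ A) := by
          gcongr
          exact h1.trans (by gcongr; exact le_abs_self _)
      _ = κ⁻¹ * |C₂| * (‖Gamma (κ * s + 1)‖ * (1 + |s.im|) ^ A) := by ring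
      _ ≤ _ := by rw [hB, mul_assoc _ _ (1 + s.im ^ 2)⁻¹]; exact mul_le_mul_of_nonneg_left (hΓ2 s hs) (by positivity)
  have hFd : DifferentiableOn ℂ F {s | s.re ∈ Set.Icc c₀ c} := by
    intro s hs
    have hs1 : c₀ ≤ s.re := hs.1
    have hs2 : s.re ≤ c := hs.2
    have h1 : DifferentiableAt ℂ Gamma (κ * s + 1) := by
      refine differentiableAt_Gamma _ fun m h => ?_
      have := congrArg re h
      simp at this
      have : (0 : ℝ) ≤ m := m.cast_nonneg
      nlinarith
    have h2 : (1 : ℝ) / 2 < (1 - s).re := by simp; linarith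
    have h3 : DifferentiableAt ℂ G (1 - s) :=
      (hG _ h2).differentiableAt ((isOpen_lt continuous_const continuous_re).mem_nhds h2)
    have h4 : DifferentiableAt ℂ (fun s => Gamma (κ * s + 1)) s :=
      DifferentiableAt.comp s (f := fun s => (κ : ℂ) * s + 1) h1 (by fun_prop)
    have h5 : DifferentiableAt ℂ (fun s => G (1 - s)) s :=
      DifferentiableAt.comp s (f := fun s => (1 : ℂ) - s) h3 (by fun_prop)
    exact ((h4.const_mul _).mul (h5.inv (hG₀ _ h2))).differentiableWithinAt
  have hline (t : ℝ) : (c₀ + t * I : ℂ).re = c₀ := by simp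
  have hsum (s : ℂ) (hs : s.re = c₀) :
      HasSum (fun m : ℕ => Gamma (κ * s) * ((b m : ℂ) * (m : ℂ) ^ (-(1 - s)))) (F s) := by
    have h := (hb (1 - s) (by simp [hs, hc₀])).mul_left (Gamma (κ * s))
    convert! h using 1
    have hs0 : s ≠ 0 := fun h => by simp [h, hc₀] at hs
    rw [hF]
    simp only
    rw [Gamma_add_one _ (mul_ne_zero hκ hs0)]
    field_simp
    ring
  have hsummable : Summable fun m : ℕ => |b m| * (m : ℝ) ^ (-(5 / 4) : ℝ) := by
    have h := (hb (5 / 4 : ℝ) (by simp; norm_num)).summable.norm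
    refine h.congr fun m => ?_
    rw [norm_mul, norm_real, Real.norm_eq_abs]
    congr 1
    rw [norm_natCast_cpow_of_re_ne_zero _ (by simp)]
    simp
  have hcontΓ : Continuous fun t : ℝ => Gamma (κ * (c₀ + t * I)) := by
    refine continuous_iff_continuousAt.mpr fun t => ?_
    have h1 : DifferentiableAt ℂ Gamma (κ * (c₀ + t * I)) := by
      refine differentiableAt_Gamma _ fun m h => ?_
      have := congrArg re h
      simp [hc₀] at this
      rcases m.eq_zero_or_pos with rfl | hm
      · simp at this; linarith
      · have : (1 : ℝ) ≤ m := by exact_mod_cast hm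
        nlinarith
    exact ContinuousAt.comp (f := fun t : ℝ => (κ * (c₀ + t * I) : ℂ)) h1.continuousAt
      (by fun_prop)
  have hIntegrableΓ : Integrable fun t : ℝ => Gamma (κ * (c₀ + t * I)) := by
    refine (integrable_inv_one_add_sq.const_mul (κ⁻¹ * 4 * (C₁ * (κ⁻¹) ^ (A + 2)))).mono'
      hcontΓ.aestronglyMeasurable (Eventually.of_forall fun t => ?_)
    set s : ℂ := c₀ + t * I with hs
    have hre : s.re = c₀ := hline t
    have him : s.im = t := by simp [hs]
    have hs0 : s ≠ 0 := fun h => by simp [h, hc₀] at hre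
    have hn : 1 / 4 ≤ ‖s‖ := by
      have := abs_re_le_norm s
      rw [hre, hc₀] at this
      norm_num at this ⊢
      exact this
    have h1 := hΓ2 s (by rw [hre]; exact ⟨by linarith, by linarith⟩)
    rw [him] at h1
    have h2 : ‖Gamma (κ * s)‖ ≤ κ⁻¹ * 4 * ‖Gamma (κ * s + 1)‖ := by
      rw [Gamma_add_one _ (mul_ne_zero hκ hs0), norm_mul, norm_mul, norm_real, Real.norm_eq_abs,
        abs_of_pos hκ₀]
      have : κ⁻¹ * 4 * (κ * ‖s‖ * ‖Gamma (κ * s)‖) = 4 * ‖s‖ * ‖Gamma (κ * s)‖ := by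
        field_simp
      rw [this]
      refine le_mul_of_one_le_left (norm_nonneg _) (by linarith)
    calc _ ≤ κ⁻¹ * 4 * ‖Gamma (κ * s + 1)‖ := h2
      _ ≤ κ⁻¹ * 4 * (‖Gamma (κ * s + 1)‖ * (1 + |t|) ^ A) := by
          gcongr
          exact le_mul_of_one_le_right (norm_nonneg _) (one_le_pow₀ (by simp))
      _ ≤ κ⁻¹ * 4 * (C₁ * κ⁻¹ ^ (A + 2) * (1 + t ^ 2)⁻¹) := by gcongr
      _ = _ := by ring
  have hmain (x : ℝ) (hx : 0 < x) : ∑' m : ℕ, ((b m : ℂ) / (m : ℂ)) *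
      mellinInv c₀ (fun s => Gamma (κ * s)) (x / m) =
      (1 / (2 * Real.pi)) • ∫ t : ℝ, (x : ℂ) ^ (-(c₀ + t * I)) * F (c₀ + t * I) := by
    have hxc (t : ℝ) : ‖(x : ℂ) ^ (-(c₀ + t * I))‖ = x ^ (-c₀) := by
      rw [norm_cpow_eq_rpow_re_of_pos hx]
      simp
    have hterm (m : ℕ) : ((b m : ℂ) / (m : ℂ)) *
        mellinInv c₀ (fun s => Gamma (κ * s)) (x / m) = (1 / (2 * Real.pi)) •
        ∫ t : ℝ, (x : ℂ) ^ (-(c₀ + t * I)) * (Gamma (κ * (c₀ + t * I)) *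
          ((b m : ℂ) * (m : ℂ) ^ (-(1 - (c₀ + t * I))))) := by
      rw [mellinInv, mul_smul_comm, ← integral_const_mul]
      congr 1
      refine integral_congr_ae (Eventually.of_forall fun t => ?_)
      simp only [smul_eq_mul]
      rcases m.eq_zero_or_pos with rfl | hm
      · have : -(1 - ((c₀ : ℂ) + t * I)) ≠ 0 := fun h => by
          have := congrArg re h
          simp [hc₀] at this
          norm_num at this
        simp only [Nat.cast_zero, div_zero, zero_mul]
        rw [zero_cpow this]
        simp
      · have hm' : (m : ℂ) ≠ 0 := by exact_mod_cast hm.ne'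
        have hmr : (0 : ℝ) < m := by exact_mod_cast hm
        have h1 : ((x / m : ℝ) : ℂ) ^ (-(c₀ + t * I)) =
            (x : ℂ) ^ (-(c₀ + t * I)) * (m : ℂ) ^ (c₀ + t * I) := by
          rw [div_eq_mul_inv, ofReal_mul, mul_cpow_ofReal_nonneg hx.le (by positivity)]
          congr 1
          rw [ofReal_inv, ofReal_natCast, inv_cpow _ _ (by rw [natCast_arg]; exact Real.pi_pos.ne),
            cpow_neg, inv_inv]
        rw [h1, neg_sub, cpow_sub _ _ hm', cpow_one]
        ring
    simp_rw [hterm]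
    rw [tsum_const_smul'']
    congr 1
    have hnorm (m : ℕ) (t : ℝ) : ‖(m : ℂ) ^ (-(1 - ((c₀ : ℂ) + t * I)))‖ =
        (m : ℝ) ^ (-(5 / 4) : ℝ) := by
      rw [norm_natCast_cpow_of_re_ne_zero]
      · simp [hc₀]; norm_num
      · simp [hc₀]; norm_num
    have hnorm2 (m : ℕ) (t : ℝ) : ‖(x : ℂ) ^ (-(c₀ + t * I)) * (Gamma (κ * (c₀ + t * I)) *
          ((b m : ℂ) * (m : ℂ) ^ (-(1 - ((c₀ : ℂ) + t * I)))))‖ =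
        ‖Gamma (κ * (c₀ + t * I))‖ * (x ^ (-c₀) * (|b m| * (m : ℝ) ^ (-(5 / 4) : ℝ))) := by
      rw [norm_mul, norm_mul, norm_mul, hnorm, hxc, norm_real, Real.norm_eq_abs]
      ring
    have hcontm (m : ℕ) : Continuous fun t : ℝ => (m : ℂ) ^ (-(1 - ((c₀ : ℂ) + t * I))) := by
      refine Continuous.const_cpow (by fun_prop) (Or.inr fun t h => ?_)
      have := congrArg re h
      simp [hc₀] at this
      norm_num at this
    have hcontx : Continuous fun t : ℝ => (x : ℂ) ^ (-((c₀ : ℂ) + t * I)) := by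
      refine Continuous.const_cpow (by fun_prop) (Or.inl (by exact_mod_cast hx.ne'))
    have key := hasSum_integral_of_summable_integral_norm (μ := volume)
      (F := fun (m : ℕ) (t : ℝ) => (x : ℂ) ^ (-(c₀ + t * I)) * (Gamma (κ * (c₀ + t * I)) *
          ((b m : ℂ) * (m : ℂ) ^ (-(1 - ((c₀ : ℂ) + t * I)))))) (fun m => ?_) ?_
    · rw [key.tsum_eq]
      refine integral_congr_ae (Eventually.of_forall fun t => ?_)
      simp only
      rw [tsum_mul_left, (hsum _ (hline t)).tsum_eq]
    · refine (hIntegrableΓ.norm.mul_const (x ^ (-c₀) * (|b m| * (m : ℝ) ^ (-(5 / 4) : ℝ)))).mono' ?_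
        (Eventually.of_forall fun t => (hnorm2 m t).le)
      exact (hcontx.mul (hcontΓ.mul (continuous_const.mul (hcontm m)))).aestronglyMeasurable
    · simp_rw [hnorm2, integral_mul_const]
      exact (hsummable.mul_left _).mul_left _
  refine Asymptotics.IsBigO.of_bound (1 / (2 * Real.pi) * (B * Real.pi)) ?_
  filter_upwards [eventually_ge_atTop 1] with y hy
  have hx1 : 1 ≤ Real.sqrt y := Real.one_le_sqrt.mpr hy
  set x := Real.sqrt y with hx
  have hx0 : 0 < x := by linarith
  have hxC : (x : ℂ) ≠ 0 := by exact_mod_cast hx0.ne'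
  rw [hmain x hx0]
  have hxs (s : ℂ) : ‖(x : ℂ) ^ (-s)‖ = x ^ (-s.re) := by
    rw [norm_cpow_eq_rpow_re_of_pos hx0, neg_re]
  have hshift := integral_verticalLine_eq (a := c₀) (b := c) (C := x ^ (-c₀) * B)
    (f := fun s => (x : ℂ) ^ (-s) * F s) hcc
    (DifferentiableOn.mul (fun s _ => ((differentiableAt_id.neg).const_cpow
      (Or.inl hxC)).differentiableWithinAt) hFd) (fun s hs => by
        rw [norm_mul, hxs, mul_assoc]
        exact mul_le_mul (Real.rpow_le_rpow_of_exponent_le hx1 (neg_le_neg hs.1)) (hFB s hs)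
          (norm_nonneg _) (by positivity))
  rw [hshift, norm_smul]
  have h2 : ‖∫ t : ℝ, (x : ℂ) ^ (-(c + t * I)) * F (c + t * I)‖ ≤ x ^ (-c) * (B * Real.pi) := by
    refine (norm_integral_le_of_norm_le (integrable_inv_one_add_sq.const_mul (x ^ (-c) * B))
      (Eventually.of_forall fun t => ?_)).trans_eq ?_
    · rw [norm_mul, hxs, mul_assoc]
      have hre : ((c : ℂ) + t * I).re = c := by simp
      have := hFB (c + t * I) (by rw [hre]; exact ⟨by linarith, by linarith⟩)
      simp only [add_im, ofReal_im, mul_im, ofReal_re, I_im, mul_one, I_re, mul_zero, add_zero,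
        zero_add] at this
      rw [hre]
      gcongr
    · rw [integral_const_mul, integral_univ_inv_one_add_sq, mul_assoc]
  have h3 : x ^ (-c) ≤ y ^ (c₀ + δ) := by
    rw [hx, Real.sqrt_eq_rpow, ← Real.rpow_mul (by linarith)]
    refine Real.rpow_le_rpow_of_exponent_le hy ?_
    rw [hc]
    linarith
  have hB0 : 0 ≤ B := by
    have := (norm_nonneg _).trans (hFB 0 (by simp [hc₀, hc]; linarith))
    simpa using this
  have hy0 : 0 ≤ y ^ (c₀ + δ) := by positivity
  rw [Real.norm_of_nonneg hy0, Real.norm_of_nonneg (by positivity), mul_assoc]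
  gcongr
  refine h2.trans ?_
  rw [mul_comm]
  gcongr

theorem exists_eq_mul_exp_of_ne_zero {f : ℂ → ℂ} {c : ℂ} {R : ℝ} (hR : 0 < R)
    (hf : DifferentiableOn ℂ f (Metric.ball c R)) (hf₀ : ∀ z ∈ Metric.ball c R, f z ≠ 0) :
    ∃ g : ℂ → ℂ, DifferentiableOn ℂ g (Metric.ball c R) ∧ g c = 0 ∧
      ∀ z ∈ Metric.ball c R, f z = f c * exp (g z) := by
  have hd : DifferentiableOn ℂ (fun z => deriv f z / f z) (Metric.ball c R) :=
    (hf.deriv Metric.isOpen_ball).div hf hf₀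
  obtain ⟨g, hgc, hg⟩ := hd.isExactOn_ball.with_val_at c 0
  have hgd : DifferentiableOn ℂ g (Metric.ball c R) := fun z hz =>
    (hg z hz).differentiableAt.differentiableWithinAt
  refine ⟨g, hgd, hgc, fun z hz => ?_⟩
  have hder (w : ℂ) (hw : w ∈ Metric.ball c R) :
      HasDerivAt (fun w => f w * exp (-g w)) 0 w := by
    have h1 := (hf.differentiableAt (Metric.isOpen_ball.mem_nhds hw)).hasDerivAt
    convert! h1.mul (hg w hw).neg.cexp using 1
    field_simp [hf₀ w hw]
    ring
  have hconst := Metric.isOpen_ball.is_const_of_deriv_eq_zero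
    (convex_ball c R).isPreconnected
    (fun w hw => (hder w hw).differentiableAt.differentiableWithinAt)
    (fun w hw => (hder w hw).deriv) hz (Metric.mem_ball_self hR)
  rw [hgc, neg_zero, exp_zero, mul_one, exp_neg] at hconst
  rw [← hconst, mul_assoc, inv_mul_cancel₀ (exp_ne_zero _), mul_one]

theorem norm_inv_le_of_norm_le {f : ℂ → ℂ} {c z : ℂ} {R L : ℝ} (hL : 0 < L)
    (hf : DifferentiableOn ℂ f (Metric.ball c R)) (hf₀ : ∀ z ∈ Metric.ball c R, f z ≠ 0)
    (hfL : ∀ z ∈ Metric.ball c R, ‖f z‖ ≤ ‖f c‖ * Real.exp L) (hz : z ∈ Metric.ball c R) :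
    ‖(f z)⁻¹‖ ≤ ‖f c‖⁻¹ * Real.exp (2 * L * ‖z - c‖ / (R - ‖z - c‖)) := by
  have hR : 0 < R := dist_nonneg.trans_lt hz
  obtain ⟨g, hg, hgc, hfg⟩ := exists_eq_mul_exp_of_ne_zero hR hf hf₀
  have hfc : 0 < ‖f c‖ := norm_pos_iff.mpr (hf₀ c (Metric.mem_ball_self hR))
  have hmap (w : ℂ) (hw : w ∈ Metric.ball (0 : ℂ) R) : c + w ∈ Metric.ball c R := by
    simpa using hw
  have h := borelCaratheodory_zero (f := fun w => g (c + w)) (M := L) (R := R) (z := z - c) hL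
    (hg.comp (by fun_prop) hmap) (fun w hw => ?_) hR (by simpa [dist_eq_norm] using hz)
    (by simpa using hgc)
  · rw [add_sub_cancel] at h
    rw [hfg z hz, norm_inv, norm_mul, norm_exp, mul_inv, ← Real.exp_neg]
    gcongr
    exact ((neg_le_abs _).trans (abs_re_le_norm _)).trans h
  · have h1 := hfL _ (hmap w hw)
    rw [hfg _ (hmap w hw), norm_mul, norm_exp] at h1
    exact Real.exp_le_exp.mp (le_of_mul_le_mul_left h1 hfc)

theorem exists_norm_inv_le {G : ℂ → ℂ} (hG : DifferentiableOn ℂ G {s | 1 / 2 < s.re})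
    (hG₀ : ∀ s : ℂ, 1 / 2 < s.re → G s ≠ 0) {c : ℝ} (hc : 0 < c)
    (hGc : ∀ t : ℝ, c ≤ ‖G (2 + t * I)‖)
    (hGle : ∀ η : ℝ, 0 < η → ∃ C : ℝ, ∃ B : ℕ, ∀ s : ℂ, 1 / 2 + η ≤ s.re → s.re ≤ 4 →
      ‖G s‖ ≤ C * (1 + |s.im|) ^ B) {η : ℝ} (hη : 0 < η) :
    ∃ C : ℝ, ∃ A : ℕ, ∀ s : ℂ, 1 / 2 + η ≤ s.re → s.re ≤ 5 / 4 →
      ‖(G s)⁻¹‖ ≤ C * (1 + |s.im|) ^ A := by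
  obtain ⟨C, B, hCB⟩ := hGle (η / 2) (by positivity)
  set k : ℕ := ⌈6 / η⌉₊ with hk
  set D : ℝ := |C| * 3 ^ B / c + 2 with hD
  have hD2 : 2 ≤ D := by
    have : 0 ≤ |C| * 3 ^ B / c := by positivity
    linarith
  refine ⟨c⁻¹ * D ^ k, B * k, fun s h1 h2 => ?_⟩
  set t := s.im with ht
  set z₀ : ℂ := 2 + t * I with hz₀
  have hdiff : s - z₀ = ((s.re - 2 : ℝ) : ℂ) := by
    apply Complex.ext <;> simp [hz₀, ht]
  have hdist : ‖s - z₀‖ = 2 - s.re := by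
    rw [hdiff, norm_real, Real.norm_eq_abs, abs_of_nonpos (by linarith)]
    ring
  set R : ℝ := 3 / 2 - η / 2 with hR
  have hball (z : ℂ) (hz : z ∈ Metric.ball z₀ R) :
      1 / 2 + η / 2 ≤ z.re ∧ z.re ≤ 4 ∧ |z.im| ≤ |t| + 2 := by
    rw [Metric.mem_ball, dist_eq_norm] at hz
    have hre := (abs_re_le_norm (z - z₀)).trans hz.le
    have him := (abs_im_le_norm (z - z₀)).trans hz.le
    simp only [hz₀, sub_re, add_re, mul_re, ofReal_re, I_re, mul_zero, ofReal_im, I_im, mul_one,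
      sub_self, add_zero, sub_im, add_im, mul_im, zero_add, re_ofNat, im_ofNat] at hre him
    have h3 := abs_le.mp hre
    refine ⟨by linarith, by linarith, ?_⟩
    have h4 := abs_sub_abs_le_abs_sub z.im t
    linarith
  set E : ℝ := D * (1 + |t|) ^ B with hE
  have hE1 : 1 < E := by
    have : 1 ≤ (1 + |t|) ^ B := one_le_pow₀ (by simp)
    nlinarith
  have hL : 0 < Real.log E := Real.log_pos hE1
  have hexp : Real.exp (Real.log E) = E := Real.exp_log (by linarith)
  have hmem : s ∈ Metric.ball z₀ R := by
    rw [Metric.mem_ball, dist_eq_norm, hdist]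
    linarith
  have hsub : Metric.ball z₀ R ⊆ {s | 1 / 2 < s.re} := fun z hz => by
    have := (hball z hz).1
    change 1 / 2 < z.re
    linarith
  have key := norm_inv_le_of_norm_le hL (hG.mono hsub) (fun z hz => hG₀ z (hsub hz))
    (fun z hz => ?_) hmem
  · refine key.trans ?_
    have hr : 2 * Real.log E * ‖s - z₀‖ / (R - ‖s - z₀‖) ≤ k * Real.log E := by
      have h5 : 6 / η ≤ k := Nat.le_ceil _
      have h6 : η / 2 ≤ R - ‖s - z₀‖ := by rw [hdist]; linarith
      calc _ ≤ 2 * Real.log E * (3 / 2) / (η / 2) := by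
            gcongr
            rw [hdist]; linarith
        _ = 6 / η * Real.log E := by field_simp; ring
        _ ≤ _ := by gcongr
    calc _ ≤ c⁻¹ * Real.exp (k * Real.log E) := by
          gcongr
          exact hGc t
      _ = c⁻¹ * D ^ k * (1 + |t|) ^ (B * k) := by
          rw [Real.exp_nat_mul, hexp, hE, mul_pow, ← pow_mul, mul_assoc]
  · obtain ⟨h3, h4, h5⟩ := hball z hz
    rw [hexp]
    calc ‖G z‖ ≤ C * (1 + |z.im|) ^ B := hCB z h3 h4
      _ ≤ |C| * (3 * (1 + |t|)) ^ B := by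
          gcongr
          · exact le_abs_self C
          · linarith [abs_nonneg t]
      _ = c * (|C| * 3 ^ B / c * (1 + |t|) ^ B) := by
          rw [mul_pow]; field_simp
      _ ≤ c * E := by
          rw [hE, hD]
          gcongr
          linarith
      _ ≤ _ := by gcongr; exact hGc t

theorem two_cpow_eq_neg_of_im {n : ℕ} {s : ℂ} {k : ℤ}
    (hs : s.im * (n * Real.log 2) = (2 * k + 1) * Real.pi) :
    (2 : ℂ) ^ (n * (1 - s)) = -(((2 : ℝ) ^ (n * (1 - s.re)) : ℝ) : ℂ) := by
  rw [cpow_def_of_ne_zero two_ne_zero, Real.rpow_def_of_pos two_pos]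
  have h1 : Complex.log 2 * (n * (1 - s)) =
      ((Real.log 2 * (n * (1 - s.re)) : ℝ) : ℂ) - (Real.pi * I + k * (2 * Real.pi * I)) := by
    have h2 : Complex.log 2 = (Real.log 2 : ℝ) := by
      rw [ofReal_log two_pos.le]; simp
    have h3 : (s.im : ℂ) * (n * (Real.log 2 : ℝ)) = (2 * k + 1) * Real.pi := by
      exact_mod_cast hs
    nth_rw 1 [h2, ← re_add_im s]
    push_cast
    linear_combination (-I) * h3
  rw [h1, exp_sub, exp_add, exp_int_mul_two_pi_mul_I, mul_one, exp_pi_mul_I, div_neg, div_one,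
    ofReal_exp]

theorem exists_norm_le_of_norm_one_sub_two_cpow_mul_le {G : ℂ → ℂ}
    (hG : DifferentiableOn ℂ G {s | 1 / 2 < s.re}) {n : ℕ} (hn : 1 ≤ n) {B : ℕ}
    (hGn : ∀ η : ℝ, 0 < η → ∃ C : ℝ, ∀ s : ℂ, 1 / 2 + η ≤ s.re → s.re ≤ 4 →
      ‖(1 - (2 : ℂ) ^ (n * (1 - s))) * G s‖ ≤ C * (1 + |s.im|) ^ B) {η : ℝ} (hη : 0 < η) :
    ∃ C : ℝ, ∃ B : ℕ, ∀ s : ℂ, 1 / 2 + η ≤ s.re → s.re ≤ 4 → ‖G s‖ ≤ C * (1 + |s.im|) ^ B := by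
  obtain ⟨a, ha₀, ha₁, haη⟩ : ∃ a : ℝ, 1 / 2 < a ∧ a < 1 ∧ a ≤ 1 / 2 + η :=
    ⟨1 / 2 + min η (1 / 4), by have := lt_min hη (by norm_num : (0 : ℝ) < 1 / 4); linarith,
      by linarith [min_le_right η (1 / 4)], by linarith [min_le_left η (1 / 4)]⟩
  obtain ⟨C, hC⟩ := hGn (a - 1 / 2) (by linarith)
  rw [add_sub_cancel] at hC
  have hn' : (1 : ℝ) ≤ n := by exact_mod_cast hn
  have hlog : 0 < n * Real.log 2 := by positivity
  set m : ℝ := min (1 / 2) ((2 : ℝ) ^ (1 - a) - 1) with hm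
  have hm0 : 0 < m := lt_min (by norm_num)
    (by linarith [Real.one_lt_rpow one_lt_two (by linarith : 0 < 1 - a)])
  have hm1 : m ≤ 1 / 2 := min_le_left _ _
  have hnorm (s : ℂ) : ‖(2 : ℂ) ^ (n * (1 - s))‖ = (2 : ℝ) ^ (n * (1 - s.re)) := by
    have := norm_cpow_eq_rpow_re_of_pos two_pos (n * (1 - s))
    simpa using this
  set τ : ℝ := 2 * Real.pi / (n * Real.log 2) with hτ
  have hτ0 : 0 < τ := by positivity
  refine ⟨|C| / m * (1 + τ) ^ B, B, fun s h1 h2 => ?_⟩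
  set k : ℤ := ⌊s.im / τ - 1 / 2⌋ with hk
  set T : ℝ := (k + 1 / 2) * τ with hT
  have hTs : T ≤ s.im := by
    have : (k : ℝ) ≤ s.im / τ - 1 / 2 := Int.floor_le _
    rw [hT, ← le_div_iff₀ hτ0]; linarith
  have hTs' : s.im ≤ T + τ := by
    have : s.im / τ - 1 / 2 < k + 1 := Int.lt_floor_add_one _
    have h : s.im / τ ≤ (k + 1 / 2) + 1 := by linarith
    rw [div_le_iff₀ hτ0] at h
    rw [hT]; linarith
  have hTτ (j : ℤ) : (j + 1 / 2) * τ * (n * Real.log 2) = (2 * j + 1) * Real.pi := by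
    rw [hτ, mul_assoc, div_mul_cancel₀ _ hlog.ne']; ring
  have hclosure : closure (Set.Ioo a 4 ×ℂ Set.Ioo T (T + τ)) =
      Set.Icc a 4 ×ℂ Set.Icc T (T + τ) := by
    rw [closure_reProdIm, closure_Ioo (by linarith), closure_Ioo (by linarith)]
  have hin : ∀ z ∈ Set.Icc a 4 ×ℂ Set.Icc T (T + τ), |z.im| ≤ |s.im| + τ := by
    rintro z ⟨-, hz⟩
    have h3 : T ≤ z.im := hz.1
    have h4 : z.im ≤ T + τ := hz.2
    rw [abs_le]
    constructor <;> linarith [neg_abs_le s.im, le_abs_self s.im]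
  have hlower : ∀ z ∈ frontier (Set.Ioo a 4 ×ℂ Set.Ioo T (T + τ)),
      m ≤ ‖1 - (2 : ℂ) ^ (n * (1 - z))‖ := by
    intro z hz
    rw [frontier_reProdIm, frontier_Ioo (by linarith), frontier_Ioo (by linarith)] at hz
    rcases hz with hz | hz
    · obtain ⟨j, hj⟩ : ∃ j : ℤ, z.im * (n * Real.log 2) = (2 * j + 1) * Real.pi := by
        rcases hz.2 with h | h
        · refine ⟨k, ?_⟩
          rw [show z.im = T from h, hT, hTτ]
        · refine ⟨k + 1, ?_⟩
          rw [show z.im = T + τ from h, hT, ← hTτ]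
          push_cast; ring
      rw [two_cpow_eq_neg_of_im hj, sub_neg_eq_add, ← ofReal_one, ← ofReal_add, norm_real,
        Real.norm_of_nonneg (by positivity)]
      have : 0 < (2 : ℝ) ^ (n * (1 - z.re)) := by positivity
      linarith
    · rcases hz.1 with h | h
      · have h3 := norm_sub_norm_le ((2 : ℂ) ^ (n * (1 - z))) 1
        rw [hnorm, show z.re = a from h, norm_one, norm_sub_rev] at h3
        have h4 : (2 : ℝ) ^ (1 - a) ≤ 2 ^ (n * (1 - a)) :=
          Real.rpow_le_rpow_of_exponent_le one_le_two (by nlinarith)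
        linarith [min_le_right (1 / 2) ((2 : ℝ) ^ (1 - a) - 1)]
      · have h3 := norm_sub_norm_le 1 ((2 : ℂ) ^ (n * (1 - z)))
        rw [hnorm, show z.re = 4 from h, norm_one] at h3
        have h4 : (2 : ℝ) ^ (n * (1 - 4 : ℝ)) ≤ 2 ^ (-1 : ℝ) :=
          Real.rpow_le_rpow_of_exponent_le one_le_two (by linarith)
        rw [Real.rpow_neg_one] at h4
        exact (le_sub_comm.mpr (h4.trans (by linarith))).trans h3
  have hbdd : Bornology.IsBounded (Set.Ioo a 4 ×ℂ Set.Ioo T (T + τ)) :=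
    (Metric.isBounded_Ioo _ _).reProdIm (Metric.isBounded_Ioo _ _)
  have hsub : closure (Set.Ioo a 4 ×ℂ Set.Ioo T (T + τ)) ⊆ {s | 1 / 2 < s.re} := by
    rw [hclosure]
    rintro z ⟨hz, -⟩
    exact ha₀.trans_le hz.1
  refine (norm_le_of_forall_mem_frontier_norm_le hbdd (hG.mono hsub).diffContOnCl
    (C := |C| / m * (1 + (|s.im| + τ)) ^ B) (fun z hz => ?_) ?_).trans ?_
  · have hz' := frontier_subset_closure hz
    rw [hclosure] at hz'
    have h3 := hC z hz'.1.1 hz'.1.2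
    have h4 : m * ‖G z‖ ≤ |C| * (1 + (|s.im| + τ)) ^ B := by
      calc m * ‖G z‖ ≤ ‖1 - (2 : ℂ) ^ (n * (1 - z))‖ * ‖G z‖ := by
            gcongr; exact hlower z hz
        _ ≤ C * (1 + |z.im|) ^ B := by rwa [← norm_mul]
        _ ≤ _ := by
            gcongr
            · exact le_abs_self _
            · exact hin z hz'
    rw [div_mul_eq_mul_div, le_div_iff₀ hm0]
    linarith
  · rw [hclosure]
    exact ⟨⟨by linarith, h2⟩, hTs, hTs'⟩
  · rw [mul_assoc, ← mul_pow]
    gcongr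
    nlinarith [abs_nonneg s.im]

section EulerProduct

variable {R : Type*} [CommRing R] [IsDedekindDomain R]

open scoped Classical in
theorem tsum_mul_prod_one_sub_eq {f : Ideal R →*₀ ℂ} (hf : Summable fun I => ‖f I‖)
    (S : Finset {p : Ideal R // Prime p}) :
    (∑' I, f I) * ∏ p ∈ S, (1 - f p) = ∑' I, if ∀ p ∈ S, ¬ p.1 ∣ I then f I else 0 := by
  induction S using Finset.induction_on with
  | empty => simp
  | insert p S hp ih =>
    rw [Finset.prod_insert hp, mul_left_comm, ih]
    set g : Ideal R → ℂ := fun I => if ∀ q ∈ S, ¬ q.1 ∣ I then f I else 0 with hg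
    have hgf (I : Ideal R) : ‖g I‖ ≤ ‖f I‖ := by
      simp only [hg]; split_ifs <;> simp
    have hgs : Summable g := Summable.of_norm_bounded hf hgf
    have hgp : Summable fun I => if p.1 ∣ I then g I else 0 :=
      Summable.of_norm_bounded hf fun I => by
        split_ifs
        · exact hgf I
        · simp
    have hmul (J : Ideal R) : g (p.1 * J) = f p * g J := by
      have : (∀ q ∈ S, ¬ q.1 ∣ p.1 * J) ↔ ∀ q ∈ S, ¬ q.1 ∣ J := by
        refine forall₂_congr fun q hq => not_congr ⟨fun h => ?_, fun h => h.mul_left _⟩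
        refine (q.2.dvd_or_dvd h).resolve_left fun h' => hp ?_
        have : q = p := Subtype.ext (associated_iff_eq.mp (q.2.associated_of_dvd p.2 h'))
        exact this ▸ hq
      simp only [hg, this, map_mul, mul_ite, mul_zero]
    have h1 : ∑' I, (if p.1 ∣ I then g I else 0) = f p * ∑' I, g I := by
      rw [← tsum_mul_left, ← (mul_right_injective₀ p.2.ne_zero).tsum_eq]
      · exact tsum_congr fun J => by rw [if_pos (dvd_mul_right _ _), hmul]
      · intro I hI
        by_contra h
        exact hI (if_neg fun ⟨J, hJ⟩ => h ⟨J, hJ.symm⟩)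
    rw [sub_mul, one_mul, ← h1, ← hgs.tsum_sub hgp]
    refine tsum_congr fun I => ?_
    by_cases h : p.1 ∣ I <;> simp [hg, h]

theorem tendsto_tsum_mul_prod_one_sub {f : Ideal R →*₀ ℂ} (hf : Summable fun I => ‖f I‖) :
    Tendsto (fun S : Finset {p : Ideal R // Prime p} => (∑' I, f I) * ∏ p ∈ S, (1 - f p))
      atTop (𝓝 1) := by
  classical
  simp_rw [tsum_mul_prod_one_sub_eq hf]
  have h1 : (1 : ℂ) = ∑' I : Ideal R, if I = 1 then 1 else 0 := by rw [tsum_ite_eq]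
  rw [h1]
  refine tendsto_tsum_of_dominated_convergence hf (fun I => ?_)
    (Eventually.of_forall fun S I => ?_)
  · by_cases hI1 : I = 1
    · refine tendsto_const_nhds.congr fun S => ?_
      subst hI1
      rw [if_pos rfl, if_pos fun p _ h => p.2.not_isUnit (isUnit_of_dvd_one h), map_one]
    rw [if_neg hI1]
    by_cases hI0 : I = 0
    · refine tendsto_const_nhds.congr fun S => ?_
      subst hI0
      rw [map_zero, ite_self]
    · obtain ⟨p, hp, hpI⟩ := WfDvdMonoid.exists_irreducible_factor
        (fun h => hI1 (isUnit_iff_eq_one.mp h)) hI0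
      refine tendsto_const_nhds.congr' ?_
      filter_upwards [eventually_ge_atTop {⟨p, hp.prime⟩}] with S hS
      rw [if_neg]
      push Not
      exact ⟨_, hS (Finset.mem_singleton_self _), hpI⟩
  · split_ifs <;> simp

theorem norm_one_sub_pow_mul_le_one {a : ℝ} (ha₀ : 0 ≤ a) (ha₁ : a < 1) {z : ℂ} (hz : ‖z‖ = 1) :
    ‖(1 - (a : ℂ)) ^ 3 * (1 - a * z) ^ 4 * (1 - a * z ^ 2)‖ ≤ 1 := by
  have hac₀ : ‖(a : ℂ)‖ < 1 := by
    simp only [Complex.norm_of_nonneg ha₀, ha₁]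
  have hac₁ : ‖a * z‖ < 1 := by rwa [norm_mul, hz, mul_one]
  have hac₂ : ‖a * z ^ 2‖ < 1 := by rwa [norm_mul, norm_pow, hz, one_pow, mul_one]
  have hpos {w : ℂ} (hw : ‖w‖ < 1) : 0 < ‖1 - w‖ :=
    norm_pos_iff.mpr fun h => by rw [← sub_eq_zero.mp h, norm_one] at hw; exact lt_irrefl _ hw
  have key : 0 ≤ 3 * (-log (1 - a)).re + 4 * (-log (1 - a * z)).re +
      (-log (1 - a * z ^ 2)).re := by
    rw [← ((hasSum_re <| hasSum_taylorSeries_neg_log hac₀).mul_left 3).add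
      ((hasSum_re <| hasSum_taylorSeries_neg_log hac₁).mul_left 4) |>.add
      (hasSum_re <| hasSum_taylorSeries_neg_log hac₂) |>.tsum_eq]
    refine tsum_nonneg fun n ↦ ?_
    simp only [← ofReal_pow, div_natCast_re, ofReal_re, mul_pow, mul_re, ofReal_im, zero_mul,
      sub_zero]
    rcases n.eq_zero_or_pos with rfl | hn
    · simp
    · simp only [← mul_div_assoc, ← add_div]
      refine div_nonneg ?_ n.cast_nonneg
      rw [← pow_mul, pow_mul', sq, mul_re, ← sq, ← sq, ← sq_norm_sub_sq_re, norm_pow, hz]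
      convert! (show 0 ≤ 2 * a ^ n * ((z ^ n).re + 1) ^ 2 by positivity) using 1
      ring
  simp only [neg_re, log_re] at key
  have h1 := hpos hac₀
  have h2 := hpos hac₁
  have h3 := hpos hac₂
  rw [norm_mul, norm_mul, norm_pow, norm_pow, ← Real.log_nonpos_iff (by positivity),
    Real.log_mul (by positivity) (by positivity), Real.log_mul (by positivity) (by positivity),
    Real.log_pow, Real.log_pow]
  push_cast
  linarith

end EulerProduct

section DedekindZeta

variable {K : Type*} [Field K] [NumberField K]

/-- The completely multiplicative function `I ↦ N(I) ^ (-s)` on ideals, vanishing at `0`. -/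
noncomputable def absNormCpow (K : Type*) [Field K] [NumberField K] {s : ℂ} (hs : s ≠ 0) :
    Ideal (𝓞 K) →*₀ ℂ where
  toFun I := ((Ideal.absNorm I : ℕ) : ℂ) ^ (-s)
  map_zero' := by simp [hs]
  map_one' := by simp
  map_mul' I J := by rw [map_mul, Nat.cast_mul, natCast_mul_natCast_cpow]

theorem hasSum_absNormCpow {s z : ℂ} (hs : s ≠ 0)
    (h : HasSum (fun I : {I : Ideal (𝓞 K) // I ≠ ⊥} =>
      ((Ideal.absNorm I.1 : ℕ) : ℂ) ^ (-s)) z) :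
    HasSum (absNormCpow K hs) z := by
  refine (hasSum_subtype_iff_of_support_subset (s := {I | I ≠ ⊥}) fun I hI => ?_).mp h
  rintro rfl
  exact hI (map_zero _)

variable {ζK : ℂ → ℂ} (hζ : ∀ s : ℂ, 1 < s.re →
  HasSum (fun I : {I : Ideal (𝓞 K) // I ≠ ⊥} => ((Ideal.absNorm I.1 : ℕ) : ℂ) ^ (-s)) (ζK s))

include hζ

theorem tendsto_zeta_mul_prod_one_sub {s : ℂ} (hs : 1 < s.re) :
    Tendsto (fun S : Finset {p : Ideal (𝓞 K) // Prime p} =>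
      ζK s * ∏ p ∈ S, (1 - ((Ideal.absNorm p.1 : ℕ) : ℂ) ^ (-s))) atTop (𝓝 1) := by
  have h := hasSum_absNormCpow (Complex.ne_zero_of_one_lt_re hs) (hζ s hs)
  have := tendsto_tsum_mul_prod_one_sub h.summable.norm
  rw [h.tsum_eq] at this
  exact this

theorem zeta_ne_zero_of_one_lt_re {s : ℂ} (hs : 1 < s.re) : ζK s ≠ 0 := by
  intro h
  have := tendsto_zeta_mul_prod_one_sub hζ hs
  simp [h] at this

theorem one_le_norm_zeta_product {σ : ℝ} (hσ : 1 < σ) (t : ℝ) :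
    1 ≤ ‖ζK σ ^ 3 * ζK (σ + t * I) ^ 4 * ζK (σ + 2 * t * I)‖ := by
  have h1 := tendsto_zeta_mul_prod_one_sub hζ (s := σ) (by simpa)
  have h2 := tendsto_zeta_mul_prod_one_sub hζ (s := σ + t * I) (by simpa)
  have h3 := tendsto_zeta_mul_prod_one_sub hζ (s := σ + 2 * t * I) (by simpa)
  have h := (((h1.pow 3).mul (h2.pow 4)).mul h3).norm
  rw [one_pow, one_pow, one_mul, one_mul, norm_one] at h
  refine le_of_tendsto h (Eventually.of_forall fun S => ?_)
  have hp (p : {p : Ideal (𝓞 K) // Prime p}) :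
      ‖(1 - ((Ideal.absNorm p.1 : ℕ) : ℂ) ^ (-(σ : ℂ))) ^ 3 *
        (1 - ((Ideal.absNorm p.1 : ℕ) : ℂ) ^ (-(σ + t * I))) ^ 4 *
        (1 - ((Ideal.absNorm p.1 : ℕ) : ℂ) ^ (-(σ + 2 * t * I)))‖ ≤ 1 := by
    have hN : 1 < Ideal.absNorm p.1 := by
      have h0 : Ideal.absNorm p.1 ≠ 0 := fun h => p.2.ne_zero (Ideal.absNorm_eq_zero_iff.mp h)
      have h1 : Ideal.absNorm p.1 ≠ 1 := fun h =>
        p.2.not_isUnit (Ideal.isUnit_iff.mpr (Ideal.absNorm_eq_one_iff.mp h))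
      lia
    have hN0 : ((Ideal.absNorm p.1 : ℕ) : ℂ) ≠ 0 := by
      exact_mod_cast (zero_lt_one.trans hN).ne'
    have hN1 : (1 : ℝ) < (Ideal.absNorm p.1 : ℕ) := by exact_mod_cast hN
    have key := norm_one_sub_pow_mul_le_one (a := ((Ideal.absNorm p.1 : ℕ) : ℝ) ^ (-σ))
      (z := ((Ideal.absNorm p.1 : ℕ) : ℂ) ^ (-(t * I))) (by positivity)
      (Real.rpow_lt_one_of_one_lt_of_neg hN1 (by linarith))
      (by rw [norm_natCast_cpow_of_pos (by lia)]; simp)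
    rw [ofReal_cpow (by positivity)] at key
    simp only [ofReal_natCast, ofReal_neg] at key
    rw [← cpow_add _ _ hN0, ← cpow_nat_mul, ← cpow_add _ _ hN0] at key
    have e1 : -((σ : ℂ) + t * I) = -σ + -(t * I) := by ring
    have e2 : -((σ : ℂ) + 2 * t * I) = -σ + ((2 : ℕ) : ℂ) * -(t * I) := by push_cast; ring
    rw [e1, e2]
    exact key
  calc _ = ‖ζK σ ^ 3 * ζK (σ + t * I) ^ 4 * ζK (σ + 2 * t * I)‖ *
        ∏ p ∈ S, ‖(1 - ((Ideal.absNorm p.1 : ℕ) : ℂ) ^ (-(σ : ℂ))) ^ 3 *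
        (1 - ((Ideal.absNorm p.1 : ℕ) : ℂ) ^ (-(σ + t * I))) ^ 4 *
        (1 - ((Ideal.absNorm p.1 : ℕ) : ℂ) ^ (-(σ + 2 * t * I)))‖ := by
        rw [← norm_prod, ← norm_mul, Finset.prod_mul_distrib, Finset.prod_mul_distrib,
          Finset.prod_pow, Finset.prod_pow]
        congr 1
        ring
    _ ≤ _ := mul_le_of_le_one_right (norm_nonneg _)
        (Finset.prod_le_one (fun _ _ => norm_nonneg _) fun p _ => hp p)

theorem zeta_ne_zero_of_re_eq_one (hζd : ∀ s : ℂ, s ≠ 1 → DifferentiableAt ℂ ζK s) {A : ℂ}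
    (hA : Tendsto (fun s : ℂ => (s - 1) * ζK s) (𝓝[≠] (1 : ℂ)) (𝓝 A))
    {s : ℂ} (hs : s.re = 1) (hs1 : s ≠ 1) : ζK s ≠ 0 := by
  intro h0
  set t := s.im with ht
  have hst : s = 1 + t * I := by rw [← re_add_im s, hs, ofReal_one]
  have ht0 : t ≠ 0 := fun h => hs1 (by rw [hst, h]; simp)
  have hto (z : ℂ) : Tendsto (fun σ : ℝ => (σ : ℂ) + z) (𝓝[>] 1) (𝓝 (1 + z)) := by
    have : Continuous fun σ : ℝ => (σ : ℂ) + z := by fun_prop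
    simpa using (this.tendsto 1).mono_left nhdsWithin_le_nhds
  have hne (z : ℂ) : ∀ᶠ σ : ℝ in 𝓝[>] 1, (σ : ℂ) + z ≠ 1 + z := by
    filter_upwards [self_mem_nhdsWithin] with σ hσ h
    exact (ne_of_gt hσ) (by exact_mod_cast add_right_cancel h)
  have h1 : Tendsto (fun σ : ℝ => ((σ : ℂ) - 1) * ζK σ) (𝓝[>] 1) (𝓝 A) := by
    have := hA.comp (tendsto_nhdsWithin_iff.mpr ⟨by simpa using hto 0, by simpa using hne 0⟩)
    simpa [Function.comp_def] using this
  have h2 : Tendsto (fun σ : ℝ => ((σ : ℂ) - 1)⁻¹ * ζK (σ + t * I)) (𝓝[>] 1)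
      (𝓝 (deriv ζK s)) := by
    have hd := (hζd s hs1).hasDerivAt.tendsto_slope
    rw [hst] at hd ⊢
    have := hd.comp (tendsto_nhdsWithin_iff.mpr ⟨hto (t * I), hne (t * I)⟩)
    refine this.congr fun σ => ?_
    rw [Function.comp_apply, slope_def_field, ← hst, h0]
    rw [hst]
    ring
  have h3 : Tendsto (fun σ : ℝ => ζK (σ + 2 * t * I)) (𝓝[>] 1) (𝓝 (ζK (1 + 2 * t * I))) := by
    refine (hζd _ fun h => ht0 ?_).continuousAt.tendsto.comp (hto (2 * t * I))
    simpa using congrArg im h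
  have h4 : Tendsto (fun σ : ℝ => (σ : ℂ) - 1) (𝓝[>] 1) (𝓝 0) := by
    simpa [sub_eq_add_neg] using hto (-1)
  have h := (((h1.pow 3).mul (h2.pow 4)).mul (h4.mul h3)).norm
  rw [zero_mul, mul_zero, norm_zero] at h
  have hle : ∀ᶠ σ : ℝ in 𝓝[>] 1, 1 ≤ ‖(((σ : ℂ) - 1) * ζK σ) ^ 3 *
      (((σ : ℂ) - 1)⁻¹ * ζK (σ + t * I)) ^ 4 * (((σ : ℂ) - 1) * ζK (σ + 2 * t * I))‖ := by
    filter_upwards [self_mem_nhdsWithin] with σ hσ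
    have hσ1 : (σ : ℂ) - 1 ≠ 0 := sub_ne_zero.mpr (by exact_mod_cast (ne_of_gt hσ))
    refine (one_le_norm_zeta_product hζ hσ t).trans_eq ?_
    congr 1
    field_simp
  exact absurd (ge_of_tendsto h hle) (by norm_num)

end DedekindZeta

theorem norm_ofReal_cpow_neg_le_one {a : ℝ} (ha : a = 0 ∨ 1 ≤ a) {u : ℂ} (hu : 0 < u.re) :
    ‖(a : ℂ) ^ (-u)‖ ≤ 1 := by
  rcases ha with rfl | ha
  · have : u ≠ 0 := fun h => by simp [h] at hu
    simp [this]
  · rw [norm_cpow_eq_rpow_re_of_pos (by linarith)]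
    exact Real.rpow_le_one_of_one_le_of_nonpos ha (by simp [hu.le])

theorem norm_ofReal_cpow_neg_sub_le {a b p : ℝ} (hp : 0 < p) (ha : p ≤ a) (hb : p ≤ b) {u : ℂ}
    (hu : 0 ≤ u.re) :
    ‖(a : ℂ) ^ (-u) - (b : ℂ) ^ (-u)‖ ≤ ‖u‖ * p ^ (-(u.re + 1)) * |a - b| := by
  rcases eq_or_ne u 0 with rfl | hu0
  · simp
  refine (convex_Ici p).norm_image_sub_le_of_norm_hasDerivWithin_le
    (f := fun x : ℝ => (x : ℂ) ^ (-u)) (f' := fun x : ℝ => -u * (x : ℂ) ^ (-u - 1))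
    (fun x hx => ?_) (fun x hx => ?_) hb ha
  · exact (hasDerivAt_ofReal_cpow_const (hp.trans_le hx).ne' (neg_ne_zero.mpr hu0)).hasDerivWithinAt
  · rw [norm_mul, norm_neg, norm_cpow_eq_rpow_re_of_pos (hp.trans_le hx)]
    refine mul_le_mul_of_nonneg_left ?_ (norm_nonneg _)
    have : (-u - 1).re = -(u.re + 1) := by simp; ring
    rw [this]
    exact Real.rpow_le_rpow_of_nonpos hp hx (by linarith)

section Lattice

variable {V T : Type*} [AddCommGroup V] [Fintype T] {q : V → ℝ}

theorem norm_sum_cpow_sub_cpow_le (τ : T → V) (hq₀ : q 0 = 0)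
    (hq₁ : ∀ x, x ≠ 0 → 1 ≤ q x) (hq₂ : ∀ x, q (2 • x) = 2 * q x)
    (hqadd : ∀ x y, |q (x + y) - q x| ≤ q y) {Q : ℝ} (hQ : 1 ≤ Q) (hQτ : ∀ t, q (τ t) ≤ Q)
    {σ : ℝ} (hσ : 0 < σ) {u : ℂ} (hu : σ ≤ u.re) (x : V) :
    ‖∑ t, ((q (2 • x + τ t) : ℂ) ^ (-u) - (q (2 • x) : ℂ) ^ (-u))‖ ≤
      Fintype.card T * ((2 + ‖u‖) * Q ^ (σ + 1)) * (max 1 (q x)) ^ (-(σ + 1)) := by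
  have hq (x : V) : q x = 0 ∨ 1 ≤ q x := by
    rcases eq_or_ne x 0 with rfl | h
    · exact Or.inl hq₀
    · exact Or.inr (hq₁ x h)
  obtain ⟨p, hp⟩ : ∃ p, p = max 1 (q x) := ⟨_, rfl⟩
  rw [← hp, mul_assoc, ← nsmul_eq_mul, ← Finset.card_univ]
  have hp1 : 1 ≤ p := hp ▸ le_max_left _ _
  have hp0 : 0 < p := by linarith
  have hu0 : 0 < u.re := by linarith
  refine (norm_sum_le _ _).trans (Finset.sum_le_card_nsmul _ _ _ fun t _ => ?_)
  rcases le_or_gt p Q with hpQ | hpQ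
  · have h1 : (1 : ℝ) ≤ Q ^ (σ + 1) * p ^ (-(σ + 1)) := by
      rw [Real.rpow_neg hp0.le, ← div_eq_mul_inv, one_le_div (by positivity)]
      exact Real.rpow_le_rpow hp0.le hpQ (by linarith)
    calc _ ≤ (2 : ℝ) := (norm_sub_le _ _).trans (by
          linarith [norm_ofReal_cpow_neg_le_one (hq (2 • x + τ t)) hu0,
            norm_ofReal_cpow_neg_le_one (hq (2 • x)) hu0])
      _ ≤ (2 + ‖u‖) * (Q ^ (σ + 1) * p ^ (-(σ + 1))) := by
          nlinarith [norm_nonneg u]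
      _ = _ := by ring
  · have hqx : q x = p := by
      rcases max_choice 1 (q x) with h | h
      · linarith
      · linarith
    have hd := (hqadd (2 • x) (τ t)).trans (hQτ t)
    have hd' := abs_le.mp hd
    rw [hq₂, hqx] at hd hd' ⊢
    calc _ ≤ ‖u‖ * p ^ (-(u.re + 1)) * |q (2 • x + τ t) - 2 * p| :=
          norm_ofReal_cpow_neg_sub_le hp0 (by linarith) (by linarith) hu0.le
      _ ≤ ‖u‖ * p ^ (-(σ + 1)) * Q ^ (σ + 1) := by
          gcongr
          exact hd.trans (Real.self_le_rpow_of_one_le hQ (by linarith))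
      _ ≤ (2 + ‖u‖) * p ^ (-(σ + 1)) * Q ^ (σ + 1) := by
          gcongr
          linarith
      _ = _ := by ring

theorem exists_differentiableOn_eq_mul_tsum (e : V × T ≃ V) (τ : T → V)
    (he : ∀ x t, e (x, t) = 2 • x + τ t) (hq₀ : q 0 = 0)
    (hq₁ : ∀ x, x ≠ 0 → 1 ≤ q x) (hq₂ : ∀ x, q (2 • x) = 2 * q x)
    (hqadd : ∀ x y, |q (x + y) - q x| ≤ q y) {n : ℕ} (hn : 1 ≤ n)
    (hT : Fintype.card T = 2 ^ n)
    (hq : ∀ r : ℝ, n < r → Summable fun x => q x ^ (-r)) :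
    ∃ S : ℂ → ℂ, DifferentiableOn ℂ S {u | (n : ℝ) - 1 < u.re} ∧
      (∀ u : ℂ, n < u.re → S u = (1 - 2 ^ (n - u)) * ∑' x, (q x : ℂ) ^ (-u)) ∧
      ∀ σ : ℝ, n - 1 < σ → ∃ C : ℝ, ∀ u : ℂ, σ ≤ u.re → ‖S u‖ ≤ C * (2 + ‖u‖) := by
  have hn1 : (1 : ℝ) ≤ n := by exact_mod_cast hn
  have hqpos (x : V) : 0 ≤ q x := by
    rcases eq_or_ne x 0 with rfl | h
    · exact hq₀.ge
    · exact zero_le_one.trans (hq₁ x h)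
  obtain ⟨Q, hQ, hQτ⟩ : ∃ Q : ℝ, 1 ≤ Q ∧ ∀ t, q (τ t) ≤ Q :=
    ⟨1 + ∑ t, q (τ t), le_add_of_nonneg_right (Finset.sum_nonneg fun _ _ => hqpos _), fun t =>
      (Finset.single_le_sum (fun t _ => hqpos (τ t)) (Finset.mem_univ t)).trans (by linarith)⟩
  have hmax {σ : ℝ} (hσ : n - 1 < σ) : Summable fun x => (max 1 (q x)) ^ (-(σ + 1)) := by
    classical
    refine Summable.of_nonneg_of_le (fun x => by positivity) (fun x => ?_)
      ((hq (σ + 1) (by linarith)).add (hasSum_ite_eq (0 : V) (1 : ℝ)).summable)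
    rcases eq_or_ne x 0 with rfl | h
    · simp [hq₀, Real.zero_rpow (show -1 + -σ ≠ 0 by linarith)]
    · rw [if_neg h, max_eq_right (hq₁ x h), add_zero]
  have hbound {σ : ℝ} (hσ : n - 1 < σ) {u : ℂ} (hu : σ ≤ u.re) (x : V) :=
    norm_sum_cpow_sub_cpow_le τ hq₀ hq₁ hq₂ hqadd hQ hQτ (by linarith : 0 < σ) hu x
  refine ⟨fun u => ∑' x, ∑ t, ((q (2 • x + τ t) : ℂ) ^ (-u) - (q (2 • x) : ℂ) ^ (-u)),
    fun u hu => ?_, fun u hu => ?_, fun σ hσ => ?_⟩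
  · obtain ⟨σ, hσ, hσu⟩ := exists_between (Set.mem_ofPred.mp hu)
    have hopen : IsOpen ({v : ℂ | σ < v.re} ∩ Metric.ball 0 (‖u‖ + 1)) :=
      (isOpen_lt continuous_const continuous_re).inter Metric.isOpen_ball
    have := differentiableOn_tsum_of_summable_norm
      ((hmax hσ).mul_left (Fintype.card T * ((2 + (‖u‖ + 1)) * Q ^ (σ + 1))))
      (F := fun x v => ∑ t, ((q (2 • x + τ t) : ℂ) ^ (-v) - (q (2 • x) : ℂ) ^ (-v)))
      (fun x v hv => ?_) hopen fun x v hv => ?_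
    · exact (this.differentiableAt (hopen.mem_nhds ⟨hσu, by simp⟩)).differentiableWithinAt
    · have hv0 : -v ≠ 0 := fun h => by
        have : v.re = 0 := by rw [neg_eq_zero.mp h, zero_re]
        linarith [hv.1.out]
      refine DifferentiableAt.differentiableWithinAt (.fun_sum fun t _ => .sub ?_ ?_)
      · exact (differentiableAt_id.neg).const_cpow (Or.inr hv0)
      · exact (differentiableAt_id.neg).const_cpow (Or.inr hv0)
    · refine (hbound hσ hv.1.le x).trans ?_
      have := mem_ball_zero_iff.mp hv.2
      gcongr
  · have hs : Summable fun x => (q x : ℂ) ^ (-u) := by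
      refine .of_norm_bounded (hq u.re hu) fun x => ?_
      rw [norm_cpow_eq_rpow_re_of_nonneg (hqpos x) (by simp; linarith), neg_re]
    have hse : Summable fun p : V × T => (q (2 • p.1 + τ p.2) : ℂ) ^ (-u) := by
      exact (e.summable_iff.mpr hs).congr fun p => by rw [Function.comp_apply, he]
    have h1 : ∑' x, (q x : ℂ) ^ (-u) = ∑' x, ∑ t, (q (2 • x + τ t) : ℂ) ^ (-u) := by
      rw [← e.tsum_eq]
      exact (tsum_congr fun p => by rw [he]).trans
        (hse.tsum_prod.trans (tsum_congr fun x => tsum_fintype _))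
    have h2 (x : V) : ∑ _t : T, (q (2 • x) : ℂ) ^ (-u) = 2 ^ (n - u) * (q x : ℂ) ^ (-u) := by
      rw [Finset.sum_const, Finset.card_univ, hT, hq₂, nsmul_eq_mul, ofReal_mul,
        mul_cpow_ofReal_nonneg two_pos.le (hqpos x), sub_eq_add_neg,
        cpow_add _ _ two_ne_zero, cpow_natCast]
      push_cast
      ring
    simp only [Finset.sum_sub_distrib, h2]
    rw [Summable.tsum_sub, ← h1, tsum_mul_left, sub_mul, one_mul]
    · simpa using hse.prod
    · exact hs.mul_left _
  · refine ⟨Fintype.card T * Q ^ (σ + 1) * ∑' x, (max 1 (q x)) ^ (-(σ + 1)), fun u hu => ?_⟩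
    refine (tsum_of_norm_bounded ((hmax hσ).mul_left _).hasSum (hbound hσ hu)).trans_eq ?_
    rw [tsum_mul_left]
    ring

end Lattice

theorem exists_equiv_two_nsmul_add {V : Type*} [AddCommGroup V] {n : ℕ}
    (v : V ≃ₗ[ℤ] (Fin n → ℤ)) :
    ∃ (e : V × (Fin n → Fin 2) ≃ V) (τ : (Fin n → Fin 2) → V),
      ∀ x t, e (x, t) = 2 • x + τ t := by
  refine ⟨(v.toEquiv.prodCongr (Equiv.refl _)).trans
    ((Equiv.arrowProdEquivProdArrow (Fin n) (fun _ => ℤ) fun _ => Fin 2).symm.trans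
      ((Equiv.piCongrRight fun _ => (Int.divModEquiv 2).symm).trans v.toEquiv.symm)),
    fun t => v.symm fun i => ((t i : ℕ) : ℤ), fun x t => v.injective ?_⟩
  ext i
  simp [mul_comm]

section ClassGroup

variable {R : Type*} [CommRing R] [IsDedekindDomain R]

/-- The class of a nonzero ideal. -/
noncomputable def idealClass (I : {I : Ideal R // I ≠ ⊥}) : ClassGroup R :=
  ClassGroup.mk0 ⟨I.1, mem_nonZeroDivisors_of_ne_zero I.2⟩

theorem idealClass_eq_mk0_inv_iff (I : {I : Ideal R // I ≠ ⊥}) {J : Ideal R}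
    (hJ : J ∈ nonZeroDivisors (Ideal R)) :
    idealClass I = (ClassGroup.mk0 ⟨J, hJ⟩)⁻¹ ↔ ∃ x ≠ (0 : R), I.1 * J = Ideal.span {x} := by
  rw [idealClass, ClassGroup.mk0_eq_mk0_inv_iff]

theorem exists_equiv_idealClass_prod_units (c : ClassGroup R) :
    ∃ (J : Ideal R) (e : {I : {I : Ideal R // I ≠ ⊥} // idealClass I = c} × Rˣ ≃ {x : J // x ≠ 0}),
      J ≠ ⊥ ∧ ∀ p, Ideal.span {((e p).1 : R)} = p.1.1.1 * J := by
  obtain ⟨⟨J, hJ⟩, hJc⟩ := ClassGroup.mk0_surjective c⁻¹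
  have hJ0 : J ≠ ⊥ := nonZeroDivisors.ne_zero hJ
  have hex (I : {I : {I : Ideal R // I ≠ ⊥} // idealClass I = c}) :
      ∃ x ≠ (0 : R), I.1.1 * J = Ideal.span {x} := by
    exact (idealClass_eq_mk0_inv_iff I.1 hJ).mp (by rw [hJc, inv_inv, I.2])
  choose g hg0 hg using hex
  have hgJ (I : {I : {I : Ideal R // I ≠ ⊥} // idealClass I = c}) (u : Rˣ) : g I * u ∈ J := by
    refine J.mul_mem_right _ ((Ideal.mul_le_right : I.1.1 * J ≤ J) ?_)
    rw [hg]
    exact Ideal.mem_span_singleton_self _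
  have hspan (I : {I : {I : Ideal R // I ≠ ⊥} // idealClass I = c}) (u : Rˣ) :
      Ideal.span {g I * u} = I.1.1 * J := by
    rw [hg, Ideal.span_singleton_mul_right_unit u.isUnit]
  refine ⟨J, Equiv.ofBijective (fun p => ⟨⟨g p.1 * p.2, hgJ _ _⟩, fun h =>
    (mul_ne_zero (hg0 p.1) p.2.ne_zero) (congrArg Subtype.val h)⟩) ⟨?_, ?_⟩, hJ0, fun p => hspan _ _⟩
  · rintro ⟨I, u⟩ ⟨I', u'⟩ h
    have h' : g I * u = g I' * u' := congrArg (fun x => (x.1 : R)) h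
    have hI : I = I' := by
      have := congrArg (fun x => Ideal.span {x}) h'
      rw [hspan, hspan] at this
      exact Subtype.ext (Subtype.ext (mul_right_cancel₀ hJ0 this))
    subst hI
    rw [Units.ext (mul_left_cancel₀ (hg0 I) h')]
  · rintro ⟨⟨x, hx⟩, hx0⟩
    have hx0' : x ≠ 0 := fun h => hx0 (Subtype.ext h)
    obtain ⟨I, hI⟩ : J ∣ Ideal.span {x} :=
      Ideal.dvd_iff_le.mpr ((Ideal.span_singleton_le_iff_mem _).mpr hx)
    have hI0 : I ≠ ⊥ := by
      rintro rfl
      exact hx0' (Ideal.span_singleton_eq_bot.mp (by simpa using hI))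
    have hIc : idealClass ⟨I, hI0⟩ = c := by
      rw [← inv_inv c, ← hJc]
      exact (idealClass_eq_mk0_inv_iff _ hJ).mpr ⟨x, hx0', by rw [hI, mul_comm]⟩
    obtain ⟨u, hu⟩ : Associated (g ⟨⟨I, hI0⟩, hIc⟩) x := by
      rw [← Ideal.span_singleton_eq_span_singleton, ← hg, hI, mul_comm]
    exact ⟨⟨⟨⟨I, hI0⟩, hIc⟩, u⟩, Subtype.ext (Subtype.ext hu)⟩

end ClassGroup

section UniquePlace

variable {K : Type*} [Field K] [NumberField K] [Unique (InfinitePlace K)]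

theorem place_pow_finrank_eq_absNorm (x : 𝓞 K) :
    (default : InfinitePlace K) x ^ Module.finrank ℚ K = (Ideal.absNorm (Ideal.span {x}) : ℝ) := by
  have h := InfinitePlace.prod_eq_abs_norm (x : K)
  have h' := InfinitePlace.sum_mult_eq (K := K)
  rw [Fintype.prod_unique] at h
  rw [Fintype.sum_unique] at h'
  rw [← h', h, Ideal.absNorm_span_singleton, ← Algebra.coe_norm_int, Nat.cast_natAbs]
  simp

theorem one_le_place {x : 𝓞 K} (hx : x ≠ 0) : 1 ≤ (default : InfinitePlace K) x := by
  have h := place_pow_finrank_eq_absNorm x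
  have h0 : (default : InfinitePlace K) x ≥ 0 := apply_nonneg _ _
  have h1 : (1 : ℝ) ≤ (Ideal.absNorm (Ideal.span {x}) : ℝ) := by
    exact_mod_cast Nat.one_le_iff_ne_zero.mpr (by simpa [Ideal.absNorm_eq_zero_iff] using hx)
  rw [← h] at h1
  by_contra hlt
  exact absurd h1 (not_le.mpr (pow_lt_one₀ h0 (not_le.mp hlt) Module.finrank_pos.ne'))

theorem finite_units_of_unique_infinitePlace : Finite (𝓞 K)ˣ := by
  have h : NumberField.Units.torsion K = ⊤ := by
    refine eq_top_iff.mpr fun u _ => (NumberField.Units.mem_torsion K).mpr fun w => ?_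
    have h := place_pow_finrank_eq_absNorm (u : 𝓞 K)
    rw [Ideal.span_singleton_eq_top.mpr u.isUnit, Ideal.absNorm_top, Nat.cast_one] at h
    rw [Unique.eq_default w]
    exact (pow_eq_one_iff_of_nonneg (apply_nonneg _ _) Module.finrank_pos.ne').mp h
  have : Finite (⊤ : Subgroup (𝓞 K)ˣ) := h ▸ inferInstance
  exact Finite.of_equiv _ Subgroup.topEquiv.toEquiv

end UniquePlace

theorem ofReal_cpow_neg_natCast_mul {a : ℝ} (ha : 0 < a) (n : ℕ) (s : ℂ) :
    (a : ℂ) ^ (-(n * s)) = ((a ^ n : ℝ) : ℂ) ^ (-s) := by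
  rw [cpow_def_of_ne_zero (ofReal_ne_zero.mpr ha.ne'),
    cpow_def_of_ne_zero (ofReal_ne_zero.mpr (pow_pos ha n).ne'), ← ofReal_log ha.le,
    ← ofReal_log (pow_pos ha n).le, Real.log_pow]
  push_cast
  ring_nf

theorem hasSum_mul_const_prod {β ι : Type*} [Finite ι] {f : β → ℂ} (hf : Summable f) (z : ℂ) :
    HasSum (fun p : β × ι => f p.1 * z) ((∑' x, f x) * (Nat.card ι * z)) := by
  have : Fintype ι := Fintype.ofFinite ι
  have h : HasSum (fun _ : ι => z) (Nat.card ι * z) := by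
    simpa [Nat.card_eq_fintype_card] using hasSum_fintype fun _ : ι => z
  exact hf.hasSum.mul (g := fun _ : ι => z) h
    (summable_mul_of_summable_norm (g := fun _ : ι => z) hf.norm h.summable.norm)

section ZetaBound

variable {K : Type*} [Field K] [NumberField K] [Unique (InfinitePlace K)] {ζK : ℂ → ℂ}
  (hζ : ∀ s : ℂ, 1 < s.re →
    HasSum (fun I : {I : Ideal (𝓞 K) // I ≠ ⊥} => ((Ideal.absNorm I.1 : ℕ) : ℂ) ^ (-s)) (ζK s))

include hζ

theorem exists_hasSum_place_cpow (c : ClassGroup (𝓞 K)) :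
    ∃ J : Ideal (𝓞 K), J ≠ ⊥ ∧ ∀ s : ℂ, 1 < s.re →
      HasSum (fun x : J => (((default : InfinitePlace K) (x : 𝓞 K) : ℝ) : ℂ) ^
          (-(Module.finrank ℚ K * s)))
        ((∑' I : {I : {I : Ideal (𝓞 K) // I ≠ ⊥} // idealClass I = c},
          ((Ideal.absNorm I.1.1 : ℕ) : ℂ) ^ (-s)) *
          (Nat.card (𝓞 K)ˣ * ((Ideal.absNorm J : ℕ) : ℂ) ^ (-s))) := by
  obtain ⟨J, e, hJ, he⟩ := exists_equiv_idealClass_prod_units c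
  refine ⟨J, hJ, fun s hs => ?_⟩
  have : Finite (𝓞 K)ˣ := finite_units_of_unique_infinitePlace
  have hn : (Module.finrank ℚ K : ℂ) ≠ 0 := Nat.cast_ne_zero.mpr Module.finrank_pos.ne'
  have h1 : Summable fun I : {I : {I : Ideal (𝓞 K) // I ≠ ⊥} // idealClass I = c} =>
      ((Ideal.absNorm I.1.1 : ℕ) : ℂ) ^ (-s) :=
    (hζ s hs).summable.comp_injective Subtype.val_injective
  have h3 := hasSum_mul_const_prod (ι := (𝓞 K)ˣ) h1 (((Ideal.absNorm J : ℕ) : ℂ) ^ (-s))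
  have h4 (p : {I : {I : Ideal (𝓞 K) // I ≠ ⊥} // idealClass I = c} × (𝓞 K)ˣ) :
      (((default : InfinitePlace K) ((e p).1 : 𝓞 K) : ℝ) : ℂ) ^ (-(Module.finrank ℚ K * s)) =
        ((Ideal.absNorm p.1.1.1 : ℕ) : ℂ) ^ (-s) * ((Ideal.absNorm J : ℕ) : ℂ) ^ (-s) := by
    have h0 : ((e p).1 : 𝓞 K) ≠ 0 := fun h => (e p).2 (Subtype.ext h)
    rw [ofReal_cpow_neg_natCast_mul (zero_lt_one.trans_le (one_le_place h0)),
      place_pow_finrank_eq_absNorm, he, map_mul, ofReal_natCast, Nat.cast_mul,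
      natCast_mul_natCast_cpow]
  have h5 : HasSum (fun x : {x : J // x ≠ 0} =>
      (((default : InfinitePlace K) (x.1 : 𝓞 K) : ℝ) : ℂ) ^ (-(Module.finrank ℚ K * s))) _ :=
    e.hasSum_iff.mp ((funext h4).symm ▸ h3)
  refine (hasSum_subtype_iff_of_support_subset (s := {x : J | x ≠ 0}) fun x hx => ?_).mp h5
  rintro rfl
  refine hx ?_
  have : s ≠ 0 := Complex.ne_zero_of_one_lt_re hs
  simp [this, hn]

omit [Unique (InfinitePlace K)] in
theorem tsum_idealClass_absNorm_cpow {s : ℂ} (hs : 1 < s.re) :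
    ∑ c : ClassGroup (𝓞 K), ∑' I : {I : {I : Ideal (𝓞 K) // I ≠ ⊥} // idealClass I = c},
      ((Ideal.absNorm I.1.1 : ℕ) : ℂ) ^ (-s) = ζK s := by
  rw [← tsum_fintype (L := .unconditional _)]
  have h := (Equiv.sigmaFiberEquiv (idealClass (R := 𝓞 K))).hasSum_iff.mpr (hζ s hs)
  exact (h.summable.tsum_sigma' fun c => h.summable.sigma_factor c).symm.trans h.tsum_eq

omit hζ in
theorem exists_differentiableOn_eq_mul_tsum_place {J : Ideal (𝓞 K)} (hJ : J ≠ ⊥)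
    (hsum : ∀ s : ℂ, 1 < s.re → Summable fun x : J =>
      (((default : InfinitePlace K) (x : 𝓞 K) : ℝ) : ℂ) ^ (-(Module.finrank ℚ K * s))) :
    ∃ S : ℂ → ℂ, DifferentiableOn ℂ S {u | (Module.finrank ℚ K : ℝ) - 1 < u.re} ∧
      (∀ u : ℂ, Module.finrank ℚ K < u.re → S u = (1 - 2 ^ (Module.finrank ℚ K - u)) *
        ∑' x : J, (((default : InfinitePlace K) (x : 𝓞 K) : ℝ) : ℂ) ^ (-u)) ∧
      ∀ σ : ℝ, Module.finrank ℚ K - 1 < σ →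
        ∃ C : ℝ, ∀ u : ℂ, σ ≤ u.re → ‖S u‖ ≤ C * (2 + ‖u‖) := by
  have hrank := Ideal.finrank_eq_finrank (RingOfIntegers.basis K) J hJ
  rw [RingOfIntegers.rank] at hrank
  obtain ⟨e, τ, he⟩ := exists_equiv_two_nsmul_add
    (Module.finBasisOfFinrankEq ℤ (J.restrictScalars ℤ) hrank).equivFun
  refine exists_differentiableOn_eq_mul_tsum (V := J) e τ he (by simp)
    (fun x hx => one_le_place fun h => hx (Subtype.ext h)) (fun x => ?_) (fun x y => ?_)
    Module.finrank_pos (by simp) fun r hr => ?_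
  · simp only [← InfinitePlace.norm_embedding_eq]
    have h2 : algebraMap (𝓞 K) K 2 = 2 := map_ofNat _ 2
    have h3 : (default : InfinitePlace K).embedding 2 = 2 := map_ofNat _ 2
    simp [h2, h3]
  · simp only [← InfinitePlace.norm_embedding_eq]
    push_cast
    rw [map_add]
    exact (abs_norm_sub_norm_le _ _).trans_eq (by rw [add_sub_cancel_left])
  · have hn : (0 : ℝ) < Module.finrank ℚ K := Nat.cast_pos.mpr Module.finrank_pos
    refine (hsum ((r / Module.finrank ℚ K : ℝ) : ℂ) ?_).norm.congr fun x => ?_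
    · rw [ofReal_re, one_lt_div hn]
      exact hr
    · have : ((Module.finrank ℚ K : ℂ) * ((r / Module.finrank ℚ K : ℝ) : ℂ)) = (r : ℂ) := by
        exact_mod_cast mul_div_cancel₀ _ hn.ne'
      rw [this, ← ofReal_neg, ← ofReal_cpow (apply_nonneg _ _), Complex.norm_of_nonneg]
      exact Real.rpow_nonneg (apply_nonneg _ _) _

theorem exists_norm_one_sub_two_cpow_mul_le {G : ℂ → ℂ}
    (hG : DifferentiableOn ℂ G {s | 1 / 2 < s.re}) (hGζ : ∀ s : ℂ, 1 < s.re → G s = (s - 1) * ζK s)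
    (hn : Module.finrank ℚ K ≤ 2) {η : ℝ} (hη : 0 < η) :
    ∃ C : ℝ, ∀ s : ℂ, 1 / 2 + η ≤ s.re → s.re ≤ 4 →
      ‖(1 - (2 : ℂ) ^ (Module.finrank ℚ K * (1 - s))) * G s‖ ≤ C * (1 + |s.im|) ^ 2 := by
  choose J hJ hsum using exists_hasSum_place_cpow hζ
  choose S hSd hSe hSb using fun c =>
    exists_differentiableOn_eq_mul_tsum_place (hJ c) fun s hs => (hsum c s hs).summable
  obtain ⟨n, hn_def⟩ : ∃ n, n = Module.finrank ℚ K := ⟨_, rfl⟩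
  simp only [← hn_def] at hn hsum hSd hSe hSb ⊢
  have hn1 : 1 ≤ n := hn_def ▸ Module.finrank_pos
  have hU : (Nat.card (𝓞 K)ˣ : ℂ) ≠ 0 := by
    have : Finite (𝓞 K)ˣ := finite_units_of_unique_infinitePlace
    exact_mod_cast Nat.card_pos.ne'
  have hN (c : ClassGroup (𝓞 K)) : ((Ideal.absNorm (J c) : ℕ) : ℂ) ≠ 0 := by
    exact_mod_cast fun h => hJ c (Ideal.absNorm_eq_zero_iff.mp h)
  obtain ⟨F, hF⟩ : ∃ F : ℂ → ℂ, ∀ s, F s = ∑ c : ClassGroup (𝓞 K),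
    ((Nat.card (𝓞 K)ˣ : ℂ))⁻¹ * ((Ideal.absNorm (J c) : ℕ) : ℂ) ^ s * S c (n * s) := ⟨_, fun _ => rfl⟩
  have hre {s : ℂ} : (n * s).re = n * s.re := by simp
  have hn1' : (1 : ℝ) ≤ n := by exact_mod_cast hn1
  have hn2' : (n : ℝ) ≤ 2 := by exact_mod_cast hn
  have hFζ {s : ℂ} (hs : 1 < s.re) : F s = (1 - (2 : ℂ) ^ (n * (1 - s))) * ζK s := by
    rw [← tsum_idealClass_absNorm_cpow hζ hs, hF, Finset.mul_sum]
    refine Finset.sum_congr rfl fun c _ => ?_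
    rw [hSe c _ (by rw [hre]; nlinarith), (hsum c s hs).tsum_eq, cpow_neg, mul_one_sub]
    have := (cpow_ne_zero_iff_of_exponent_ne_zero (Complex.ne_zero_of_one_lt_re hs)).mpr (hN c)
    field_simp
  have hFd : DifferentiableOn ℂ F {s | 1 / 2 < s.re} := by
    rw [funext hF]
    refine .fun_sum fun c _ => .mul (.mul (differentiableOn_const _) ?_) ?_
    · exact fun s hs => (differentiableAt_id.const_cpow (Or.inl (hN c))).differentiableWithinAt
    · refine (hSd c).comp (by fun_prop) fun s hs => ?_
      have hs : 1 / 2 < s.re := hs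
      change (n : ℝ) - 1 < (n * s).re
      rw [hre]
      nlinarith
  have hopen : IsOpen {s : ℂ | 1 / 2 < s.re} := isOpen_lt continuous_const continuous_re
  have heq : Set.EqOn (fun s : ℂ => (1 - (2 : ℂ) ^ (n * (1 - s))) * G s) (fun s : ℂ => (s - 1) * F s)
      {s | 1 / 2 < s.re} := by
    refine AnalyticOnNhd.eqOn_of_preconnected_of_eventuallyEq (z₀ := 2)
      (DifferentiableOn.analyticOnNhd ?_ hopen) (DifferentiableOn.analyticOnNhd ?_ hopen)
      (convex_halfSpace_re_gt _).isPreconnected (show 1 / 2 < (2 : ℂ).re by norm_num) ?_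
    · refine DifferentiableOn.mul (fun s hs => DifferentiableAt.differentiableWithinAt ?_) hG
      exact (DifferentiableAt.const_cpow (by fun_prop) (Or.inl two_ne_zero)).const_sub _
    · exact DifferentiableOn.mul (by fun_prop) hFd
    · filter_upwards [(isOpen_lt continuous_const continuous_re).mem_nhds
        (show (2 : ℂ) ∈ {s : ℂ | 1 < s.re} by simp)] with s hs
      simp only [hFζ hs, hGζ s hs]
      ring
  have hσ : (n : ℝ) - 1 < n * (1 / 2 + η) := by nlinarith
  choose C hC using fun c => hSb c _ hσ
  have hC0 (c : ClassGroup (𝓞 K)) : 0 ≤ C c := by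
    have := (norm_nonneg _).trans (hC c ((n * (1 / 2 + η) : ℝ) : ℂ) (by simp))
    exact nonneg_of_mul_nonneg_left this (by positivity)
  refine ⟨∑ c, 50 * ((Nat.card (𝓞 K)ˣ : ℝ)⁻¹ * (Ideal.absNorm (J c) : ℝ) ^ (4 : ℝ) * C c),
    fun s hs hs4 => ?_⟩
  have hns : ‖(n : ℂ) * s‖ ≤ 2 * (4 + |s.im|) := by
    rw [norm_mul, Complex.norm_natCast]
    have : ‖s‖ ≤ 4 + |s.im| := (norm_le_abs_re_add_abs_im s).trans (by
      rw [abs_of_nonneg (by linarith)]; linarith)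
    gcongr
  have hs1 : ‖s - 1‖ ≤ 5 + |s.im| := by
    refine (norm_le_abs_re_add_abs_im _).trans ?_
    simp only [sub_re, one_re, sub_im, one_im, sub_zero]
    have : |s.re - 1| ≤ 5 := abs_le.mpr ⟨by linarith, by linarith⟩
    linarith
  have him := abs_nonneg s.im
  rw [show (1 - (2 : ℂ) ^ (n * (1 - s))) * G s = (s - 1) * F s from
    heq (show 1 / 2 < s.re by linarith), hF, Finset.mul_sum, Finset.sum_mul]
  refine norm_sum_le_of_le _ fun c _ => ?_
  have hNc : ‖((Ideal.absNorm (J c) : ℕ) : ℂ) ^ s‖ ≤ (Ideal.absNorm (J c) : ℝ) ^ (4 : ℝ) := by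
    have h1 : 0 < Ideal.absNorm (J c) := Nat.pos_of_ne_zero fun h => hN c (by rw [h, Nat.cast_zero])
    rw [norm_natCast_cpow_of_pos h1]
    exact Real.rpow_le_rpow_of_exponent_le (by exact_mod_cast h1) hs4
  calc _ ≤ (5 + |s.im|) * ((Nat.card (𝓞 K)ˣ : ℝ)⁻¹ * (Ideal.absNorm (J c) : ℝ) ^ (4 : ℝ) *
        (C c * (2 + 2 * (4 + |s.im|)))) := by
        rw [norm_mul, norm_mul, norm_mul, norm_inv, Complex.norm_natCast]
        have := hC0 c
        gcongr
        refine (hC c _ (by rw [hre]; gcongr)).trans ?_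
        gcongr
    _ = ((5 + |s.im|) * (10 + 2 * |s.im|)) *
        ((Nat.card (𝓞 K)ˣ : ℝ)⁻¹ * (Ideal.absNorm (J c) : ℝ) ^ (4 : ℝ) * C c) := by ring
    _ ≤ (50 * (1 + |s.im|) ^ 2) *
        ((Nat.card (𝓞 K)ˣ : ℝ)⁻¹ * (Ideal.absNorm (J c) : ℝ) ^ (4 : ℝ) * C c) := by
        have := hC0 c
        exact mul_le_mul_of_nonneg_right (by nlinarith) (by positivity)
    _ = _ := by ring

end ZetaBound

theorem exists_le_norm_of_hasSum_inv {ζK : ℂ → ℂ} {b : ℕ → ℝ} (hζ₀ : ∀ s : ℂ, 1 < s.re → ζK s ≠ 0)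
    (hb : ∀ s : ℂ, 1 < s.re →
      HasSum (fun m : ℕ => (b m : ℂ) * (m : ℂ) ^ (-s)) (ζK s)⁻¹) :
    ∃ c : ℝ, 0 < c ∧ ∀ t : ℝ, c ≤ ‖ζK (2 + t * I)‖ := by
  have hnorm (t : ℝ) (m : ℕ) : ‖(b m : ℂ) * (m : ℂ) ^ (-(2 + t * I))‖ =
      ‖(b m : ℂ) * (m : ℂ) ^ (-(2 : ℂ))‖ := by
    rw [norm_mul, norm_mul, norm_natCast_cpow_of_re_ne_zero _ (by simp),
      norm_natCast_cpow_of_re_ne_zero _ (by simp)]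
    simp
  have hs := (hb 2 (by simp)).summable.norm
  have hM : 0 ≤ ∑' m : ℕ, ‖(b m : ℂ) * (m : ℂ) ^ (-(2 : ℂ))‖ := tsum_nonneg fun _ => norm_nonneg _
  refine ⟨(∑' m : ℕ, ‖(b m : ℂ) * (m : ℂ) ^ (-(2 : ℂ))‖ + 1)⁻¹, by positivity, fun t => ?_⟩
  have ht : 1 < (2 + t * I : ℂ).re := by simp
  have h := tsum_of_norm_bounded hs.hasSum fun m => (hnorm t m).le
  rw [(hb _ ht).tsum_eq, norm_inv] at h
  exact inv_le_of_inv_le₀ (norm_pos_iff.mpr (hζ₀ _ ht)) (by linarith)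

/-- Riesz-type criterion, part 2(b): if `r = r₁ + r₂ - 1 = 0` (i.e. `K = ℚ` or `K`
imaginary quadratic), then GRH for `ζK` implies `𝒫_{r₁,r₂}(y) = O(y^{-1/4+δ})` as
`y → ∞`, for every `δ > 0`. -/
theorem GRH_implies_riesz_estimate_r_eq_zero
    (K : Type*) [Field K] [NumberField K] (ζK : ℂ → ℂ)
    (hζ_an : ∀ s : ℂ, s ≠ 1 → DifferentiableAt ℂ ζK s)
    (hζ_ser : ∀ s : ℂ, 1 < s.re →
      HasSum (fun I : {I : Ideal (𝓞 K) // I ≠ ⊥} =>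
        ((Ideal.absNorm I.1 : ℕ) : ℂ) ^ (-s)) (ζK s))
    (hζ_pole : ∃ A : ℂ, A ≠ 0 ∧
      Tendsto (fun s : ℂ => (s - 1) * ζK s) (𝓝[≠] (1 : ℂ)) (𝓝 A))
    (b : ℕ → ℝ)
    (hb : ∀ s : ℂ, 1 < s.re →
      HasSum (fun m : ℕ => (b m : ℂ) * (m : ℂ) ^ (-s)) (ζK s)⁻¹)
    (r₁ r₂ : ℕ)
    (hr₁ : r₁ = InfinitePlace.nrRealPlaces K)
    (hr₂ : r₂ = InfinitePlace.nrComplexPlaces K)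
    (hrzero : r₁ + r₂ - 1 = 0)
    (hGRH : ∀ ρ : ℂ, ζK ρ = 0 → 0 < ρ.re → ρ.re < 1 → ρ.re = 1/2) :
    ∀ δ : ℝ, 0 < δ →
      (fun y : ℝ => P r₁ r₂ b y) =O[atTop] fun y : ℝ => y ^ (-(1/4 : ℝ) + δ) := by
  intro δ hδ
  obtain ⟨A, hA0, hA⟩ := hζ_pole
  have hcard : Fintype.card (InfinitePlace K) = r₁ + r₂ := by
    rw [hr₁, hr₂, InfinitePlace.card_eq_nrRealPlaces_add_nrComplexPlaces]
  have hcard1 : Fintype.card (InfinitePlace K) = 1 := by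
    have : 0 < Fintype.card (InfinitePlace K) := Fintype.card_pos
    lia
  obtain ⟨_⟩ := Fintype.card_eq_one_iff_nonempty_unique.mp hcard1
  have hrank : r₁ + 2 * r₂ = Module.finrank ℚ K := by
    rw [hr₁, hr₂, InfinitePlace.card_add_two_mul_card_eq_rank]
  have hζ₁ (s : ℂ) (hs : 1 < s.re) : ζK s ≠ 0 := zeta_ne_zero_of_one_lt_re hζ_ser hs
  obtain ⟨G, hGdef⟩ : ∃ G : ℂ → ℂ, G = Function.update (fun s => (s - 1) * ζK s) 1 A := ⟨_, rfl⟩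
  have hG1 : G 1 = A := by rw [hGdef, Function.update_self]
  have hGne {s : ℂ} (hs : s ≠ 1) : G s = (s - 1) * ζK s := by
    rw [hGdef, Function.update_of_ne hs]
  have hne {s : ℂ} (hs : 1 < s.re) : s ≠ 1 := fun h => by
    rw [h, one_re] at hs
    exact lt_irrefl _ hs
  have hGζ (s : ℂ) (hs : 1 < s.re) : G s = (s - 1) * ζK s := hGne (hne hs)
  have hG' {s : ℂ} (hs : s ≠ 1) : DifferentiableAt ℂ G s := by
    refine DifferentiableAt.congr_of_eventuallyEq (f := fun s => (s - 1) * ζK s) ?_ ?_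
    · exact DifferentiableAt.mul (by fun_prop) (hζ_an s hs)
    · filter_upwards [isOpen_ne.mem_nhds hs] with z hz using hGne hz
  have hGd : DifferentiableOn ℂ G {s | 1 / 2 < s.re} := by
    intro s _
    refine DifferentiableAt.differentiableWithinAt ?_
    rcases eq_or_ne s 1 with rfl | hs
    · refine (analyticAt_of_differentiable_on_punctured_nhds_of_continuousAt
        (eventually_nhdsWithin_of_forall fun z hz => hG' hz) ?_).differentiableAt
      rw [hGdef]
      exact continuousAt_update_same.mpr hA
    · exact hG' hs
  have hG₀ (s : ℂ) (hs : 1 / 2 < s.re) : G s ≠ 0 := by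
    rcases eq_or_ne s 1 with rfl | hs1
    · rwa [hG1]
    rw [hGne hs1]
    refine mul_ne_zero (sub_ne_zero.mpr hs1) ?_
    rcases lt_trichotomy s.re 1 with h | h | h
    · exact fun h0 => absurd (hGRH s h0 (by linarith) h) hs.ne'
    · exact zeta_ne_zero_of_re_eq_one hζ_ser hζ_an hA h hs1
    · exact hζ₁ s h
  obtain ⟨c, hc, hcζ⟩ := exists_le_norm_of_hasSum_inv hζ₁ hb
  have hGc (t : ℝ) : c ≤ ‖G (2 + t * I)‖ := by
    rw [hGζ _ (by simp), norm_mul]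
    have h1 : 1 ≤ ‖(2 + t * I - 1 : ℂ)‖ := by
      refine le_trans (le_of_eq ?_) (re_le_norm _)
      simp
      norm_num
    exact (hcζ t).trans (le_mul_of_one_le_left (norm_nonneg _) h1)
  have hGle (η : ℝ) (hη : 0 < η) := exists_norm_le_of_norm_one_sub_two_cpow_mul_le hGd
    (Module.finrank_pos (R := ℚ) (M := K))
    (fun η hη => exists_norm_one_sub_two_cpow_mul_le hζ_ser hGd hGζ (by lia) hη) hη
  have hb' (s : ℂ) (hs : 1 < s.re) :
      HasSum (fun m : ℕ => (b m : ℂ) * (m : ℂ) ^ (-s)) ((s - 1) / G s) := by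
    rw [hGζ s hs, div_mul_cancel_left₀ (sub_ne_zero.mpr (hne hs))]
    exact hb s hs
  have key {κ : ℝ} (hκ₀ : 0 < κ) (hκ₁ : κ ≤ 1) := isBigO_tsum_mellinInv_Gamma hκ₀ hκ₁ hGd hG₀
    (fun η hη => exists_norm_inv_le hGd hG₀ hc hGc hGle hη) hb' hδ
  unfold P Z
  obtain ⟨rfl, rfl⟩ | ⟨rfl, rfl⟩ : r₁ = 1 ∧ r₂ = 0 ∨ r₁ = 0 ∧ r₂ = 1 := by lia
  · have h : (fun s : ℂ => Gamma (s / 2) ^ 1 * Gamma s ^ 0) =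
        fun s => Gamma (((1 / 2 : ℝ) : ℂ) * s) := by
      ext s
      rw [pow_one, pow_zero, mul_one]
      congr 1
      push_cast
      ring
    rw [h]
    exact key (by norm_num) (by norm_num)
  · have h : (fun s : ℂ => Gamma (s / 2) ^ 0 * Gamma s ^ 1) =
        fun s => Gamma (((1 : ℝ) : ℂ) * s) := by
      ext s
      rw [pow_one, pow_zero, one_mul, ofReal_one, one_mul]
    rw [h]
    exact key one_pos le_rfl
end
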